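/- Let n ≡ 1 (mod 4), n ≥ 5, and suppose the structure group of Sⁿ reduces to a closed connected subgroup G' of the standard SO(n−1) ⊆ SO(n). Then G' acts transitively on the sphere S^{n-2}. -/

import Mathlib

/-- The special orthogonal group SO(n) as a set of matrices. -/
def SOSet (n : ℕ) : Set (Matrix (Fin n) (Fin n) ℝ) :=
  {A | A * A.transpose = 1 ∧ A.det = 1}

/-- The characteristic (clutching) map of the tangent bundle of Sⁿ: for x in the equator
S^{n-1} ⊆ ℝⁿ, the reflection through x^⊥ composed with a fixed reflection, an element
of SO(n). -/
noncomputable def charMatrix (n : ℕ) (x : EuclideanSpace ℝ (Fin n)) :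
    Matrix (Fin n) (Fin n) ℝ :=
  (1 - (2 : ℝ) • Matrix.vecMulVec (fun i => x i) (fun i => x i)) *
    Matrix.diagonal (fun i : Fin n => if i.val = 0 then (-1 : ℝ) else 1)

/-- The structure group of Sⁿ reduces to a subgroup G ⊆ GL(n,ℝ) (a set of matrices):
the characteristic map χₙ : S^{n-1} → SO(n) ⊆ GL(n,ℝ) is homotopic, through invertible
matrices, to a map with image in G. -/
def SphereStructureGroupReducesTo (n : ℕ) (G : Set (Matrix (Fin n) (Fin n) ℝ)) : Prop :=
  ∃ χ g : C(Metric.sphere (0 : EuclideanSpace ℝ (Fin n)) 1, Matrix (Fin n) (Fin n) ℝ),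
    (∀ x : Metric.sphere (0 : EuclideanSpace ℝ (Fin n)) 1, χ x = charMatrix n ↑x) ∧
    (∀ x, g x ∈ G) ∧
    ContinuousMap.HomotopicWith χ g fun h => ∀ x, IsUnit (h x)

open Module Submodule
open scoped InnerProductSpace

/-- A finite-dimensional real space with a complex structure has even dimension. -/
theorem even_finrank_of_comp_self_eq_neg {V : Type*} [AddCommGroup V] [Module ℝ V]
    (J : V →ₗ[ℝ] V) (hJ : ∀ v, J (J v) = -v) : Even (finrank ℝ V) := by
  have h : J ∘ₗ J = (-1 : ℝ) • LinearMap.id := by ext v; simp [hJ]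
  have h2 := congrArg LinearMap.det h
  rw [LinearMap.det_comp, LinearMap.det_smul, LinearMap.det_id, mul_one] at h2
  by_contra hodd
  rw [Nat.not_even_iff_odd] at hodd
  rw [hodd.neg_one_pow] at h2
  nlinarith [mul_self_nonneg (LinearMap.det J)]

/-- The rank of a skew-symmetric endomorphism is even. -/
theorem even_finrank_range_of_inner_self_eq_zero {V : Type*} [NormedAddCommGroup V]
    [InnerProductSpace ℝ V] [FiniteDimensional ℝ V] (T : V →ₗ[ℝ] V)
    (hT : ∀ v, ⟪T v, v⟫_ℝ = 0) : Even (finrank ℝ (LinearMap.range T)) := by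
  have hskew : ∀ v w, ⟪T v, w⟫_ℝ = -⟪v, T w⟫_ℝ := by
    intro v w
    have := hT (v + w)
    simp only [map_add, inner_add_left, inner_add_right, hT] at this
    rw [real_inner_comm (T w) v]; linarith
  let S : LinearMap.range T →ₗ[ℝ] LinearMap.range T :=
    T.restrict (fun x _ => LinearMap.mem_range_self T x)
  have hSker : LinearMap.ker S = ⊥ := by
    rw [LinearMap.ker_eq_bot']
    rintro ⟨x, y, rfl⟩ hx
    have hx' : T (T y) = 0 := congrArg Subtype.val hx
    have : ⟪T y, T y⟫_ℝ = 0 := by rw [hskew, hx', inner_zero_right, neg_zero]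
    ext
    simpa using this
  have hadj : LinearMap.adjoint S = (-1 : ℝ) • S := by
    symm
    rw [LinearMap.eq_adjoint_iff]
    intro x y
    have := hskew x y
    simp only [LinearMap.smul_apply, neg_smul, one_smul, inner_neg_left]
    change -⟪T x, (y : V)⟫_ℝ = ⟪(x : V), T y⟫_ℝ
    linarith
  have hdet := congrArg LinearMap.det hadj
  let b := stdOrthonormalBasis ℝ (LinearMap.range T)
  rw [LinearMap.det_smul, ← LinearMap.det_toMatrix b.toBasis, LinearMap.toMatrix_adjoint,
    Matrix.det_conjTranspose, LinearMap.det_toMatrix, star_trivial] at hdet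
  have hne : LinearMap.det S ≠ 0 := by
    have : IsUnit S := (LinearMap.isUnit_iff_ker_eq_bot S).2 hSker
    exact (LinearMap.isUnit_iff_isUnit_det S).1 this |>.ne_zero
  by_contra hodd
  rw [Nat.not_even_iff_odd] at hodd
  rw [hodd.neg_one_pow] at hdet
  simp at hdet
  apply hne; linarith

section

variable {H S : Type*} [NormedAddCommGroup H] [InnerProductSpace ℝ H] [CompleteSpace H]
  [AddCommGroup S] [Module ℝ S] (ι : S →ₗ[ℝ] H) (D : S →ₗ[ℝ] S)

/-- The inverse of a skew operator that is bounded below on the orthogonal complement of `E`. -/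
theorem exists_skew_inverse (hD : ∀ f g, ⟪ι (D f), ι g⟫_ℝ = -⟪ι f, ι (D g)⟫_ℝ)
    (V : ℕ → Submodule ℝ S) (hmono : Monotone V) (hfin : ∀ k, FiniteDimensional ℝ (V k))
    (hVD : ∀ k, ∀ f ∈ V k, D f ∈ V k)
    (hdense : ∀ f, ∀ ε > 0, ∃ k, ∃ g ∈ V k, ‖ι f - ι g‖ < ε)
    (hι : DenseRange ι) (k : ℕ) (M : ℝ) (hM : 0 < M)
    (hgrow : ∀ l, ∀ f ∈ V l, (∀ g ∈ V k, ⟪ι f, ι g⟫_ℝ = 0) → M * ‖ι f‖ ≤ ‖ι (D f)‖) :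
    ∃ R : ((V k).map ι)ᗮ →L[ℝ] H, ‖R‖ ≤ M⁻¹ ∧ (∀ h, R h ∈ ((V k).map ι)ᗮ) ∧
      (∀ (h : ((V k).map ι)ᗮ) (s : S), ⟪R h, ι (D s)⟫_ℝ = -⟪(h : H), ι s⟫_ℝ) ∧
      (∀ h : ((V k).map ι)ᗮ, ⟪(h : H), R h⟫_ℝ = 0) ∧
      ∀ y : H, (∀ f, (∀ g ∈ V k, ⟪ι f, ι g⟫_ℝ = 0) → ⟪y, ι (D f)⟫_ℝ = 0) →
        y ∈ (V k).map ι := by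
  have : ∀ l, FiniteDimensional ℝ ((V l).map ι) := fun l => inferInstance
  set E := (V k).map ι with hE
  have memE : ∀ f, ι f ∈ Eᗮ ↔ ∀ g ∈ V k, ⟪ι f, ι g⟫_ℝ = 0 := by
    intro f
    rw [Submodule.mem_orthogonal']
    constructor
    · intro h g hg; exact h _ (Submodule.mem_map_of_mem hg)
    · rintro h _ ⟨g, hg, rfl⟩; exact h g hg
  have hDperp : ∀ f, ι f ∈ Eᗮ → ι (D f) ∈ Eᗮ := by
    intro f hf
    rw [memE] at hf ⊢
    intro g hg
    rw [hD, hf _ (hVD k g hg), neg_zero]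
  let Q : Submodule ℝ S := (⨆ l, V l) ⊓ Eᗮ.comap ι
  have hdir : Directed (· ≤ ·) V := hmono.directed_le
  have hQ : ∀ f : Q, ∃ l, (f : S) ∈ V l := fun f =>
    (Submodule.mem_iSup_of_directed V hdir).1 f.2.1
  let e : Q →ₗ[ℝ] Eᗮ :=
    { toFun := fun f => ⟨ι (D f), hDperp _ f.2.2⟩
      map_add' := fun f g => by ext; simp
      map_smul' := fun c f => by ext; simp }
  let F : Q →ₗ[ℝ] H := ι ∘ₗ Q.subtype
  -- vectors annihilated by the image of `D` on `Q`
  have key : ∀ u ∈ Eᗮ, (∀ f : Q, ⟪u, ι (D f)⟫_ℝ = 0) → u = 0 := by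
    intro u hu hu0
    have horth : ∀ l, k ≤ l → ∀ g ∈ V l, ⟪u, ι g⟫_ℝ = 0 := by
      intro l hkl g hg
      obtain ⟨p, hp, hpu⟩ := HasOrthogonalProjection.exists_orthogonal (K := (V l).map ι) u
      obtain ⟨h, hh, rfl⟩ := hp
      have hperp : ∀ g ∈ V l, ⟪u, ι g⟫_ℝ = ⟪ι h, ι g⟫_ℝ := by
        intro g hg
        have := (Submodule.mem_orthogonal' _ _).1 hpu (ι g) (Submodule.mem_map_of_mem hg)
        rw [inner_sub_left] at this; linarith
      have hhE : ι h ∈ Eᗮ := by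
        rw [memE]
        intro g hg
        rw [← hperp g (hmono hkl hg)]
        exact (Submodule.mem_orthogonal' _ _).1 hu _ (Submodule.mem_map_of_mem hg)
      have hhQ : h ∈ Q := ⟨Submodule.mem_iSup_of_mem l hh, hhE⟩
      have hDh : D h ∈ Q := ⟨Submodule.mem_iSup_of_mem l (hVD l h hh), hDperp h hhE⟩
      have h1 := hu0 ⟨D h, hDh⟩
      rw [hperp _ (hVD l _ (hVD l h hh))] at h1
      have h2 : ⟪ι (D h), ι (D h)⟫_ℝ = 0 := by rw [hD]; simpa using h1
      have h3 : ι (D h) = 0 := inner_self_eq_zero.1 h2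
      have h4 := hgrow l h hh ((memE h).1 hhE)
      rw [h3, norm_zero] at h4
      have h5 : ι h = 0 := by
        rw [← norm_le_zero_iff]
        by_contra hc
        push Not at hc
        nlinarith
      rw [hperp g hg, h5, inner_zero_left]
    have hall : ∀ x : H, ⟪u, x⟫_ℝ = 0 := by
      intro x
      refine hι.induction_on (p := fun x => ⟪u, x⟫_ℝ = 0) x
        (isClosed_eq (by fun_prop) (by fun_prop)) ?_
      intro f
      by_contra hne
      obtain ⟨l, g, hg, hlt⟩ := hdense f (|⟪u, ι f⟫_ℝ| / (‖u‖ + 1)) (by positivity)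
      have hg' := horth (max k l) (le_max_left _ _) g (hmono (le_max_right _ _) hg)
      have : |⟪u, ι f⟫_ℝ| ≤ ‖u‖ * ‖ι f - ι g‖ := by
        have h1 := abs_real_inner_le_norm u (ι f - ι g)
        rwa [inner_sub_right, hg', sub_zero] at h1
      rw [lt_div_iff₀ (by positivity)] at hlt
      nlinarith [norm_nonneg u, norm_nonneg (ι f - ι g), abs_pos.2 hne]
    exact inner_self_eq_zero.1 (hall u)
  have he : DenseRange e := by
    have : (LinearMap.range e).topologicalClosure = ⊤ := by
      rw [Submodule.topologicalClosure_eq_top_iff, Submodule.eq_bot_iff]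
      intro u hu
      rw [Submodule.mem_orthogonal'] at hu
      have := key u u.2 (fun f => hu (e f) (LinearMap.mem_range_self e f))
      exact Subtype.ext this
    have h2 := (Submodule.dense_iff_topologicalClosure_eq_top).2 this
    rwa [LinearMap.coe_range] at h2
  have hF : ∀ f : Q, ‖F f‖ ≤ M⁻¹ * ‖e f‖ := by
    intro f
    obtain ⟨l, hl⟩ := hQ f
    have := hgrow l f hl ((memE _).1 f.2.2)
    rw [inv_mul_eq_div, le_div_iff₀ hM, mul_comm]
    exact this
  have hR : ∀ f : Q, F.extendOfNorm e (e f) = ι f := fun f =>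
    LinearMap.extendOfNorm_eq he ⟨_, hF⟩ f
  refine ⟨F.extendOfNorm e, LinearMap.opNorm_extendOfNorm_le he (by positivity) hF, ?_, ?_, ?_, ?_⟩
  · intro h
    refine he.induction_on (p := fun h : Eᗮ => F.extendOfNorm e h ∈ Eᗮ) h
      ((Submodule.isClosed_orthogonal E).preimage (F.extendOfNorm e).continuous) ?_
    intro f
    rw [hR]; exact f.2.2
  · intro h s
    refine he.induction_on (p := fun h : Eᗮ => ⟪F.extendOfNorm e h, ι (D s)⟫_ℝ = -⟪(h : H), ι s⟫_ℝ) h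
      (isClosed_eq (by fun_prop) (by fun_prop)) ?_
    intro f
    rw [hR]
    have := hD f s
    change _ = -⟪ι (D f), ι s⟫_ℝ
    linarith
  · intro h
    refine he.induction_on (p := fun h : Eᗮ => ⟪(h : H), F.extendOfNorm e h⟫_ℝ = 0) h
      (isClosed_eq (by fun_prop) (by fun_prop)) ?_
    intro f
    rw [hR]
    change ⟪ι (D f), ι f⟫_ℝ = 0
    have := hD f f
    rw [real_inner_comm] at this ⊢
    rw [real_inner_comm] at this
    linarith [real_inner_comm (ι (f : S)) (ι (D f))]
  · intro y hy
    rw [← Submodule.orthogonal_orthogonal E, Submodule.mem_orthogonal']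
    intro x hx
    refine he.induction_on (p := fun x : Eᗮ => ⟪y, (x : H)⟫_ℝ = 0) ⟨x, hx⟩
      (isClosed_eq (by fun_prop) (by fun_prop)) ?_
    intro f
    exact hy f ((memE _).1 f.2.2)

end

theorem inner_map_eq_neg_of_dense {H S : Type*} [NormedAddCommGroup H] [InnerProductSpace ℝ H]
    [AddCommGroup S] [Module ℝ S] {ι : S →ₗ[ℝ] H} (hι : DenseRange ι)
    (B : H →L[ℝ] H)
    (hB : ∀ f g, ⟪B (ι f), ι g⟫_ℝ = -⟪ι f, B (ι g)⟫_ℝ) (x y : H) :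
    ⟪B x, y⟫_ℝ = -⟪x, B y⟫_ℝ := by
  refine hι.induction_on (p := fun x => ⟪B x, y⟫_ℝ = -⟪x, B y⟫_ℝ) x
    (isClosed_eq (by fun_prop) (by fun_prop)) fun f => ?_
  exact hι.induction_on (p := fun y => ⟪B (ι f), y⟫_ℝ = -⟪ι f, B y⟫_ℝ) y
    (isClosed_eq (by fun_prop) (by fun_prop)) fun g => hB f g

section

variable {H S : Type*} [NormedAddCommGroup H] [InnerProductSpace ℝ H] [CompleteSpace H]
  [AddCommGroup S] [Module ℝ S]

/-- An endomorphism of `S` that is bounded for the seminorm pulled back along a map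
`ι : S → H` with dense range induces a bounded operator on `H`. -/
theorem exists_extension_of_norm_le {ι : S →ₗ[ℝ] H} (hι : DenseRange ι) (B : S →ₗ[ℝ] S)
    {c : ℝ} (hc : 0 ≤ c) (hB : ∀ f, ‖ι (B f)‖ ≤ c * ‖ι f‖) :
    ∃ B' : H →L[ℝ] H, ‖B'‖ ≤ c ∧ ∀ f, B' (ι f) = ι (B f) :=
  ⟨(ι ∘ₗ B).extendOfNorm ι, LinearMap.opNorm_extendOfNorm_le hι hc hB,
    fun f => LinearMap.extendOfNorm_eq hι ⟨c, hB⟩ f⟩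

/-- Vanishing of the mod 2 index: a skew operator with a bounded commutator with a complex
structure cannot have a one-dimensional kernel. -/
theorem false_of_skew_of_kernel_line {ι : S →ₗ[ℝ] H} (hι : DenseRange ι) (D J : S →ₗ[ℝ] S)
    (hD : ∀ f g, ⟪ι (D f), ι g⟫_ℝ = -⟪ι f, ι (D g)⟫_ℝ)
    (hJ : ∀ f g, ⟪ι (J f), ι g⟫_ℝ = -⟪ι f, ι (J g)⟫_ℝ)
    (hJJ : ∀ f, ι (J (J f)) = -ι f)
    {c : ℝ} (hc : 0 ≤ c) (hDJ : ∀ f, ‖ι (D (J f)) - ι (J (D f))‖ ≤ c * ‖ι f‖)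
    (V : ℕ → Submodule ℝ S) (hmono : Monotone V) (hfin : ∀ k, FiniteDimensional ℝ (V k))
    (hVD : ∀ k, ∀ f ∈ V k, D f ∈ V k)
    (hdense : ∀ f, ∀ ε > 0, ∃ k, ∃ g ∈ V k, ‖ι f - ι g‖ < ε)
    (hgrow : ∀ M : ℝ, ∃ k, ∀ l, ∀ f ∈ V l, (∀ g ∈ V k, ⟪ι f, ι g⟫_ℝ = 0) →
      M * ‖ι f‖ ≤ ‖ι (D f)‖)
    (e : S) (heV : e ∈ V 0) (he0 : ι e ≠ 0) (hDe : ι (D e) = 0)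
    (hker : ∀ k, ∀ f ∈ V k, ι (D f) = 0 → ∃ a : ℝ, ι f = a • ι e) : False := by
  -- the operators on `H`
  have hnormJ : ∀ f, ‖ι (J f)‖ ≤ 1 * ‖ι f‖ := by
    intro f
    have : ⟪ι (J f), ι (J f)⟫_ℝ = ⟪ι f, ι f⟫_ℝ := by rw [hJ, hJJ]; simp
    rw [real_inner_self_eq_norm_sq, real_inner_self_eq_norm_sq] at this
    rw [one_mul]
    nlinarith [norm_nonneg (ι (J f)), norm_nonneg (ι f)]
  obtain ⟨J', -, hJ'⟩ := exists_extension_of_norm_le hι J zero_le_one hnormJ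
  have hJ'J' : ∀ x, J' (J' x) = -x := fun x =>
    hι.induction_on (p := fun x => J' (J' x) = -x) x
      (isClosed_eq (by fun_prop) (by fun_prop)) fun f => by rw [hJ', hJ', hJJ]
  have hJ's := inner_map_eq_neg_of_dense hι J' (fun f g => by rw [hJ', hJ', hJ])
  have hnormJ' : ∀ x, ‖J' x‖ = ‖x‖ := by
    intro x
    have : ⟪J' x, J' x⟫_ℝ = ⟪x, x⟫_ℝ := by rw [hJ's, hJ'J']; simp
    rw [real_inner_self_eq_norm_sq, real_inner_self_eq_norm_sq] at this
    exact (sq_eq_sq₀ (norm_nonneg _) (norm_nonneg _)).1 this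
  have hD0 : ∀ f, ι f = 0 → ι (D f) = 0 := by
    intro f hf
    refine inner_self_eq_zero (𝕜 := ℝ).1 ?_
    rw [hD, hf, inner_zero_left, neg_zero]
  have hDcongr : ∀ f g, ι f = ι g → ι (D f) = ι (D g) := by
    intro f g h
    have := hD0 (f - g) (by rw [map_sub, h, sub_self])
    rwa [map_sub, map_sub, sub_eq_zero] at this
  have hDJJ : ∀ f, ι (D (J (J f))) = -ι (D f) := by
    intro f
    rw [← map_neg, ← map_neg]
    exact hDcongr _ _ (by rw [hJJ, map_neg])
  let B : S →ₗ[ℝ] S := (-(1 / 2) : ℝ) • (J ∘ₗ D ∘ₗ J + D)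
  have hBdef : ∀ f, ι (B f) = (-(1 / 2) : ℝ) • (J' (ι (D (J f))) + ι (D f)) := by
    intro f
    simp [B, hJ']
  have hBnorm : ∀ f, ‖ι (B f)‖ ≤ c / 2 * ‖ι f‖ := by
    intro f
    have h1 : J' (ι (D (J f))) + ι (D f) = J' (ι (D (J f)) - ι (J (D f))) := by
      rw [map_sub, ← hJ' (D f), hJ'J', sub_neg_eq_add]
    rw [hBdef, h1, norm_smul, hnormJ']
    have := hDJ f
    norm_num
    linarith
  obtain ⟨K, hKnorm, hK⟩ := exists_extension_of_norm_le hι B (by positivity) hBnorm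
  have hKs : ∀ x y, ⟪K x, y⟫_ℝ = -⟪x, K y⟫_ℝ := by
    refine inner_map_eq_neg_of_dense hι K fun f g => ?_
    have h1 : ⟪J' (ι (D (J f))), ι g⟫_ℝ = -⟪ι f, J' (ι (D (J g)))⟫_ℝ := by
      rw [hJ's, hJ', hD, hJ, hJ', neg_neg]
    rw [hK, hK, hBdef, hBdef, real_inner_smul_left, real_inner_smul_right, inner_add_left,
      inner_add_right, h1, hD]
    ring
  have hBJ : ∀ f, ι (J (D f)) = ι (D (J f)) + ι (B (J f)) - ι (J (B f)) := by
    intro f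
    rw [← hJ' (B f), hBdef, hBdef, hDJJ, map_smul, map_add, hJ'J', map_neg, ← hJ']
    module
  let N : Submodule ℝ H :=
    { carrier := {u | ∀ s, ⟪u, ι (D s)⟫_ℝ = ⟪K u, ι s⟫_ℝ}
      add_mem' := fun {u v} hu hv s => by
        rw [inner_add_left, hu, hv, map_add, inner_add_left]
      zero_mem' := fun s => by simp
      smul_mem' := fun a u hu s => by
        rw [map_smul, inner_smul_left, inner_smul_left, hu] }
  have hNJ : ∀ u ∈ N, J' u ∈ N := by
    intro u hu s
    rw [hJ's, hJ', hBJ, inner_sub_right, inner_add_right, hu, ← hK, hKs u, ← hJ' (B s), ← hK,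
      hKs (J' u), hJ's]
    ring
  have hNeven : Even (finrank ℝ N) :=
    even_finrank_of_comp_self_eq_neg ((J' : H →ₗ[ℝ] H).restrict hNJ)
      fun v => Subtype.ext (hJ'J' v)
  -- the finite-dimensional reduction
  obtain ⟨k, hk⟩ := hgrow (c + 1)
  set E := (V k).map ι with hE
  obtain ⟨R, hRnorm, hRperp, hRD, hRs, hRE⟩ :=
    exists_skew_inverse ι D hD V hmono hfin hVD hdense hι k (c + 1) (by positivity) hk
  have := hfin k
  have : FiniteDimensional ℝ E := by rw [hE]; infer_instance
  let Q : H →L[ℝ] Eᗮ := Eᗮ.orthogonalProjectionOnto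
  let P : H →L[ℝ] E := E.orthogonalProjectionOnto
  have hQE : ∀ x, ∀ y ∈ E, ⟪(Q x : H), y⟫_ℝ = 0 := fun x y hy =>
    (Submodule.mem_orthogonal' _ _).1 (Q x).2 y hy
  have hPQ : ∀ x, (P x : H) + Q x = x := fun x => Submodule.starProjection_add_starProjection_orthogonal (K := E) x
  have hPE : ∀ x, ∀ y ∈ E, ⟪(P x : H), y⟫_ℝ = ⟪x, y⟫_ℝ := fun x y hy => by
    conv_rhs => rw [← hPQ x, inner_add_left, hQE x y hy, add_zero]
  have hQx : ∀ x, ∀ y ∈ Eᗮ, ⟪(Q x : H), y⟫_ℝ = ⟪x, y⟫_ℝ := fun x y hy => by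
    conv_rhs => rw [← hPQ x, inner_add_left, (Submodule.mem_orthogonal _ _).1 hy _ (P x).2, zero_add]
  let A : H →L[ℝ] H := R ∘L Q ∘L K
  have hA : ∀ u, A u = R (Q (K u)) := fun u => rfl
  have hAnorm : ‖-A‖ < 1 := by
    have hQ1 : ‖Q‖ ≤ 1 := Submodule.orthogonalProjectionOnto_norm_le _
    have h1 : ‖Q ∘L K‖ ≤ c / 2 := by
      refine (ContinuousLinearMap.opNorm_comp_le _ _).trans ?_
      nlinarith [norm_nonneg Q, norm_nonneg K]
    have h2 : ‖A‖ ≤ (c + 1)⁻¹ * (c / 2) :=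
      (ContinuousLinearMap.opNorm_comp_le _ _).trans
        (mul_le_mul hRnorm h1 (norm_nonneg _) (by positivity))
    rw [norm_neg]
    refine h2.trans_lt ?_
    rw [inv_mul_lt_iff₀ (by positivity)]
    linarith
  let U : (H →L[ℝ] H)ˣ := Units.oneSub (-A) hAnorm
  have hU : ∀ u, (U : H →L[ℝ] H) u = u + R (Q (K u)) := fun u => by simp [U, hA]
  let G : H →L[ℝ] H := (U⁻¹ : (H →L[ℝ] H)ˣ)
  have hUG : ∀ v, G v + R (Q (K (G v))) = v := fun v => by
    rw [← hU, ← mul_apply_eq_comp, U.mul_inv]; rfl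
  have hGU : ∀ u, G (u + R (Q (K u))) = u := fun u => by
    rw [← hU, ← mul_apply_eq_comp, U.inv_mul]; rfl
  -- the restriction of `D` to `E`
  let p : V k →ₗ[ℝ] E := (ι ∘ₗ (V k).subtype).codRestrict E fun f => mem_map_of_mem f.2
  have hp : LinearMap.range p = ⊤ := by
    rw [LinearMap.range_eq_top]
    rintro ⟨_, f, hf, rfl⟩
    exact ⟨⟨f, hf⟩, rfl⟩
  obtain ⟨σ, hσ⟩ := LinearMap.exists_rightInverse_of_surjective p hp
  have hσ' : ∀ v : E, ι (σ v) = v := fun v =>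
    congrArg Subtype.val (LinearMap.congr_fun hσ v)
  let DE : E →ₗ[ℝ] E := (ι ∘ₗ D ∘ₗ (V k).subtype ∘ₗ σ).codRestrict E
    fun v => mem_map_of_mem (hVD k _ (σ v).2)
  have hDE : ∀ v : E, (DE v : H) = ι (D (σ v)) := fun v => rfl
  have hDEinner : ∀ (v : E) s, ⟪(DE v : H), ι s⟫_ℝ = -⟪(v : H), ι (D s)⟫_ℝ := fun v s => by
    rw [hDE, hD, hσ']
  have hself : ∀ T : H →L[ℝ] H, (∀ x y, ⟪T x, y⟫_ℝ = -⟪x, T y⟫_ℝ) → ∀ x, ⟪T x, x⟫_ℝ = 0 :=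
    fun T hT x => by
      have := hT x x
      rw [real_inner_comm x (T x)] at this ⊢
      linarith
  have hDEself : ∀ v : E, ⟪DE v, v⟫_ℝ = 0 := by
    intro v
    have h1 : ⟪ι (D (σ v)), ι (σ v)⟫_ℝ = 0 := by
      have := hD (σ v) (σ v)
      rw [real_inner_comm (ι (σ v)) (ι (D (σ v)))] at this ⊢
      linarith
    rw [hσ'] at h1
    exact h1
  have hDEker : finrank ℝ (LinearMap.ker DE) = 1 := by
    have heE : ι e ∈ E := mem_map_of_mem (hmono (Nat.zero_le k) heV)
    have : LinearMap.ker DE = ℝ ∙ (⟨ι e, heE⟩ : E) := by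
      ext v
      rw [LinearMap.mem_ker, Submodule.mem_span_singleton]
      constructor
      · intro hv
        obtain ⟨a, ha⟩ := hker k (σ v) (σ v).2 (congrArg Subtype.val hv)
        exact ⟨a, Subtype.ext (by rw [← hσ' v, ha]; rfl)⟩
      · rintro ⟨a, rfl⟩
        rw [map_smul]
        have : DE ⟨ι e, heE⟩ = 0 :=
          Subtype.ext ((hDcongr _ e (hσ' _)).trans hDe)
        rw [this, smul_zero]
    rw [this]
    exact finrank_span_singleton fun h => he0 (congrArg Subtype.val h)
  have hEodd : Odd (finrank ℝ E) := by
    rw [← LinearMap.finrank_range_add_finrank_ker DE, hDEker]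
    exact (even_finrank_range_of_inner_self_eq_zero DE hDEself).add_one
  -- the perturbed operator
  let T : E →ₗ[ℝ] E := DE + (P ∘L K ∘L G ∘L E.subtypeL : E →L[ℝ] E)
  have hT : ∀ v, T v = DE v + P (K (G v)) := fun v => rfl
  have hTself : ∀ v : E, ⟪T v, v⟫_ℝ = 0 := by
    intro v
    rw [hT, inner_add_left, hDEself, zero_add]
    change ⟪(P (K (G v)) : H), (v : H)⟫_ℝ = 0
    rw [hPE _ _ v.2]
    conv_lhs => rw [← hUG v]
    rw [hGU, inner_add_right, hself K hKs, zero_add, ← hQx _ _ (hRperp _), hRs]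
  have hTker : Odd (finrank ℝ (LinearMap.ker T)) := by
    have h1 := LinearMap.finrank_range_add_finrank_ker T
    have h2 := even_finrank_range_of_inner_self_eq_zero T hTself
    rw [← h1] at hEodd
    exact (Nat.odd_add'.1 hEodd).2 h2
  have hNT : N.map (U : H →L[ℝ] H).toLinearMap = (LinearMap.ker T).map E.subtype := by
    ext y
    constructor
    · rintro ⟨u, hu, rfl⟩
      change (U : H →L[ℝ] H) u ∈ _
      rw [hU]
      have hy : u + R (Q (K u)) ∈ E := by
        refine hRE _ fun f hf => ?_
        have hfE : ι f ∈ Eᗮ := by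
          rw [Submodule.mem_orthogonal']
          rintro _ ⟨g, hg, rfl⟩
          exact hf g hg
        rw [inner_add_left, hu f, hRD, hQx _ _ hfE, add_neg_cancel]
      refine ⟨⟨_, hy⟩, ?_, rfl⟩
      rw [SetLike.mem_coe, LinearMap.mem_ker]
      refine inner_self_eq_zero (𝕜 := ℝ).1 ?_
      have hz : ∀ z : E, ⟪T ⟨_, hy⟩, z⟫_ℝ = 0 := by
        rintro ⟨_, g, hg, rfl⟩
        rw [hT, inner_add_left]
        change ⟪(DE ⟨_, hy⟩ : H), ι g⟫_ℝ + ⟪(P (K (G (u + R (Q (K u))))) : H), ι g⟫_ℝ = 0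
        rw [hDEinner, hPE _ _ (mem_map_of_mem hg), hGU]
        change -⟪u + R (Q (K u)), ι (D g)⟫_ℝ + _ = 0
        rw [inner_add_left, hu g, (Submodule.mem_orthogonal' _ _).1 (hRperp _) _
          (mem_map_of_mem (hVD k g hg))]
        ring
      exact hz _
    · rintro ⟨v, hv, rfl⟩
      refine ⟨G v, fun s => ?_, ?_⟩
      · have hv' : (DE v : H) + P (K (G v)) = 0 := congrArg Subtype.val (hv : T v = 0)
        have h1 : G v = v - R (Q (K (G v))) := eq_sub_of_add_eq (hUG v)
        have h2 := hDEinner v s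
        rw [eq_neg_of_add_eq_zero_left hv', inner_neg_left] at h2
        conv_rhs => rw [← hPQ (K (G v)), inner_add_left]
        have h3 := congrArg (fun x => ⟪x, ι (D s)⟫_ℝ) h1
        simp only [inner_sub_left, hRD] at h3
        linarith
      · change (U : H →L[ℝ] H) (G v) = v
        rw [hU, hUG]
  have hfinrank : finrank ℝ N = finrank ℝ (LinearMap.ker T) := by
    have hinj : Function.Injective (U : H →L[ℝ] H).toLinearMap := fun x y hxy => by
      have h3 : (U : H →L[ℝ] H) x = (U : H →L[ℝ] H) y := hxy
      rw [hU, hU] at h3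
      rw [← hGU x, ← hGU y, h3]
    rw [(Submodule.equivMapOfInjective _ hinj N).finrank_eq, hNT,
      (Submodule.equivMapOfInjective _ E.subtype_injective (LinearMap.ker T)).finrank_eq]
  rw [hfinrank] at hNeven
  exact (Nat.not_even_iff_odd.2 hTker) hNeven

end

section

variable {H S : Type*} [NormedAddCommGroup H] [InnerProductSpace ℝ H] [AddCommGroup S] [Module ℝ S]

theorem exists_mem_forall_inner_sub_eq_zero (ι : S →ₗ[ℝ] H) (P : Submodule ℝ S)
    [FiniteDimensional ℝ P] (f : S) : ∃ p ∈ P, ∀ g ∈ P, ⟪ι (f - p), ι g⟫_ℝ = 0 := by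
  have h := Submodule.starProjection_apply_mem (P.map ι) (ι f)
  obtain ⟨p, hp, h⟩ := h
  refine ⟨p, hp, fun g hg => ?_⟩
  rw [map_sub, h]
  exact Submodule.starProjection_inner_eq_zero _ _ (Submodule.mem_map_of_mem hg)

/-- A symmetric operator that is triangular with respect to a filtration is bounded below by its
diagonal entries. -/
theorem le_inner_of_triangular (ι : S →ₗ[ℝ] H) (C : S →ₗ[ℝ] S)
    (hC : ∀ f g, ⟪ι (C f), ι g⟫_ℝ = ⟪ι f, ι (C g)⟫_ℝ) (P : ℕ → Submodule ℝ S) (hP : Monotone P)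
    (hfin : ∀ k, FiniteDimensional ℝ (P k)) (μ : ℕ → ℝ) (hμ : Monotone μ)
    (h0 : ∀ f ∈ P 0, ι (C f) = 0)
    (h : ∀ k, ∀ f ∈ P (k + 1), ∃ r ∈ P k, ι (C f) = μ k • ι f + ι r)
    {l d : ℕ} {f : S} (hf : f ∈ P l) (hfd : ∀ g ∈ P d, ⟪ι f, ι g⟫_ℝ = 0) :
    μ d * ‖ι f‖ ^ 2 ≤ ⟪ι (C f), ι f⟫_ℝ := by
  have hsmall : ∀ f ∈ P d, (∀ g ∈ P d, ⟪ι f, ι g⟫_ℝ = 0) → μ d * ‖ι f‖ ^ 2 ≤ ⟪ι (C f), ι f⟫_ℝ := by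
    intro f hf hfd
    have := inner_self_eq_zero.1 (hfd f hf)
    simp [this]
  induction l generalizing f with
  | zero => exact hsmall f (hP (Nat.zero_le d) hf) hfd
  | succ l ih =>
    by_cases hl : l + 1 ≤ d
    · exact hsmall f (hP hl hf) hfd
    have hdl : d ≤ l := by omega
    obtain ⟨g, hg, hgf⟩ := exists_mem_forall_inner_sub_eq_zero ι (P l) f
    obtain ⟨e, rfl⟩ : ∃ e, f = g + e := ⟨f - g, by abel⟩
    rw [add_sub_cancel_left] at hgf
    have he : e ∈ P (l + 1) := by
      have := Submodule.sub_mem _ hf (hP (Nat.le_succ l) hg)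
      rwa [add_sub_cancel_left] at this
    have h1 := ih hg (fun q hq => by
      have := hfd q hq
      rwa [map_add, inner_add_left, hgf q (hP hdl hq), add_zero] at this)
    obtain ⟨r, hr, hCe⟩ := h l e he
    have h2 : ⟪ι (C e), ι e⟫_ℝ = μ l * ‖ι e‖ ^ 2 := by
      rw [hCe, inner_add_left, real_inner_smul_left, real_inner_comm (ι e) (ι r), hgf r hr,
        real_inner_self_eq_norm_sq, add_zero]
    have h3 : ⟪ι e, ι (C g)⟫_ℝ = 0 := by
      cases l with
      | zero => rw [h0 g hg, inner_zero_right]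
      | succ l =>
        obtain ⟨r', hr', hCg⟩ := h l g hg
        rw [hCg, inner_add_right, real_inner_smul_right, hgf g hg, hgf r' (hP (Nat.le_succ l) hr')]
        simp
    have h4 : ‖ι (g + e)‖ ^ 2 = ‖ι g‖ ^ 2 + ‖ι e‖ ^ 2 := by
      have := hgf g hg
      rw [real_inner_comm] at this
      rw [map_add, norm_add_sq_real, this]
      ring
    have h5 : ⟪ι (C (g + e)), ι (g + e)⟫_ℝ = ⟪ι (C g), ι g⟫_ℝ + μ l * ‖ι e‖ ^ 2 := by
      simp only [map_add, inner_add_left, inner_add_right]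
      rw [h2, hC e g, h3, real_inner_comm (ι e), h3]
      ring
    rw [h4, h5]
    nlinarith [hμ hdl, sq_nonneg ‖ι e‖]

theorem exists_eq_of_inner_nonpos (ι : S →ₗ[ℝ] H) (C : S →ₗ[ℝ] S)
    (hC : ∀ f g, ⟪ι (C f), ι g⟫_ℝ = ⟪ι f, ι (C g)⟫_ℝ) (P : ℕ → Submodule ℝ S) (hP : Monotone P)
    (hfin : ∀ k, FiniteDimensional ℝ (P k)) (μ : ℕ → ℝ) (hμ : Monotone μ) (hμ0 : 0 < μ 0)
    (h0 : ∀ f ∈ P 0, ι (C f) = 0)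
    (h : ∀ k, ∀ f ∈ P (k + 1), ∃ r ∈ P k, ι (C f) = μ k • ι f + ι r)
    {l : ℕ} {f : S} (hf : f ∈ P l) (hneg : ⟪ι (C f), ι f⟫_ℝ ≤ 0) : ∃ p ∈ P 0, ι f = ι p := by
  obtain ⟨g, hg, hgf⟩ := exists_mem_forall_inner_sub_eq_zero ι (P 0) f
  obtain ⟨e, rfl⟩ : ∃ e, f = g + e := ⟨f - g, by abel⟩
  rw [add_sub_cancel_left] at hgf
  have he : e ∈ P l := by
    have := Submodule.sub_mem _ hf (hP (Nat.zero_le l) hg)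
    rwa [add_sub_cancel_left] at this
  have h1 := le_inner_of_triangular ι C hC P hP hfin μ hμ h0 h he hgf
  have h2 : ⟪ι (C (g + e)), ι (g + e)⟫_ℝ = ⟪ι (C e), ι e⟫_ℝ := by
    simp only [map_add, inner_add_left, inner_add_right]
    rw [h0 g hg, hC e g, h0 g hg]
    simp
  refine ⟨g, hg, ?_⟩
  have h3 : ‖ι e‖ ^ 2 = 0 := le_antisymm (by
    by_contra! h4
    nlinarith [mul_pos hμ0 h4]) (sq_nonneg _)
  rw [map_add, norm_eq_zero.1 (pow_eq_zero_iff two_ne_zero |>.1 h3), add_zero]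

/-- Version of `false_of_skew_of_kernel_line` without density of the range. -/
theorem false_of_skew_of_kernel_line_of_completeSpace [CompleteSpace H]
    (ι : S →ₗ[ℝ] H) (D J : S →ₗ[ℝ] S)
    (hD : ∀ f g, ⟪ι (D f), ι g⟫_ℝ = -⟪ι f, ι (D g)⟫_ℝ)
    (hJ : ∀ f g, ⟪ι (J f), ι g⟫_ℝ = -⟪ι f, ι (J g)⟫_ℝ)
    (hJJ : ∀ f, ι (J (J f)) = -ι f)
    {c : ℝ} (hc : 0 ≤ c) (hDJ : ∀ f, ‖ι (D (J f)) - ι (J (D f))‖ ≤ c * ‖ι f‖)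
    (V : ℕ → Submodule ℝ S) (hmono : Monotone V) (hfin : ∀ k, FiniteDimensional ℝ (V k))
    (hVD : ∀ k, ∀ f ∈ V k, D f ∈ V k)
    (hdense : ∀ f, ∀ ε > 0, ∃ k, ∃ g ∈ V k, ‖ι f - ι g‖ < ε)
    (hgrow : ∀ M : ℝ, ∃ k, ∀ l, ∀ f ∈ V l, (∀ g ∈ V k, ⟪ι f, ι g⟫_ℝ = 0) →
      M * ‖ι f‖ ≤ ‖ι (D f)‖)
    (e : S) (heV : e ∈ V 0) (he0 : ι e ≠ 0) (hDe : ι (D e) = 0)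
    (hker : ∀ k, ∀ f ∈ V k, ι (D f) = 0 → ∃ a : ℝ, ι f = a • ι e) : False := by
  let R := (LinearMap.range ι).topologicalClosure
  let ι' : S →ₗ[ℝ] R := ι.codRestrict R fun f =>
    (LinearMap.range ι).le_topologicalClosure ⟨f, rfl⟩
  have hι' : ∀ f, (ι' f : H) = ι f := fun f => rfl
  have hdr : DenseRange ι' := by
    rintro ⟨y, hy⟩
    rw [Metric.mem_closure_range_iff]
    intro δ hδ
    obtain ⟨_, ⟨f, rfl⟩, hf⟩ := Metric.mem_closure_iff.1 hy δ hδ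
    exact ⟨f, hf⟩
  refine false_of_skew_of_kernel_line hdr D J hD hJ (fun f => Subtype.ext (hJJ f)) hc hDJ V hmono
    hfin hVD hdense hgrow e heV (fun h => he0 ?_) (Subtype.ext hDe) fun k f hf h => ?_
  · rw [← hι', h]; rfl
  · obtain ⟨a, ha⟩ := hker k f hf (by rw [← hι', h]; rfl)
    exact ⟨a, Subtype.ext ha⟩

end

/-- The exterior algebra of `ℝ^m` with its creation and annihilation operators: `L i` is the
difference and `ρ i` the sum of the `i`-th creation and annihilation operators, `ω` is the volume
element of the Clifford algebra generated by the `L i`, `ε` is the parity, `N` the degree operator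
and `vac` spans degree zero. -/
structure CliffordModel (m : ℕ) (W : Type*) [NormedAddCommGroup W] [InnerProductSpace ℝ W] where
  L : Fin m → W →L[ℝ] W
  ρ : Fin m → W →L[ℝ] W
  ω : W →L[ℝ] W
  ε : W →L[ℝ] W
  N : W →L[ℝ] W
  vac : W
  L_L : ∀ i j f, L i (L j f) + L j (L i f) = if i = j then (-2 : ℝ) • f else 0
  ρ_ρ : ∀ i j f, ρ i (ρ j f) + ρ j (ρ i f) = if i = j then (2 : ℝ) • f else 0
  L_ρ : ∀ i j f, L i (ρ j f) = -ρ j (L i f)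
  inner_L : ∀ i f g, ⟪L i f, g⟫_ℝ = -⟪f, L i g⟫_ℝ
  inner_ρ : ∀ i f g, ⟪ρ i f, g⟫_ℝ = ⟪f, ρ i g⟫_ℝ
  ω_L : ∀ i f, ω (L i f) = -L i (ω f)
  ω_ρ : ∀ i f, ω (ρ i f) = ρ i (ω f)
  ω_ω : ∀ f, ω (ω f) = -f
  inner_ω : ∀ f g, ⟪ω f, g⟫_ℝ = -⟪f, ω g⟫_ℝ
  ε_L : ∀ i f, ε (L i f) = -L i (ε f)
  ε_ρ : ∀ i f, ε (ρ i f) = -ρ i (ε f)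
  ε_ω : ∀ f, ε (ω f) = ω (ε f)
  ε_ε : ∀ f, ε (ε f) = f
  inner_ε : ∀ f g, ⟪ε f, g⟫_ℝ = ⟪f, ε g⟫_ℝ
  two_N : ∀ f, (2 : ℝ) • N f = ∑ i, L i (ρ i f) + (m : ℝ) • f
  inner_N : ∀ (x : Fin m → ℝ) (f : W), x ≠ 0 → ε f = f → ∑ i, x i • ρ i f = ∑ i, x i • L i f →
    ⟪N f, N f⟫_ℝ - ((m : ℝ) - 2) * ⟪N f, f⟫_ℝ ≤ 0
  eq_smul_vac : ∀ f, (∀ i, ρ i f = L i f) → ∃ a : ℝ, f = a • vac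
  vac_ne_zero : vac ≠ 0
  ρ_vac : ∀ i, ρ i vac = L i vac
  ε_vac : ε vac = vac
  N_vac : N vac = 0

namespace FockModel

variable {m : ℕ}

/-- Toggles the `i`-th entry. -/
def flip (i : Fin m) (s : Fin m → Bool) : Fin m → Bool := Function.update s i (!s i)

/-- `1` if `i` is occupied, `-1` otherwise. -/
def chi (i : Fin m) (s : Fin m → Bool) : ℝ := if s i then 1 else -1

/-- The sign picked up when the `j`-th operator moves to its place. -/
def sgn (j : Fin m) (s : Fin m → Bool) : ℝ := ∏ k, if k < j then -chi k s else 1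

/-- The parity of the number of occupied places. -/
def par (s : Fin m → Bool) : ℝ := ∏ k, -chi k s

theorem flip_flip (i : Fin m) (s : Fin m → Bool) : flip i (flip i s) = s := by
  ext k; by_cases h : k = i
  · subst h; simp [flip]
  · simp [flip, h]

theorem flip_comm (i j : Fin m) (s : Fin m → Bool) : flip i (flip j s) = flip j (flip i s) := by
  by_cases hij : i = j
  · rw [hij]
  · ext k; by_cases h : k = i
    · subst h; simp [flip, hij]
    · by_cases h' : k = j
      · subst h'; simp [flip, h]
      · simp [flip, h, h']

theorem chi_flip_self (i : Fin m) (s : Fin m → Bool) : chi i (flip i s) = -chi i s := by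
  cases h : s i <;> simp [chi, flip, h]

theorem chi_flip_of_ne {i k : Fin m} (h : k ≠ i) (s : Fin m → Bool) :
    chi k (flip i s) = chi k s := by
  simp [chi, flip, h]

theorem chi_mul_chi (i : Fin m) (s : Fin m → Bool) : chi i s * chi i s = 1 := by
  cases h : s i <;> simp [chi, h]

theorem sgn_mul_sgn (i : Fin m) (s : Fin m → Bool) : sgn i s * sgn i s = 1 := by
  rw [sgn, ← Finset.prod_mul_distrib]
  refine Finset.prod_eq_one fun k _ => ?_
  split_ifs
  · rw [neg_mul_neg, chi_mul_chi]
  · rw [one_mul]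

theorem par_mul_par (s : Fin m → Bool) : par s * par s = 1 := by
  rw [par, ← Finset.prod_mul_distrib]
  exact Finset.prod_eq_one fun k _ => by rw [neg_mul_neg, chi_mul_chi]

theorem sgn_flip (i j : Fin m) (s : Fin m → Bool) :
    sgn j (flip i s) = if i < j then -sgn j s else sgn j s := by
  have h1 : ∀ k ∈ Finset.univ.erase i, (if k < j then -chi k (flip i s) else 1) =
      if k < j then -chi k s else 1 := fun k hk => by
    rw [chi_flip_of_ne (Finset.ne_of_mem_erase hk)]
  rw [sgn, sgn, ← Finset.mul_prod_erase _ _ (Finset.mem_univ i), Finset.prod_congr rfl h1,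
    ← Finset.mul_prod_erase _ _ (Finset.mem_univ i), chi_flip_self]
  split_ifs <;> ring

theorem par_flip (i : Fin m) (s : Fin m → Bool) : par (flip i s) = -par s := by
  have h1 : ∀ k ∈ Finset.univ.erase i, -chi k (flip i s) = -chi k s := fun k hk => by
    rw [chi_flip_of_ne (Finset.ne_of_mem_erase hk)]
  rw [par, par, ← Finset.mul_prod_erase _ _ (Finset.mem_univ i), Finset.prod_congr rfl h1,
    ← Finset.mul_prod_erase _ _ (Finset.mem_univ i), chi_flip_self]
  ring

/-- The underlying space, with one basis vector for every set of occupied places. -/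
abbrev Space (m : ℕ) : Type := EuclideanSpace ℝ (Fin m → Bool)

/-- Multiplication by a function. -/
noncomputable def diag (φ : (Fin m → Bool) → ℝ) : Space m →L[ℝ] Space m :=
  LinearMap.toContinuousLinearMap
    { toFun := fun f => WithLp.toLp 2 fun s => φ s * f s
      map_add' := fun f g => by ext s; simp [mul_add]
      map_smul' := fun c f => by ext s; simp; ring }

/-- Substitution of `flip i`. -/
noncomputable def shift (i : Fin m) : Space m →L[ℝ] Space m :=
  LinearMap.toContinuousLinearMap
    { toFun := fun f => WithLp.toLp 2 fun s => f (flip i s)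
      map_add' := fun f g => by ext s; simp
      map_smul' := fun c f => by ext s; simp }

theorem diag_apply (φ : (Fin m → Bool) → ℝ) (f : Space m) (s : Fin m → Bool) :
    diag φ f s = φ s * f s := rfl

theorem shift_apply (i : Fin m) (f : Space m) (s : Fin m → Bool) :
    shift i f s = f (flip i s) := rfl

theorem inner_diag (φ : (Fin m → Bool) → ℝ) (f g : Space m) :
    ⟪diag φ f, g⟫_ℝ = ⟪f, diag φ g⟫_ℝ := by
  rw [PiLp.inner_apply, PiLp.inner_apply]
  refine Finset.sum_congr rfl fun s _ => ?_
  rw [diag_apply, diag_apply, ← smul_eq_mul, ← smul_eq_mul, real_inner_smul_left,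
    real_inner_smul_right]

theorem inner_shift (i : Fin m) (f g : Space m) : ⟪shift i f, g⟫_ℝ = ⟪f, shift i g⟫_ℝ := by
  rw [PiLp.inner_apply, PiLp.inner_apply]
  refine Fintype.sum_equiv (Function.Involutive.toPerm (flip i) (flip_flip i)) _ _ fun s => ?_
  change ⟪f (flip i s), g s⟫_ℝ = ⟪f (flip i s), g (flip i (flip i s))⟫_ℝ
  rw [flip_flip]

/-- Difference of creation and annihilation. -/
noncomputable def opL (i : Fin m) : Space m →L[ℝ] Space m :=
  (diag fun s => chi i s * sgn i s) ∘L shift i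

/-- Sum of creation and annihilation. -/
noncomputable def opR (i : Fin m) : Space m →L[ℝ] Space m := diag (sgn i) ∘L shift i

theorem opL_apply (i : Fin m) (f : Space m) (s : Fin m → Bool) :
    opL i f s = chi i s * sgn i s * f (flip i s) := rfl

theorem opR_apply (i : Fin m) (f : Space m) (s : Fin m → Bool) :
    opR i f s = sgn i s * f (flip i s) := rfl

theorem opL_opL (i j : Fin m) (f : Space m) :
    opL i (opL j f) + opL j (opL i f) = if i = j then (-2 : ℝ) • f else 0 := by
  ext s
  rw [PiLp.add_apply]
  simp only [opL_apply]
  split_ifs with h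
  · subst h
    rw [chi_flip_self, sgn_flip, flip_flip, if_neg (lt_irrefl i), PiLp.smul_apply, smul_eq_mul]
    linear_combination (-2 * chi i s * chi i s * f s) * sgn_mul_sgn i s - 2 * f s * chi_mul_chi i s
  · rw [chi_flip_of_ne h, chi_flip_of_ne (Ne.symm h), flip_comm i j, sgn_flip, sgn_flip,
      PiLp.zero_apply]
    rcases lt_or_gt_of_ne h with h3 | h3
    · rw [if_pos h3, if_neg h3.not_gt]; ring
    · rw [if_pos h3, if_neg h3.not_gt]; ring

theorem opR_opR (i j : Fin m) (f : Space m) :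
    opR i (opR j f) + opR j (opR i f) = if i = j then (2 : ℝ) • f else 0 := by
  ext s
  rw [PiLp.add_apply]
  simp only [opR_apply]
  split_ifs with h
  · subst h
    rw [sgn_flip, flip_flip, if_neg (lt_irrefl i), PiLp.smul_apply, smul_eq_mul]
    linear_combination (2 * f s) * sgn_mul_sgn i s
  · rw [flip_comm i j, sgn_flip, sgn_flip, PiLp.zero_apply]
    rcases lt_or_gt_of_ne h with h3 | h3
    · rw [if_pos h3, if_neg h3.not_gt]; ring
    · rw [if_pos h3, if_neg h3.not_gt]; ring

theorem opL_opR (i j : Fin m) (f : Space m) : opL i (opR j f) = -opR j (opL i f) := by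
  ext s
  rw [PiLp.neg_apply]
  simp only [opL_apply, opR_apply]
  by_cases h : i = j
  · subst h
    rw [chi_flip_self, sgn_flip, flip_flip, if_neg (lt_irrefl i)]
    ring
  · rw [chi_flip_of_ne h, flip_comm i j, sgn_flip, sgn_flip]
    rcases lt_or_gt_of_ne h with h3 | h3
    · rw [if_pos h3, if_neg h3.not_gt]; ring
    · rw [if_pos h3, if_neg h3.not_gt]; ring

theorem opL_opR_self (i : Fin m) (f : Space m) : opL i (opR i f) = diag (chi i) f := by
  ext s
  rw [opL_apply, opR_apply, sgn_flip, flip_flip, if_neg (lt_irrefl i), diag_apply]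
  linear_combination (chi i s * f s) * sgn_mul_sgn i s

theorem inner_opR (i : Fin m) (f g : Space m) : ⟪opR i f, g⟫_ℝ = ⟪f, opR i g⟫_ℝ := by
  change ⟪diag (sgn i) (shift i f), g⟫_ℝ = _
  rw [inner_diag, inner_shift]
  congr 1
  ext s
  rw [shift_apply, diag_apply, opR_apply, sgn_flip, if_neg (lt_irrefl i)]

theorem inner_opL (i : Fin m) (f g : Space m) : ⟪opL i f, g⟫_ℝ = -⟪f, opL i g⟫_ℝ := by
  change ⟪diag _ (shift i f), g⟫_ℝ = _
  rw [inner_diag, inner_shift, ← inner_neg_right]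
  congr 1
  ext s
  rw [PiLp.neg_apply, shift_apply, diag_apply, opL_apply, sgn_flip, if_neg (lt_irrefl i),
    chi_flip_self]
  ring

theorem opL_opL_self (i : Fin m) (f : Space m) : opL i (opL i f) = -f := by
  have h := opL_opL i i f
  rw [if_pos rfl, ← two_smul ℝ, neg_smul, ← smul_neg] at h
  exact smul_right_injective _ (two_ne_zero' ℝ) h

theorem opL_opL_of_ne {i j : Fin m} (h : i ≠ j) (f : Space m) :
    opL i (opL j f) = -opL j (opL i f) := by
  have := opL_opL i j f
  rw [if_neg h] at this
  exact eq_neg_of_add_eq_zero_left this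

/-- The product of the first `k` operators `opL`. -/
noncomputable def vol (m : ℕ) : ℕ → Space m →L[ℝ] Space m
  | 0 => ContinuousLinearMap.id ℝ _
  | k + 1 => vol m k ∘L if h : k < m then opL ⟨k, h⟩ else ContinuousLinearMap.id ℝ _

theorem vol_zero (f : Space m) : vol m 0 f = f := rfl

theorem vol_succ {k : ℕ} (h : k < m) (f : Space m) : vol m (k + 1) f = vol m k (opL ⟨k, h⟩ f) := by
  rw [vol, dif_pos h]; rfl

theorem opR_vol (j : Fin m) (k : ℕ) (hk : k ≤ m) (f : Space m) :
    opR j (vol m k f) = (-1 : ℝ) ^ k • vol m k (opR j f) := by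
  induction k generalizing f with
  | zero => rw [vol_zero, vol_zero, pow_zero, one_smul]
  | succ k ih =>
    rw [vol_succ hk, vol_succ hk, ih (by omega), opL_opR, map_neg, pow_succ, mul_neg_one, neg_smul,
      smul_neg, neg_neg]

theorem opL_vol (j : Fin m) (k : ℕ) (hk : k ≤ m) (f : Space m) :
    opL j (vol m k f) = (-1 : ℝ) ^ (k + if (j : ℕ) < k then 1 else 0) • vol m k (opL j f) := by
  induction k generalizing f with
  | zero => simp [vol_zero]
  | succ k ih =>
    rw [vol_succ hk, vol_succ hk, ih (by omega)]
    by_cases hj : (j : ℕ) = k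
    · have : j = ⟨k, hk⟩ := Fin.ext hj
      subst this
      simp [pow_succ]
    · have h2 : ((j : ℕ) < k + 1) = ((j : ℕ) < k) := by
        apply propext; omega
      rw [opL_opL_of_ne fun hh => hj (congrArg Fin.val hh), map_neg, smul_neg, ← neg_smul]
      simp only [h2]
      congr 1
      ring

theorem vol_vol (k : ℕ) (hk : k ≤ m) (f : Space m) :
    vol m k (vol m k f) = (-1 : ℝ) ^ (k * (k + 1) / 2) • f := by
  induction k generalizing f with
  | zero => simp [vol_zero]
  | succ k ih =>
    have h0 : (k + 1) * (k + 1 + 1) / 2 = k * (k + 1) / 2 + (k + 1) := by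
      rw [show (k + 1) * (k + 1 + 1) = k * (k + 1) + (k + 1) * 2 by ring,
        Nat.add_mul_div_right _ _ two_pos]
    rw [vol_succ hk, vol_succ hk, opL_vol ⟨k, hk⟩ k (by omega), if_neg (lt_irrefl k), add_zero,
      map_smul, ih (by omega), opL_opL_self, h0, pow_add, pow_succ, smul_neg, smul_neg, smul_smul,
      ← neg_smul]
    congr 1
    ring

theorem vol_vol_self (hm : m % 4 = 2) (f : Space m) : vol m m (vol m m f) = -f := by
  have h1 : Odd (m * (m + 1) / 2) := by
    obtain ⟨q, rfl⟩ : ∃ q, m = 4 * q + 2 := ⟨m / 4, by omega⟩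
    have : (4 * q + 2) * (4 * q + 2 + 1) / 2 = (2 * q + 1) * (4 * q + 3) := by
      rw [show (4 * q + 2) * (4 * q + 2 + 1) = (2 * q + 1) * (4 * q + 3) * 2 by ring,
        Nat.mul_div_cancel _ two_pos]
    rw [this]
    exact Odd.mul ⟨q, rfl⟩ ⟨2 * q + 1, by ring⟩
  rw [vol_vol m le_rfl, h1.neg_one_pow, neg_one_smul]

theorem inner_vol_vol (k : ℕ) (hk : k ≤ m) (f g : Space m) :
    ⟪vol m k f, vol m k g⟫_ℝ = ⟪f, g⟫_ℝ := by
  induction k generalizing f g with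
  | zero => rfl
  | succ k ih =>
    rw [vol_succ hk, vol_succ hk, ih (by omega), inner_opL, opL_opL_self, inner_neg_right, neg_neg]

theorem diag_par_opL (i : Fin m) (f : Space m) :
    diag par (opL i f) = -opL i (diag par f) := by
  ext s
  rw [PiLp.neg_apply, diag_apply, opL_apply, opL_apply, diag_apply, par_flip]
  ring

theorem diag_par_opR (i : Fin m) (f : Space m) :
    diag par (opR i f) = -opR i (diag par f) := by
  ext s
  rw [PiLp.neg_apply, diag_apply, opR_apply, opR_apply, diag_apply, par_flip]
  ring

theorem diag_par_vol (k : ℕ) (hk : k ≤ m) (f : Space m) :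
    diag par (vol m k f) = (-1 : ℝ) ^ k • vol m k (diag par f) := by
  induction k generalizing f with
  | zero => simp [vol_zero]
  | succ k ih =>
    rw [vol_succ hk, vol_succ hk, ih (by omega), diag_par_opL, map_neg, smul_neg, pow_succ,
      mul_neg_one, neg_smul]

/-- The number of occupied places. -/
def count (s : Fin m → Bool) : ℕ := (Finset.univ.filter fun k => s k).card

theorem two_mul_count (s : Fin m → Bool) : (2 : ℝ) * count s = ∑ k, chi k s + m := by
  have h1 : ∀ k, chi k s = 2 * (if s k then 1 else 0) - 1 := fun k => by
    cases h : s k <;> norm_num [chi, h]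
  simp_rw [h1]
  rw [Finset.sum_sub_distrib, ← Finset.mul_sum, count, Finset.card_filter]
  simp

theorem par_eq (s : Fin m → Bool) : par s = (-1) ^ count s := by
  have h1 : ∀ k, -chi k s = if s k then -1 else 1 := fun k => by
    cases h : s k <;> simp [chi, h]
  rw [par, Finset.prod_congr rfl fun k _ => h1 k, Finset.prod_ite, count]
  simp

theorem inner_count {x : Fin m → ℝ} {f : Space m} (hm : Even m) (hx : x ≠ 0)
    (hpar : diag par f = f) (hf : ∑ i, x i • opR i f = ∑ i, x i • opL i f) :
    ⟪diag (fun s => (count s : ℝ)) f, diag (fun s => (count s : ℝ)) f⟫_ℝ -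
      ((m : ℝ) - 2) * ⟪diag (fun s => (count s : ℝ)) f, f⟫_ℝ ≤ 0 := by
  rw [PiLp.inner_apply, PiLp.inner_apply, Finset.mul_sum, ← Finset.sum_sub_distrib]
  refine Finset.sum_nonpos fun s _ => ?_
  rw [diag_apply]
  rw [← smul_eq_mul, real_inner_smul_left, real_inner_smul_left, real_inner_smul_right,
    real_inner_self_eq_norm_sq]
  by_cases h0 : f s = 0
  · simp [h0]
  have heven : Even (count s) := by
    by_contra h
    rw [Nat.not_even_iff_odd] at h
    have h1 := congrArg (fun g : Space m => g s) hpar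
    simp only [diag_apply, par_eq, h.neg_one_pow] at h1
    exact h0 (by linarith)
  have hle : count s ≤ m := (Finset.card_le_univ _).trans (Fintype.card_fin m).le
  have hne : count s ≠ m := by
    intro h
    have hall : ∀ k, s k = true := by
      have := (Finset.card_eq_iff_eq_univ (Finset.univ.filter fun k => s k = true)).1
        (by rw [Fintype.card_fin]; exact h)
      simpa [Finset.eq_univ_iff_forall] using this
    obtain ⟨j, hj⟩ := Function.ne_iff.1 hx
    have h1 := congrArg (fun g : Space m => g (flip j s)) hf
    simp only [WithLp.ofLp_sum, WithLp.ofLp_smul, Finset.sum_apply, Pi.smul_apply, opR_apply,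
      opL_apply, smul_eq_mul] at h1
    rw [← sub_eq_zero, ← Finset.sum_sub_distrib, Finset.sum_eq_single j] at h1
    · rw [flip_flip, chi_flip_self] at h1
      have h2 : chi j s = 1 := by simp [chi, hall]
      rw [h2] at h1
      have h3 : x j * sgn j (flip j s) * f s = 0 := by linarith
      have h4 : sgn j (flip j s) ≠ 0 := fun h => by
        have := sgn_mul_sgn j (flip j s)
        rw [h] at this; norm_num at this
      exact mul_ne_zero (mul_ne_zero hj h4) h0 h3
    · intro k _ hk
      rw [chi_flip_of_ne hk]
      simp [chi, hall]
    · simp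
  have hle2 : count s + 2 ≤ m := by
    obtain ⟨a, ha⟩ := heven
    obtain ⟨b, hb⟩ := hm
    omega
  have hle3 : (count s : ℝ) + 2 ≤ m := by exact_mod_cast hle2
  have h1 : (count s : ℝ) * (count s * ‖f s‖ ^ 2) - (m - 2) * (count s * ‖f s‖ ^ 2) =
    -((count s : ℝ) * (m - 2 - count s) * ‖f s‖ ^ 2) := by ring
  rw [h1, neg_nonpos]
  have h2 : (0 : ℝ) ≤ m - 2 - count s := by linarith
  positivity

theorem exists_eq_smul {f : Space m} (hf : ∀ i, opR i f = opL i f) :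
    ∃ a : ℝ, f = a • EuclideanSpace.single (fun _ => false) (1 : ℝ) := by
  refine ⟨f fun _ => false, ?_⟩
  ext s
  by_cases hs : s = fun _ => false
  · subst hs; simp
  · obtain ⟨j, hj⟩ := Function.ne_iff.1 hs
    have h1 := congrArg (fun g : Space m => g (flip j s)) (hf j)
    simp only [opR_apply, opL_apply, flip_flip, chi_flip_self] at h1
    have h2 : chi j s = 1 := by
      have : s j = true := by simpa using hj
      simp [chi, this]
    have h4 : sgn j (flip j s) ≠ 0 := fun h => by
      have := sgn_mul_sgn j (flip j s)
      rw [h] at this; norm_num at this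
    have h3 : sgn j (flip j s) * f s = 0 := by rw [h2] at h1; linarith
    have h5 : f s = 0 := (mul_eq_zero.1 h3).resolve_left h4
    rw [h5]
    simp [hs]

theorem opR_single (i : Fin m) : opR i (EuclideanSpace.single (fun _ => false) (1 : ℝ)) =
    opL i (EuclideanSpace.single (fun _ => false) (1 : ℝ)) := by
  ext s
  rw [opR_apply, opL_apply]
  by_cases hs : flip i s = fun _ => false
  · have h1 : s = flip i fun _ => false := by rw [← hs, flip_flip]
    have h2 : chi i s = 1 := by rw [h1, chi_flip_self]; simp [chi]
    rw [h2, one_mul]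
  · simp [hs]

theorem diag_single (φ : (Fin m → Bool) → ℝ) :
    diag φ (EuclideanSpace.single (fun _ => false) (1 : ℝ)) =
      φ (fun _ => false) • EuclideanSpace.single (fun _ => false) (1 : ℝ) := by
  ext s
  rw [diag_apply, PiLp.smul_apply, smul_eq_mul]
  by_cases hs : s = fun _ => false
  · rw [hs]
  · simp [hs]

/-- The exterior algebra model, for `m` congruent to `2` modulo `4`. -/
noncomputable def model (hm : m % 4 = 2) : CliffordModel m (Space m) where
  L := opL
  ρ := opR
  ω := vol m m
  ε := diag par
  N := diag fun s => (count s : ℝ)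
  vac := EuclideanSpace.single (fun _ => false) 1
  L_L := opL_opL
  ρ_ρ := opR_opR
  L_ρ := opL_opR
  inner_L := inner_opL
  inner_ρ := inner_opR
  ω_L i f := by
    have h1 : Even m := ⟨m / 2, by omega⟩
    rw [opL_vol i m le_rfl, if_pos i.2, h1.add_one.neg_one_pow, neg_one_smul, neg_neg]
  ω_ρ i f := by
    have h1 : Even m := ⟨m / 2, by omega⟩
    rw [opR_vol i m le_rfl, h1.neg_one_pow, one_smul]
  ω_ω f := vol_vol_self hm f
  inner_ω f g := by
    rw [← inner_vol_vol m le_rfl (vol m m f), vol_vol_self hm, inner_neg_left]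
  ε_L := diag_par_opL
  ε_ρ := diag_par_opR
  ε_ω f := by
    have h1 : Even m := ⟨m / 2, by omega⟩
    rw [diag_par_vol m le_rfl, h1.neg_one_pow, one_smul]
  ε_ε f := by
    ext s
    rw [diag_apply, diag_apply, ← mul_assoc, par_mul_par, one_mul]
  inner_ε := inner_diag par
  two_N f := by
    simp only [opL_opR_self]
    ext s
    simp only [PiLp.add_apply, PiLp.smul_apply, WithLp.ofLp_sum, Finset.sum_apply, diag_apply,
      smul_eq_mul, ← Finset.sum_mul]
    rw [← mul_assoc, two_mul_count]
    ring
  inner_N x f hx hε hf := inner_count ⟨m / 2, by omega⟩ hx hε hf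
  eq_smul_vac f hf := exists_eq_smul hf
  vac_ne_zero h := by simpa using congrArg (fun g : Space m => g fun _ => false) h
  ρ_vac := opR_single
  ε_vac := by rw [diag_single]; simp [par, chi]
  N_vac := by rw [diag_single]; simp [count]

end FockModel

open MeasureTheory Set Filter Topology
open scoped ContDiff

section SphereMeasure

variable {m : ℕ}

/-- The infinitesimal rotation in the `(i, j)`-plane. -/
noncomputable def rotVec (i j : Fin m) (x : EuclideanSpace ℝ (Fin m)) : EuclideanSpace ℝ (Fin m) :=
  x i • EuclideanSpace.single j 1 - x j • EuclideanSpace.single i 1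

/-- The rotation by the angle `t` in the `(i, j)`-plane, for `i ≠ j`. -/
noncomputable def planeRotation (i j : Fin m) (t : ℝ) :
    EuclideanSpace ℝ (Fin m) →ₗ[ℝ] EuclideanSpace ℝ (Fin m) where
  toFun x := x + ((Real.cos t - 1) * x i - Real.sin t * x j) • EuclideanSpace.single i 1 +
    ((Real.cos t - 1) * x j + Real.sin t * x i) • EuclideanSpace.single j 1
  map_add' x y := by
    simp only [PiLp.add_apply]
    module
  map_smul' c x := by
    simp only [PiLp.smul_apply, smul_eq_mul, RingHom.id_apply]
    module

theorem planeRotation_apply (i j : Fin m) (t : ℝ) (x : EuclideanSpace ℝ (Fin m)) :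
    planeRotation i j t x =
    x + ((Real.cos t - 1) * x i - Real.sin t * x j) • EuclideanSpace.single i 1 +
    ((Real.cos t - 1) * x j + Real.sin t * x i) • EuclideanSpace.single j 1 := rfl

theorem planeRotation_zero (i j : Fin m) (x : EuclideanSpace ℝ (Fin m)) :
    planeRotation i j 0 x = x := by
  simp [planeRotation_apply]

theorem norm_planeRotation {i j : Fin m} (hij : i ≠ j) (t : ℝ) (x : EuclideanSpace ℝ (Fin m)) :
    ‖planeRotation i j t x‖ = ‖x‖ := by
  rw [← sq_eq_sq₀ (norm_nonneg _) (norm_nonneg _), ← real_inner_self_eq_norm_sq,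
    ← real_inner_self_eq_norm_sq, planeRotation_apply]
  simp only [inner_add_left, inner_add_right, real_inner_smul_left, real_inner_smul_right,
    EuclideanSpace.inner_single_left, EuclideanSpace.inner_single_right]
  simp [hij, hij.symm]
  linear_combination (x i ^ 2 + x j ^ 2) * Real.sin_sq_add_cos_sq t

theorem hasDerivAt_planeRotation (i j : Fin m) (t : ℝ) (x : EuclideanSpace ℝ (Fin m)) :
    HasDerivAt (fun t => planeRotation i j t x)
      ((-Real.sin t * x i - Real.cos t * x j) • EuclideanSpace.single i 1 +
        (-Real.sin t * x j + Real.cos t * x i) • EuclideanSpace.single j 1) t := by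
  simp only [planeRotation_apply]
  have h1 : HasDerivAt (fun t => (Real.cos t - 1) * x i - Real.sin t * x j)
      (-Real.sin t * x i - Real.cos t * x j) t :=
    (((Real.hasDerivAt_cos t).sub_const 1).mul_const _).sub ((Real.hasDerivAt_sin t).mul_const _)
  have h2 : HasDerivAt (fun t => (Real.cos t - 1) * x j + Real.sin t * x i)
      (-Real.sin t * x j + Real.cos t * x i) t :=
    (((Real.hasDerivAt_cos t).sub_const 1).mul_const _).add ((Real.hasDerivAt_sin t).mul_const _)
  have h3 := ((h1.smul_const (EuclideanSpace.single i (1 : ℝ))).const_add x).add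
    (h2.smul_const (EuclideanSpace.single j (1 : ℝ)))
  exact h3

theorem hasDerivAt_planeRotation_zero (i j : Fin m) (x : EuclideanSpace ℝ (Fin m)) :
    HasDerivAt (fun t => planeRotation i j t x) (rotVec i j x) 0 := by
  convert hasDerivAt_planeRotation i j 0 x using 1
  simp [rotVec]
  abel

theorem rotVec_self (i : Fin m) (x : EuclideanSpace ℝ (Fin m)) : rotVec i i x = 0 := by
  simp [rotVec]

/-- A function vanishing on the unit sphere has vanishing tangential derivatives. -/
theorem fderiv_rotVec_eq_zero {W : Type*} [NormedAddCommGroup W] [NormedSpace ℝ W]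
    {F : EuclideanSpace ℝ (Fin m) → W} (hF : ∀ x, ‖x‖ = 1 → F x = 0)
    {x : EuclideanSpace ℝ (Fin m)} (hx : ‖x‖ = 1) (hd : DifferentiableAt ℝ F x) (i j : Fin m) :
    fderiv ℝ F x (rotVec i j x) = 0 := by
  by_cases hij : i = j
  · rw [hij, rotVec_self, map_zero]
  have h1 : HasDerivAt (fun t => F (planeRotation i j t x)) (fderiv ℝ F x (rotVec i j x)) 0 := by
    have h2 : HasFDerivAt F (fderiv ℝ F x) (planeRotation i j 0 x) := by
      rw [planeRotation_zero]; exact hd.hasFDerivAt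
    exact h2.comp_hasDerivAt 0 (hasDerivAt_planeRotation_zero i j x)
  have h2 : (fun t => F (planeRotation i j t x)) = fun _ => 0 := by
    funext t
    exact hF _ (by rw [norm_planeRotation hij, hx])
  rw [h2] at h1
  exact h1.unique (hasDerivAt_const 0 0)

/-- The rotation invariant measure on the unit sphere, as a measure on the ambient space. -/
noncomputable def sphereMeasure (m : ℕ) : Measure (EuclideanSpace ℝ (Fin m)) :=
  Measure.map (fun x => ‖x‖⁻¹ • x) (volume.restrict (Metric.ball 0 1))

theorem measurable_normalize :
    Measurable fun x : EuclideanSpace ℝ (Fin m) => ‖x‖⁻¹ • x := by fun_prop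

instance : IsFiniteMeasure (sphereMeasure m) := by
  have : IsFiniteMeasure (volume.restrict (Metric.ball (0 : EuclideanSpace ℝ (Fin m)) 1)) :=
    ⟨by rw [Measure.restrict_apply_univ]; exact measure_ball_lt_top⟩
  rw [sphereMeasure]; infer_instance

theorem ae_norm_eq_one [NeZero m] : ∀ᵐ x ∂sphereMeasure m, ‖x‖ = 1 := by
  rw [sphereMeasure, ae_map_iff measurable_normalize.aemeasurable
    (isClosed_eq continuous_norm continuous_const).measurableSet]
  have h1 : ∀ᵐ x ∂(volume : Measure (EuclideanSpace ℝ (Fin m))), x ≠ 0 := by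
    have := (measure_singleton (μ := (volume : Measure (EuclideanSpace ℝ (Fin m)))) 0)
    exact compl_mem_ae_iff.2 this
  filter_upwards [ae_restrict_of_ae h1] with x hx
  rw [norm_smul, norm_inv, norm_norm, inv_mul_cancel₀ (norm_ne_zero_iff.2 hx)]

theorem ae_ne_zero [NeZero m] : ∀ᵐ x ∂sphereMeasure m, x ≠ 0 := by
  filter_upwards [ae_norm_eq_one] with x hx h
  simp [h] at hx

theorem map_sphereMeasure (U : EuclideanSpace ℝ (Fin m) ≃ₗᵢ[ℝ] EuclideanSpace ℝ (Fin m)) :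
    Measure.map U (sphereMeasure m) = sphereMeasure m := by
  have hU : Measurable U := U.continuous.measurable
  have h1 : U ∘ (fun x : EuclideanSpace ℝ (Fin m) => ‖x‖⁻¹ • x) = (fun x => ‖x‖⁻¹ • x) ∘ U := by
    funext x
    simp
  rw [sphereMeasure, Measure.map_map hU measurable_normalize, h1,
    ← Measure.map_map measurable_normalize hU]
  congr 1
  have h2 := (U.measurePreserving).restrict_preimage (s := Metric.ball 0 1) measurableSet_ball
  have h3 : U ⁻¹' Metric.ball 0 1 = Metric.ball 0 1 := by
    ext x; simp
  rw [h3] at h2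
  exact h2.map_eq

theorem isCompact_unitSphere : IsCompact {x : EuclideanSpace ℝ (Fin m) | ‖x‖ = 1} := by
  have := isCompact_sphere (0 : EuclideanSpace ℝ (Fin m)) 1
  simpa [Metric.sphere] using this

theorem exists_bound_on_sphere {W : Type*} [NormedAddCommGroup W]
    {F : EuclideanSpace ℝ (Fin m) → W} (hF : ContinuousOn F {0}ᶜ) :
    ∃ C, 0 ≤ C ∧ ∀ x, ‖x‖ = 1 → ‖F x‖ ≤ C := by
  obtain ⟨C, hC⟩ := isCompact_unitSphere.exists_bound_of_continuousOn
    (hF.mono fun x (hx : ‖x‖ = 1) (h : x = 0) => by simp [h] at hx)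
  exact ⟨max C 0, le_max_right _ _, fun x hx => (hC x hx).trans (le_max_left _ _)⟩

theorem aestronglyMeasurable_sphereMeasure [NeZero m] {W : Type*} [NormedAddCommGroup W]
    {F : EuclideanSpace ℝ (Fin m) → W} (hF : ContinuousOn F {0}ᶜ) :
    AEStronglyMeasurable F (sphereMeasure m) := by
  have h1 := hF.aestronglyMeasurable (μ := sphereMeasure m)
    (measurableSet_singleton (0 : EuclideanSpace ℝ (Fin m))).compl
  have h2 : (sphereMeasure m).restrict {0}ᶜ = sphereMeasure m :=
    Measure.restrict_eq_self_of_ae_mem ae_ne_zero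
  rwa [h2] at h1

theorem memLp_sphereMeasure [NeZero m] {W : Type*} [NormedAddCommGroup W]
    {F : EuclideanSpace ℝ (Fin m) → W} (hF : ContinuousOn F {0}ᶜ) (p : ENNReal) :
    MemLp F p (sphereMeasure m) := by
  obtain ⟨C, -, hC⟩ := exists_bound_on_sphere hF
  refine MemLp.of_bound (aestronglyMeasurable_sphereMeasure hF) C ?_
  filter_upwards [ae_norm_eq_one] with x hx using hC x hx

theorem integrable_sphereMeasure [NeZero m] {W : Type*} [NormedAddCommGroup W]
    {F : EuclideanSpace ℝ (Fin m) → W} (hF : ContinuousOn F {0}ᶜ) :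
    Integrable F (sphereMeasure m) :=
  memLp_one_iff_integrable.1 (memLp_sphereMeasure hF 1)

/-- Infinitesimal rotation invariance of the measure. -/
theorem integral_fderiv_rotVec [NeZero m] {h : EuclideanSpace ℝ (Fin m) → ℝ}
    (hh : ContDiffOn ℝ 1 h {0}ᶜ) (i j : Fin m) :
    ∫ x, fderiv ℝ h x (rotVec i j x) ∂sphereMeasure m = 0 := by
  by_cases hij : i = j
  · simp [hij, rotVec_self]
  have hopen : IsOpen ({0}ᶜ : Set (EuclideanSpace ℝ (Fin m))) := isOpen_compl_singleton
  have hne : ∀ {x : EuclideanSpace ℝ (Fin m)}, ‖x‖ = 1 → x ∈ ({0}ᶜ : Set _) :=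
    fun {x} hx h => by simp [show x = 0 from h] at hx
  have hdiff : ∀ x : EuclideanSpace ℝ (Fin m), ‖x‖ = 1 → DifferentiableAt ℝ h x := fun x hx =>
    (hh.differentiableOn one_ne_zero).differentiableAt (hopen.mem_nhds (hne hx))
  have hcont : ContinuousOn (fderiv ℝ h) {0}ᶜ := hh.continuousOn_fderiv_of_isOpen hopen le_rfl
  obtain ⟨C, hC0, hC⟩ := exists_bound_on_sphere hcont
  let iso : ℝ → EuclideanSpace ℝ (Fin m) ≃ₗᵢ[ℝ] EuclideanSpace ℝ (Fin m) := fun t =>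
    LinearIsometry.toLinearIsometryEquiv ⟨planeRotation i j t, norm_planeRotation hij t⟩ rfl
  have hiso : ∀ t x, iso t x = planeRotation i j t x := fun t x => rfl
  have hconst : ∀ t, ∫ x, h (planeRotation i j t x) ∂sphereMeasure m = ∫ x, h x ∂sphereMeasure m := by
    intro t
    conv_rhs => rw [← map_sphereMeasure (iso t)]
    rw [integral_map (iso t).continuous.measurable.aemeasurable]
    · rfl
    · rw [map_sphereMeasure]
      exact aestronglyMeasurable_sphereMeasure hh.continuousOn
  let w : ℝ → EuclideanSpace ℝ (Fin m) → EuclideanSpace ℝ (Fin m) := fun t x =>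
    (-Real.sin t * x i - Real.cos t * x j) • EuclideanSpace.single i 1 +
        (-Real.sin t * x j + Real.cos t * x i) • EuclideanSpace.single j 1
  have hcoord : ∀ (x : EuclideanSpace ℝ (Fin m)) k, ‖x‖ = 1 → |x k| ≤ 1 := fun x k hx => by
    rw [← hx, ← Real.norm_eq_abs]; exact PiLp.norm_apply_le x k
  have hw : ∀ t x, ‖x‖ = 1 → ‖w t x‖ ≤ 4 := by
    intro t x hx
    have b1 : |(-Real.sin t * x i - Real.cos t * x j)| ≤ 2 := by
      refine (abs_sub _ _).trans ?_
      rw [abs_mul, abs_mul, abs_neg]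
      nlinarith [Real.abs_sin_le_one t, Real.abs_cos_le_one t, hcoord x i hx, hcoord x j hx,
        abs_nonneg (Real.sin t), abs_nonneg (Real.cos t), abs_nonneg (x i), abs_nonneg (x j)]
    have b2 : |(-Real.sin t * x j + Real.cos t * x i)| ≤ 2 := by
      refine (abs_add_le _ _).trans ?_
      rw [abs_mul, abs_mul, abs_neg]
      nlinarith [Real.abs_sin_le_one t, Real.abs_cos_le_one t, hcoord x i hx, hcoord x j hx,
        abs_nonneg (Real.sin t), abs_nonneg (Real.cos t), abs_nonneg (x i), abs_nonneg (x j)]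
    refine (norm_add_le _ _).trans ?_
    rw [norm_smul, norm_smul, PiLp.norm_single, PiLp.norm_single]
    simp only [Real.norm_eq_abs, abs_one]
    linarith
  have hder : HasDerivAt (fun t => ∫ x, h (planeRotation i j t x) ∂sphereMeasure m)
      (∫ x, fderiv ℝ h (planeRotation i j 0 x) (w 0 x) ∂sphereMeasure m) 0 := by
    refine (hasDerivAt_integral_of_dominated_loc_of_deriv_le (bound := fun _ => C * 4)
      (F := fun t x => h (planeRotation i j t x))
      (F' := fun t x => fderiv ℝ h (planeRotation i j t x) (w t x))
      (s := univ) univ_mem ?_ ?_ ?_ ?_ ?_ ?_).2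
    · refine Eventually.of_forall fun t => ?_
      have h1 := (aestronglyMeasurable_sphereMeasure (m := m) hh.continuousOn)
      rw [← map_sphereMeasure (iso t)] at h1
      exact h1.comp_measurable (iso t).continuous.measurable
    · simp only [planeRotation_zero]
      exact integrable_sphereMeasure hh.continuousOn
    · simp only [planeRotation_zero]
      refine aestronglyMeasurable_sphereMeasure (hcont.clm_apply ?_)
      fun_prop
    · filter_upwards [ae_norm_eq_one] with x hx t _
      refine (ContinuousLinearMap.le_opNorm _ _).trans ?_
      exact mul_le_mul (hC _ (by rw [norm_planeRotation hij, hx])) (hw t x hx) (norm_nonneg _) hC0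
    · exact integrable_const _
    · filter_upwards [ae_norm_eq_one] with x hx t _
      exact (hdiff _ (by rw [norm_planeRotation hij, hx])).hasFDerivAt.comp_hasDerivAt t
        (hasDerivAt_planeRotation i j t x)
  simp only [hconst] at hder
  have h0 := hder.unique (hasDerivAt_const _ _)
  rw [← h0]
  refine integral_congr_ae (Eventually.of_forall fun x => ?_)
  simp only [planeRotation_zero]
  congr 1
  simp [w, rotVec]
  abel

end SphereMeasure

namespace CliffordModel

section

variable {m : ℕ} {W : Type*} [NormedAddCommGroup W] [InnerProductSpace ℝ W] (K : CliffordModel m W)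

/-- Clifford multiplication by a vector. -/
noncomputable def cl : EuclideanSpace ℝ (Fin m) →L[ℝ] W →L[ℝ] W :=
  ∑ i, (EuclideanSpace.proj i).smulRight (K.L i)

/-- The second Clifford multiplication by a vector. -/
noncomputable def cr : EuclideanSpace ℝ (Fin m) →L[ℝ] W →L[ℝ] W :=
  ∑ i, (EuclideanSpace.proj i).smulRight (K.ρ i)

theorem cl_apply (x : EuclideanSpace ℝ (Fin m)) (f : W) : K.cl x f = ∑ i, x i • K.L i f := by
  simp [cl]

theorem cr_apply (x : EuclideanSpace ℝ (Fin m)) (f : W) : K.cr x f = ∑ i, x i • K.ρ i f := by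
  simp [cr]

theorem cl_single (i : Fin m) (f : W) : K.cl (EuclideanSpace.single i 1) f = K.L i f := by
  rw [cl_apply, Finset.sum_eq_single i] <;> simp +contextual

theorem cr_single (i : Fin m) (f : W) : K.cr (EuclideanSpace.single i 1) f = K.ρ i f := by
  rw [cr_apply, Finset.sum_eq_single i] <;> simp +contextual

theorem cl_cl (x y : EuclideanSpace ℝ (Fin m)) (f : W) :
    K.cl x (K.cl y f) + K.cl y (K.cl x f) = (-2 * ⟪x, y⟫_ℝ) • f := by
  have h1 : K.cl y (K.cl x f) = ∑ i, ∑ j, (x i * y j) • K.L j (K.L i f) := by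
    simp only [cl_apply, map_sum, map_smul, Finset.smul_sum, smul_smul]
  have h2 : K.cl x (K.cl y f) = ∑ i, ∑ j, (x i * y j) • K.L i (K.L j f) := by
    simp only [cl_apply, map_sum, map_smul, Finset.smul_sum, smul_smul]
    rw [Finset.sum_comm]
    simp only [mul_comm]
  rw [h1, h2, ← Finset.sum_add_distrib]
  simp only [← Finset.sum_add_distrib, ← smul_add, K.L_L]
  simp [PiLp.inner_apply, Finset.sum_smul, Finset.mul_sum, smul_smul, mul_comm]

theorem cr_cr (x y : EuclideanSpace ℝ (Fin m)) (f : W) :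
    K.cr x (K.cr y f) + K.cr y (K.cr x f) = (2 * ⟪x, y⟫_ℝ) • f := by
  have h1 : K.cr y (K.cr x f) = ∑ i, ∑ j, (x i * y j) • K.ρ j (K.ρ i f) := by
    simp only [cr_apply, map_sum, map_smul, Finset.smul_sum, smul_smul]
  have h2 : K.cr x (K.cr y f) = ∑ i, ∑ j, (x i * y j) • K.ρ i (K.ρ j f) := by
    simp only [cr_apply, map_sum, map_smul, Finset.smul_sum, smul_smul]
    rw [Finset.sum_comm]
    simp only [mul_comm]
  rw [h1, h2, ← Finset.sum_add_distrib]
  simp only [← Finset.sum_add_distrib, ← smul_add, K.ρ_ρ]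
  simp [PiLp.inner_apply, Finset.sum_smul, Finset.mul_sum, smul_smul, mul_comm]

theorem cl_cl_self (x : EuclideanSpace ℝ (Fin m)) (f : W) :
    K.cl x (K.cl x f) = -(‖x‖ ^ 2) • f := by
  have h := K.cl_cl x x f
  rw [real_inner_self_eq_norm_sq, ← two_smul ℝ, mul_smul] at h
  have h2 := smul_right_injective W (two_ne_zero' ℝ) (h.trans (by rw [neg_smul]; exact (smul_neg _ _).symm) :
    (2 : ℝ) • _ = (2 : ℝ) • (-(‖x‖ ^ 2 • f)))
  rw [h2, neg_smul]

theorem cr_cr_self (x : EuclideanSpace ℝ (Fin m)) (f : W) :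
    K.cr x (K.cr x f) = (‖x‖ ^ 2) • f := by
  have h := K.cr_cr x x f
  rw [real_inner_self_eq_norm_sq, ← two_smul ℝ, mul_smul] at h
  exact smul_right_injective W (two_ne_zero' ℝ) h

theorem cl_cr (x y : EuclideanSpace ℝ (Fin m)) (f : W) :
    K.cl x (K.cr y f) = -K.cr y (K.cl x f) := by
  simp only [cl_apply, cr_apply, map_sum, map_smul, Finset.smul_sum, K.L_ρ, smul_neg,
    Finset.sum_neg_distrib]
  rw [Finset.sum_comm]
  exact congrArg _ (Finset.sum_congr rfl fun i _ => Finset.sum_congr rfl fun j _ => smul_comm _ _ _)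

theorem inner_cl (x : EuclideanSpace ℝ (Fin m)) (f g : W) :
    ⟪K.cl x f, g⟫_ℝ = -⟪f, K.cl x g⟫_ℝ := by
  simp [cl_apply, sum_inner, inner_sum, real_inner_smul_left, real_inner_smul_right, K.inner_L]

theorem inner_cr (x : EuclideanSpace ℝ (Fin m)) (f g : W) :
    ⟪K.cr x f, g⟫_ℝ = ⟪f, K.cr x g⟫_ℝ := by
  simp [cr_apply, sum_inner, inner_sum, real_inner_smul_left, real_inner_smul_right, K.inner_ρ]

theorem ω_cl (x : EuclideanSpace ℝ (Fin m)) (f : W) : K.ω (K.cl x f) = -K.cl x (K.ω f) := by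
  simp [cl_apply, K.ω_L]

theorem ω_cr (x : EuclideanSpace ℝ (Fin m)) (f : W) : K.ω (K.cr x f) = K.cr x (K.ω f) := by
  simp [cr_apply, K.ω_ρ]

theorem ε_cl (x : EuclideanSpace ℝ (Fin m)) (f : W) : K.ε (K.cl x f) = -K.cl x (K.ε f) := by
  simp [cl_apply, K.ε_L]

theorem ε_cr (x : EuclideanSpace ℝ (Fin m)) (f : W) : K.ε (K.cr x f) = -K.cr x (K.ε f) := by
  simp [cr_apply, K.ε_ρ]

theorem N_L (i : Fin m) (f : W) : K.N (K.L i f) = K.L i (K.N f) + K.ρ i f := by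
  refine smul_right_injective W (two_ne_zero' ℝ) ?_
  have h : ∀ j, K.L j (K.ρ j (K.L i f)) = K.L i (K.L j (K.ρ j f)) +
      (if i = j then (2 : ℝ) • K.ρ i f else 0) := by
    intro j
    have h1 := K.L_L i j (K.ρ j f)
    have h2 : K.ρ j (K.L i f) = -K.L i (K.ρ j f) := by rw [K.L_ρ, neg_neg]
    rw [h2, map_neg]
    split_ifs at h1 ⊢ with hij
    · subst hij
      linear_combination (norm := module) (-1 : ℝ) • h1
    · linear_combination (norm := module) (-1 : ℝ) • h1
  simp only [smul_add, K.two_N, ← map_smul, map_add, map_sum]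
  rw [Finset.sum_congr rfl fun j _ => h j, Finset.sum_add_distrib]
  simp
  abel

theorem N_ρ (i : Fin m) (f : W) : K.N (K.ρ i f) = K.ρ i (K.N f) + K.L i f := by
  refine smul_right_injective W (two_ne_zero' ℝ) ?_
  have h : ∀ j, K.L j (K.ρ j (K.ρ i f)) = K.ρ i (K.L j (K.ρ j f)) +
      (if i = j then (2 : ℝ) • K.L i f else 0) := by
    intro j
    have h1 := congrArg (K.L j) (K.ρ_ρ i j f)
    have h2 : K.ρ i (K.L j (K.ρ j f)) = -K.L j (K.ρ i (K.ρ j f)) := by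
      rw [K.L_ρ j i (K.ρ j f), neg_neg]
    rw [map_add] at h1
    rw [h2]
    split_ifs at h1 ⊢ with hij
    · subst hij
      rw [map_smul] at h1
      linear_combination (norm := module) h1
    · rw [map_zero] at h1
      linear_combination (norm := module) h1
  simp only [smul_add, K.two_N, ← map_smul, map_add, map_sum]
  rw [Finset.sum_congr rfl fun j _ => h j, Finset.sum_add_distrib]
  simp
  abel

theorem N_cl (x : EuclideanSpace ℝ (Fin m)) (f : W) :
    K.N (K.cl x f) = K.cl x (K.N f) + K.cr x f := by
  simp [cl_apply, cr_apply, K.N_L, Finset.sum_add_distrib]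

theorem N_cr (x : EuclideanSpace ℝ (Fin m)) (f : W) :
    K.N (K.cr x f) = K.cr x (K.N f) + K.cl x f := by
  simp [cl_apply, cr_apply, K.N_ρ, Finset.sum_add_distrib]

theorem ε_N (f : W) : K.ε (K.N f) = K.N (K.ε f) := by
  refine smul_right_injective W (two_ne_zero' ℝ) ?_
  beta_reduce
  rw [← map_smul K.ε, K.two_N, K.two_N]
  simp only [map_add, map_sum, K.ε_L, K.ε_ρ, map_neg, neg_neg, map_smul]

theorem norm_ω (f : W) : ‖K.ω f‖ = ‖f‖ := by
  rw [← sq_eq_sq₀ (norm_nonneg _) (norm_nonneg _), ← real_inner_self_eq_norm_sq,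
    ← real_inner_self_eq_norm_sq, K.inner_ω, K.ω_ω, inner_neg_right, neg_neg]

/-- Contraction of a linear map with Clifford multiplication. -/
noncomputable def tr (g : EuclideanSpace ℝ (Fin m) →L[ℝ] W) : W :=
  ∑ j, K.L j (g (EuclideanSpace.single j 1))

theorem tr_add (g h : EuclideanSpace ℝ (Fin m) →L[ℝ] W) : K.tr (g + h) = K.tr g + K.tr h := by
  simp [tr, Finset.sum_add_distrib]

theorem tr_smul (c : ℝ) (g : EuclideanSpace ℝ (Fin m) →L[ℝ] W) : K.tr (c • g) = c • K.tr g := by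
  simp [tr, Finset.smul_sum]

theorem tr_comp_of_comm {T : W →L[ℝ] W} (hT : ∀ i f, T (K.L i f) = K.L i (T f))
    (g : EuclideanSpace ℝ (Fin m) →L[ℝ] W) : K.tr (T ∘L g) = T (K.tr g) := by
  simp [tr, hT]

theorem tr_comp_of_anticomm {T : W →L[ℝ] W} (hT : ∀ i f, T (K.L i f) = -K.L i (T f))
    (g : EuclideanSpace ℝ (Fin m) →L[ℝ] W) : K.tr (T ∘L g) = -T (K.tr g) := by
  simp [tr, hT]

theorem sum_coord_smul_single (x : EuclideanSpace ℝ (Fin m)) :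
    ∑ j, x j • (EuclideanSpace.single j 1 : EuclideanSpace ℝ (Fin m)) = x := by
  ext i
  simp [Pi.single_apply]

theorem tr_cl_comp (x : EuclideanSpace ℝ (Fin m)) (g : EuclideanSpace ℝ (Fin m) →L[ℝ] W) :
    K.tr (K.cl x ∘L g) = -K.cl x (K.tr g) - (2 : ℝ) • g x := by
  have h : ∀ j, K.L j (K.cl x (g (EuclideanSpace.single j 1))) =
      -K.cl x (K.L j (g (EuclideanSpace.single j 1))) -
        (2 : ℝ) • g (x j • EuclideanSpace.single j 1) := by
    intro j
    have h1 := K.cl_cl x (EuclideanSpace.single j 1) (g (EuclideanSpace.single j 1))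
    rw [cl_single, cl_single] at h1
    rw [← eq_sub_iff_add_eq'] at h1
    rw [h1, EuclideanSpace.inner_single_right, map_smul, smul_smul]
    simp
    abel
  simp only [tr, ContinuousLinearMap.comp_apply]
  rw [Finset.sum_congr rfl fun j _ => h j, Finset.sum_sub_distrib, Finset.sum_neg_distrib,
    ← Finset.smul_sum, ← map_sum, ← map_sum, sum_coord_smul_single]

theorem tr_cl_flip (f : W) : K.tr (K.cl.flip f) = -(m : ℝ) • f := by
  have h : ∀ j, K.L j (K.L j f) = -f := fun j => by
    have h1 := K.cl_cl_self (EuclideanSpace.single j 1) f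
    rw [cl_single, cl_single] at h1
    simpa using h1
  simp [tr, cl_single, h, Nat.cast_smul_eq_nsmul]

theorem tr_cr_flip (f : W) : K.tr (K.cr.flip f) = (2 : ℝ) • K.N f - (m : ℝ) • f := by
  simp [tr, cr_single, K.two_N]

/-- The symbol of the spherical Dirac operator: its value on a function with derivative `g`
at `x`. -/
noncomputable def gamma (x : EuclideanSpace ℝ (Fin m)) (g : EuclideanSpace ℝ (Fin m) →L[ℝ] W) : W :=
  -(K.cl x (K.tr g) + g x)

theorem gamma_add (x : EuclideanSpace ℝ (Fin m)) (g h : EuclideanSpace ℝ (Fin m) →L[ℝ] W) :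
    K.gamma x (g + h) = K.gamma x g + K.gamma x h := by
  simp [gamma, tr_add]; abel

theorem gamma_smul (x : EuclideanSpace ℝ (Fin m)) (c : ℝ) (g : EuclideanSpace ℝ (Fin m) →L[ℝ] W) :
    K.gamma x (c • g) = c • K.gamma x g := by
  simp [gamma, tr_smul]

theorem gamma_zero_left (g : EuclideanSpace ℝ (Fin m) →L[ℝ] W) : K.gamma 0 g = 0 := by
  simp [gamma]

theorem gamma_comp_of_comm {T : W →L[ℝ] W} (hT : ∀ i f, T (K.L i f) = K.L i (T f))
    (x : EuclideanSpace ℝ (Fin m)) (g : EuclideanSpace ℝ (Fin m) →L[ℝ] W) :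
    K.gamma x (T ∘L g) = T (K.gamma x g) := by
  have h : T (K.cl x (K.tr g)) = K.cl x (T (K.tr g)) := by simp [cl_apply, hT]
  simp [gamma, K.tr_comp_of_comm hT, h]

theorem gamma_comp_of_anticomm {T : W →L[ℝ] W} (hT : ∀ i f, T (K.L i f) = -K.L i (T f))
    (x : EuclideanSpace ℝ (Fin m)) (g : EuclideanSpace ℝ (Fin m) →L[ℝ] W) :
    K.gamma x (T ∘L g) = T (K.gamma x g) := by
  have h : T (K.cl x (K.tr g)) = -K.cl x (T (K.tr g)) := by simp [cl_apply, hT]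
  simp [gamma, K.tr_comp_of_anticomm hT, h]

theorem gamma_cl (x : EuclideanSpace ℝ (Fin m)) (g : EuclideanSpace ℝ (Fin m) →L[ℝ] W) (f : W) :
    K.gamma x (K.cl x ∘L g + K.cl.flip f) =
      ((m : ℝ) - 1) • K.cl x f - K.cl x (K.gamma x g) := by
  simp only [gamma, tr_add, tr_cl_comp, tr_cl_flip, add_apply,
    ContinuousLinearMap.comp_apply, ContinuousLinearMap.flip_apply, map_add, map_sub, map_neg,
    map_smul]
  module

theorem gamma_cr (x : EuclideanSpace ℝ (Fin m)) (g : EuclideanSpace ℝ (Fin m) →L[ℝ] W) (f : W) :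
    K.gamma x (K.cr x ∘L g + K.cr.flip f) =
      K.cr x (K.gamma x g) - K.cl x ((2 : ℝ) • K.N f - (m : ℝ) • f) - K.cr x f := by
  have h : ∀ i f, K.cr x (K.L i f) = -K.L i (K.cr x f) := fun i f => by
    rw [← cl_single, ← cl_single, cl_cr, neg_neg]
  simp only [gamma, tr_add, tr_cr_flip, K.tr_comp_of_anticomm h, add_apply,
    ContinuousLinearMap.comp_apply, ContinuousLinearMap.flip_apply, map_add, map_sub, map_neg,
    map_smul, K.cl_cr]
  module

/-- The fibre over `x` of the bundle of even forms annihilated by contraction with `x`. -/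
noncomputable def Fib (x : EuclideanSpace ℝ (Fin m)) : Submodule ℝ W :=
  LinearMap.eqLocus K.ε.toLinearMap LinearMap.id ⊓
    LinearMap.eqLocus (K.cr x).toLinearMap (K.cl x).toLinearMap

theorem mem_Fib {x : EuclideanSpace ℝ (Fin m)} {f : W} :
    f ∈ K.Fib x ↔ K.ε f = f ∧ K.cr x f = K.cl x f := Iff.rfl

/-- Four times the projection onto the fibre, for a unit vector. -/
noncomputable def proj (x : EuclideanSpace ℝ (Fin m)) : W →L[ℝ] W :=
  (1 + K.ε) - K.cl x ∘L K.cr x ∘L (1 + K.ε)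

theorem proj_apply (x : EuclideanSpace ℝ (Fin m)) (f : W) :
    K.proj x f = (f + K.ε f) - K.cl x (K.cr x (f + K.ε f)) := by
  simp [proj]

theorem proj_mem_Fib {x : EuclideanSpace ℝ (Fin m)} (hx : ‖x‖ = 1) (f : W) :
    K.proj x f ∈ K.Fib x := by
  rw [mem_Fib, proj_apply]
  constructor
  · simp only [map_sub, map_add, K.ε_cl, K.ε_cr, map_neg, neg_neg, K.ε_ε]
    abel
  · generalize f + K.ε f = u
    have h : K.cr x (K.cl x (K.cr x u)) = -K.cl x u := by
      rw [← neg_inj, ← K.cl_cr, K.cr_cr_self, hx]; simp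
    rw [map_sub, map_sub, h, K.cl_cl_self, hx]
    simp
    try abel

theorem proj_of_mem_Fib {x : EuclideanSpace ℝ (Fin m)} (hx : ‖x‖ = 1) {f : W}
    (hf : f ∈ K.Fib x) : K.proj x f = (4 : ℝ) • f := by
  rw [mem_Fib] at hf
  rw [proj_apply, hf.1, map_add, map_add, hf.2, K.cl_cl_self, hx]
  module

theorem inner_proj (x : EuclideanSpace ℝ (Fin m)) (f g : W) :
    ⟪K.proj x f, g⟫_ℝ = ⟪f, K.proj x g⟫_ℝ := by
  have h : ∀ u v, ⟪K.cl x (K.cr x u), v⟫_ℝ = ⟪u, K.cl x (K.cr x v)⟫_ℝ := fun u v => by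
    rw [K.inner_cl, K.inner_cr, ← inner_neg_right, ← K.cl_cr]
  have h2 : K.cl x (K.cr x (K.ε g)) = K.ε (K.cl x (K.cr x g)) := by
    rw [K.ε_cl, K.ε_cr, map_neg, neg_neg]
  simp only [proj_apply, map_add, inner_sub_left, inner_sub_right, inner_add_left, inner_add_right,
    h, K.inner_ε, h2]

theorem inner_ω_N_eq_zero {x : EuclideanSpace ℝ (Fin m)} (hx : ‖x‖ = 1) {f g : W}
    (hf : f ∈ K.Fib x) (hg : g ∈ K.Fib x) : ⟪K.ω (K.N f), g⟫_ℝ = 0 := by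
  rw [mem_Fib] at hf hg
  have h1 : K.cr x (K.N f) = K.cl x (K.N f) := by
    have := congrArg K.N hf.2
    rw [K.N_cl, K.N_cr, hf.2] at this
    exact add_right_cancel this
  have h2 : K.cr x (K.ω (K.N f)) = -K.cl x (K.ω (K.N f)) := by
    rw [← K.ω_cr, h1, K.ω_cl]
  have h3 : ⟪K.cr x (K.ω (K.N f)), K.cr x g⟫_ℝ = ⟪K.ω (K.N f), g⟫_ℝ := by
    rw [K.inner_cr, K.cr_cr_self, hx]; simp
  have h4 : ⟪K.cl x (K.ω (K.N f)), K.cl x g⟫_ℝ = ⟪K.ω (K.N f), g⟫_ℝ := by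
    rw [K.inner_cl, K.cl_cl_self, hx]; simp
  rw [h2, hg.2, inner_neg_left, h4] at h3
  linarith

theorem ω_gamma_sub_mem_Fib {x : EuclideanSpace ℝ (Fin m)} {f u : W} (hf : f ∈ K.Fib x)
    (hε : K.ε u = u) (hu : K.cr x u + K.cl x u = (2 : ℝ) • K.cl x (K.N f)) :
    K.ω (u - K.N f) ∈ K.Fib x := by
  rw [mem_Fib] at hf
  have h1 : K.cr x (K.N f) = K.cl x (K.N f) := by
    have := congrArg K.N hf.2
    rw [K.N_cl, K.N_cr, hf.2] at this
    exact add_right_cancel this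
  rw [mem_Fib]
  constructor
  · rw [K.ε_ω, map_sub, hε, K.ε_N, hf.1]
  · rw [← K.ω_cr, ← neg_neg (K.cl x _), ← K.ω_cl, ← map_neg]
    congr 1
    rw [map_sub, map_sub, h1, ← sub_eq_zero, ← sub_eq_zero.2 hu]
    module

theorem cr_cr_mem_Fib {x a b : EuclideanSpace ℝ (Fin m)} (ha : ⟪x, a⟫_ℝ = 0) (hb : ⟪x, b⟫_ℝ = 0)
    {f : W} (hf : f ∈ K.Fib x) : K.cr a (K.cr b f) ∈ K.Fib x := by
  rw [mem_Fib] at hf ⊢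
  have ha' := fun f => eq_neg_of_add_eq_zero_left
    ((K.cr_cr x a f).trans (by rw [ha, mul_zero, zero_smul]))
  have hb' := fun f => eq_neg_of_add_eq_zero_left
    ((K.cr_cr x b f).trans (by rw [hb, mul_zero, zero_smul]))
  constructor
  · rw [K.ε_cr, K.ε_cr, hf.1, map_neg, neg_neg]
  · rw [ha', hb', hf.2, K.cl_cr, K.cl_cr]

theorem cr_cr_cr_cr {a b : EuclideanSpace ℝ (Fin m)} (ha : ‖a‖ = 1) (hb : ‖b‖ = 1)
    (hab : ⟪a, b⟫_ℝ = 0) (f : W) : K.cr a (K.cr b (K.cr a (K.cr b f))) = -f := by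
  have h := eq_neg_of_add_eq_zero_left
    ((K.cr_cr a b (K.cr b f)).trans (by rw [hab, mul_zero, zero_smul]))
  rw [← neg_eq_iff_eq_neg] at h
  rw [← h]
  simp [K.cr_cr_self, ha, hb]

theorem inner_cr_cr {a b : EuclideanSpace ℝ (Fin m)} (hab : ⟪a, b⟫_ℝ = 0) (f g : W) :
    ⟪K.cr a (K.cr b f), g⟫_ℝ = -⟪f, K.cr a (K.cr b g)⟫_ℝ := by
  have h := eq_neg_of_add_eq_zero_left
    ((K.cr_cr a b g).trans (by rw [hab, mul_zero, zero_smul]))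
  rw [h, K.inner_cr, K.inner_cr, inner_neg_right, neg_neg]

end

end CliffordModel

section SmoothOff

variable {m : ℕ} {W : Type*} [NormedAddCommGroup W] [InnerProductSpace ℝ W]

/-- The functions that are smooth away from the origin. -/
def smoothOff (m : ℕ) (W : Type*) [NormedAddCommGroup W] [InnerProductSpace ℝ W] :
    Submodule ℝ (EuclideanSpace ℝ (Fin m) → W) where
  carrier := {F | ContDiffOn ℝ ∞ F {0}ᶜ}
  zero_mem' := contDiffOn_const
  add_mem' hF hG := ContDiffOn.add hF hG
  smul_mem' c _ hF := ContDiffOn.const_smul c hF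

theorem continuousOn_of_mem_smoothOff {F : EuclideanSpace ℝ (Fin m) → W}
    (hF : F ∈ smoothOff m W) : ContinuousOn F {0}ᶜ := ContDiffOn.continuousOn hF

theorem differentiableAt_of_mem_smoothOff {F : EuclideanSpace ℝ (Fin m) → W}
    (hF : F ∈ smoothOff m W) {x : EuclideanSpace ℝ (Fin m)} (hx : x ≠ 0) :
    DifferentiableAt ℝ F x :=
  (ContDiffOn.differentiableOn hF (by simp)).differentiableAt
    (isOpen_compl_singleton.mem_nhds hx)

theorem contDiffOn_fderiv_of_mem_smoothOff {F : EuclideanSpace ℝ (Fin m) → W}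
    (hF : F ∈ smoothOff m W) : ContDiffOn ℝ ∞ (fderiv ℝ F) {0}ᶜ :=
  ContDiffOn.fderiv_of_isOpen hF isOpen_compl_singleton (by simp)

theorem ne_zero_of_norm_eq_one {x : EuclideanSpace ℝ (Fin m)} (hx : ‖x‖ = 1) : x ≠ 0 := by
  rintro rfl; simp at hx

theorem clm_comp_mem_smoothOff {V : Type*} [NormedAddCommGroup V] [InnerProductSpace ℝ V]
    (T : V →L[ℝ] W) {F : EuclideanSpace ℝ (Fin m) → V}
    (hF : F ∈ smoothOff m V) : (fun x => T (F x)) ∈ smoothOff m W :=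
  T.contDiff.comp_contDiffOn hF

theorem clm_apply_mem_smoothOff {V : Type*} [NormedAddCommGroup V] [InnerProductSpace ℝ V]
    {A : EuclideanSpace ℝ (Fin m) → V →L[ℝ] W} (hA : ContDiffOn ℝ ∞ A {0}ᶜ)
    {F : EuclideanSpace ℝ (Fin m) → V} (hF : F ∈ smoothOff m V) :
    (fun x => A x (F x)) ∈ smoothOff m W :=
  ContDiffOn.clm_apply hA hF

end SmoothOff

namespace CliffordModel

section

variable {m : ℕ} {W : Type*} [NormedAddCommGroup W] [InnerProductSpace ℝ W] (K : CliffordModel m W)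

theorem gamma_eq_sum (x : EuclideanSpace ℝ (Fin m)) (g : EuclideanSpace ℝ (Fin m) →L[ℝ] W) :
    K.gamma x g = (-(1 / 2) : ℝ) • ∑ i, ∑ j, K.L i (K.L j (g (rotVec i j x))) := by
  have h1 : ∑ i, ∑ j, K.L i (K.L j (x i • g (EuclideanSpace.single j 1))) = K.cl x (K.tr g) := by
    simp only [cl_apply, tr, map_sum, map_smul]
    exact Finset.sum_comm
  have h3 : ∀ i j (f : W), K.L i (K.L j f) = -K.L j (K.L i f) + if i = j then (-2 : ℝ) • f else 0 :=
    fun i j f => by rw [← K.L_L]; abel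
  have h2 : ∑ i, ∑ j, K.L i (K.L j (x j • g (EuclideanSpace.single i 1))) =
      -K.cl x (K.tr g) - (2 : ℝ) • g x := by
    rw [Finset.sum_congr rfl fun i _ => Finset.sum_congr rfl fun j _ => h3 i j _]
    simp only [Finset.sum_add_distrib, Finset.sum_neg_distrib]
    rw [Finset.sum_comm, h1, sub_eq_add_neg]
    congr 1
    simp only [Finset.sum_ite_eq, Finset.mem_univ, if_true]
    rw [← Finset.smul_sum, neg_smul]
    conv_rhs => rw [← sum_coord_smul_single x, map_sum]
    simp only [map_smul]
  have h4 : ∀ i j, K.L i (K.L j (g (rotVec i j x))) =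
      K.L i (K.L j (x i • g (EuclideanSpace.single j 1))) -
      K.L i (K.L j (x j • g (EuclideanSpace.single i 1))) := by
    intro i j
    simp only [rotVec, map_sub, map_smul]
  simp only [h4, Finset.sum_sub_distrib]
  rw [h1, h2, gamma]
  module

/-- The spherical Dirac operator. -/
noncomputable def gam (F : EuclideanSpace ℝ (Fin m) → W) (x : EuclideanSpace ℝ (Fin m)) : W :=
  K.gamma x (fderiv ℝ F x)

theorem gam_mem {F : EuclideanSpace ℝ (Fin m) → W} (hF : F ∈ smoothOff m W) :
    K.gam F ∈ smoothOff m W := by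
  have h := contDiffOn_fderiv_of_mem_smoothOff hF
  have h1 : ContDiffOn ℝ ∞ (fun x => K.cl x) {0}ᶜ := K.cl.contDiff.contDiffOn
  refine ContDiffOn.neg (ContDiffOn.add (h1.clm_apply (ContDiffOn.sum fun j _ => ?_))
    (h.clm_apply contDiffOn_id))
  exact (K.L j).contDiff.comp_contDiffOn (h.clm_apply contDiffOn_const)

theorem gam_add {F G : EuclideanSpace ℝ (Fin m) → W} (hF : F ∈ smoothOff m W)
    (hG : G ∈ smoothOff m W) : K.gam (F + G) = K.gam F + K.gam G := by
  funext x
  by_cases hx : x = 0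
  · simp [gam, hx, gamma_zero_left]
  · simp only [gam, Pi.add_apply]
    rw [fderiv_add (differentiableAt_of_mem_smoothOff hF hx)
      (differentiableAt_of_mem_smoothOff hG hx), gamma_add]

theorem gam_smul (c : ℝ) {F : EuclideanSpace ℝ (Fin m) → W} (hF : F ∈ smoothOff m W) :
    K.gam (c • F) = c • K.gam F := by
  funext x
  by_cases hx : x = 0
  · simp [gam, hx, gamma_zero_left]
  · simp only [gam, Pi.smul_apply]
    rw [fderiv_const_smul (differentiableAt_of_mem_smoothOff hF hx), gamma_smul]

theorem fderiv_clm_comp (T : W →L[ℝ] W) {F : EuclideanSpace ℝ (Fin m) → W}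
    {x : EuclideanSpace ℝ (Fin m)} (hF : DifferentiableAt ℝ F x) :
    fderiv ℝ (fun y => T (F y)) x = T ∘L fderiv ℝ F x :=
  (T.hasFDerivAt.comp x hF.hasFDerivAt).fderiv

theorem gam_comp_of_anticomm {T : W →L[ℝ] W} (hT : ∀ i f, T (K.L i f) = -K.L i (T f))
    {F : EuclideanSpace ℝ (Fin m) → W} {x : EuclideanSpace ℝ (Fin m)}
    (hF : DifferentiableAt ℝ F x) : K.gam (fun y => T (F y)) x = T (K.gam F x) := by
  rw [gam, fderiv_clm_comp T hF, K.gamma_comp_of_anticomm hT, gam]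

theorem gam_cl {F : EuclideanSpace ℝ (Fin m) → W} {x : EuclideanSpace ℝ (Fin m)}
    (hF : DifferentiableAt ℝ F x) : K.gam (fun y => K.cl y (F y)) x =
      ((m : ℝ) - 1) • K.cl x (F x) - K.cl x (K.gam F x) := by
  rw [gam, (K.cl.hasFDerivAt.clm_apply hF.hasFDerivAt).fderiv, gamma_cl, gam]

theorem gam_cr {F : EuclideanSpace ℝ (Fin m) → W} {x : EuclideanSpace ℝ (Fin m)}
    (hF : DifferentiableAt ℝ F x) : K.gam (fun y => K.cr y (F y)) x =
      K.cr x (K.gam F x) - K.cl x ((2 : ℝ) • K.N (F x) - (m : ℝ) • F x) - K.cr x (F x) := by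
  rw [gam, (K.cr.hasFDerivAt.clm_apply hF.hasFDerivAt).fderiv, gamma_cr, gam]

theorem cl_mem {F : EuclideanSpace ℝ (Fin m) → W} (hF : F ∈ smoothOff m W) :
    (fun y => K.cl y (F y)) ∈ smoothOff m W :=
  clm_apply_mem_smoothOff K.cl.contDiff.contDiffOn hF

theorem cr_mem {F : EuclideanSpace ℝ (Fin m) → W} (hF : F ∈ smoothOff m W) :
    (fun y => K.cr y (F y)) ∈ smoothOff m W :=
  clm_apply_mem_smoothOff K.cr.contDiff.contDiffOn hF

theorem gam_eq_zero {F : EuclideanSpace ℝ (Fin m) → W} (hF : F ∈ smoothOff m W)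
    (h : ∀ x, ‖x‖ = 1 → F x = 0) {x : EuclideanSpace ℝ (Fin m)} (hx : ‖x‖ = 1) :
    K.gam F x = 0 := by
  have h1 := fderiv_rotVec_eq_zero h hx
    (differentiableAt_of_mem_smoothOff hF (ne_zero_of_norm_eq_one hx))
  rw [gam, gamma_eq_sum]
  simp [h1]

theorem gam_congr {F G : EuclideanSpace ℝ (Fin m) → W} (hF : F ∈ smoothOff m W)
    (hG : G ∈ smoothOff m W) (h : ∀ x, ‖x‖ = 1 → F x = G x) {x : EuclideanSpace ℝ (Fin m)}
    (hx : ‖x‖ = 1) : K.gam F x = K.gam G x := by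
  have h1 := K.gam_eq_zero (F := F + (-1 : ℝ) • G)
    ((smoothOff m W).add_mem hF ((smoothOff m W).smul_mem _ hG))
    (fun y hy => by simp [h y hy]) hx
  rw [K.gam_add hF ((smoothOff m W).smul_mem _ hG), K.gam_smul _ hG] at h1
  simp only [Pi.add_apply, Pi.neg_apply, neg_one_smul] at h1
  exact eq_of_sub_eq_zero (by rw [sub_eq_add_neg, h1])

theorem ω_gam_sub_mem_Fib {F : EuclideanSpace ℝ (Fin m) → W} (hF : F ∈ smoothOff m W)
    (h : ∀ x, ‖x‖ = 1 → F x ∈ K.Fib x) {x : EuclideanSpace ℝ (Fin m)} (hx : ‖x‖ = 1) :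
    K.ω (K.gam F x - K.N (F x)) ∈ K.Fib x := by
  have hd := differentiableAt_of_mem_smoothOff hF (ne_zero_of_norm_eq_one hx)
  refine K.ω_gamma_sub_mem_Fib (h x hx) ?_ ?_
  · rw [← K.gam_comp_of_anticomm K.ε_L hd]
    exact K.gam_congr (clm_comp_mem_smoothOff _ hF) hF (fun y hy => (h y hy).1) hx
  · have h1 := K.gam_congr (K.cr_mem hF) (K.cl_mem hF) (fun y hy => (h y hy).2) hx
    have h2 := (K.mem_Fib.1 (h x hx)).2
    rw [K.gam_cr hd, K.gam_cl hd, h2, map_sub, map_smul, map_smul] at h1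
    linear_combination (norm := module) h1

theorem integral_inner_gam [NeZero m] {F G : EuclideanSpace ℝ (Fin m) → W}
    (hF : F ∈ smoothOff m W) (hG : G ∈ smoothOff m W) :
    ∫ x, ⟪K.gam F x, G x⟫_ℝ ∂sphereMeasure m = ∫ x, ⟪F x, K.gam G x⟫_ℝ ∂sphereMeasure m := by
  have hint : ∀ {A B : EuclideanSpace ℝ (Fin m) → W}, A ∈ smoothOff m W → B ∈ smoothOff m W →
      Integrable (fun x => ⟪A x, B x⟫_ℝ) (sphereMeasure m) := fun hA hB =>
    integrable_sphereMeasure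
      ((continuousOn_of_mem_smoothOff hA).inner (continuousOn_of_mem_smoothOff hB))
  have hLG : ∀ i j, (fun x => K.L j (K.L i (G x))) ∈ smoothOff m W := fun i j =>
    clm_comp_mem_smoothOff _ (clm_comp_mem_smoothOff _ hG)
  have hs : ∀ i j, ContDiffOn ℝ 1 (fun x => ⟪F x, K.L j (K.L i (G x))⟫_ℝ) {0}ᶜ := fun i j =>
    (ContDiffOn.inner ℝ hF (hLG i j)).of_le (by simp)
  have hder : ∀ x ≠ 0, ∀ i j, fderiv ℝ (fun x => ⟪F x, K.L j (K.L i (G x))⟫_ℝ) x (rotVec i j x) =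
      ⟪F x, K.L j (K.L i (fderiv ℝ G x (rotVec i j x)))⟫_ℝ +
      ⟪K.L i (K.L j (fderiv ℝ F x (rotVec i j x))), G x⟫_ℝ := by
    intro x hx i j
    have hd := differentiableAt_of_mem_smoothOff hF hx
    have hd' := differentiableAt_of_mem_smoothOff hG hx
    have e1 : fderiv ℝ (fun x => K.L j (K.L i (G x))) x = (K.L j ∘L K.L i) ∘L fderiv ℝ G x :=
      fderiv_clm_comp (K.L j ∘L K.L i) hd'
    rw [fderiv_inner_apply ℝ hd (differentiableAt_of_mem_smoothOff (hLG i j) hx), e1, K.inner_L,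
      K.inner_L, neg_neg]
    rfl
  have hrot : ∀ (i j : Fin m) (x : EuclideanSpace ℝ (Fin m)), rotVec j i x = -rotVec i j x :=
    fun i j x => by simp [rotVec]
  have key : ∀ᵐ x ∂sphereMeasure m, ⟪K.gam F x, G x⟫_ℝ - ⟪F x, K.gam G x⟫_ℝ =
      ∑ i, ∑ j, (-(1 / 2) : ℝ) *
        fderiv ℝ (fun x => ⟪F x, K.L j (K.L i (G x))⟫_ℝ) x (rotVec i j x) := by
    filter_upwards [ae_ne_zero] with x hx
    have e2 : K.gam G x = (1 / 2 : ℝ) • ∑ i, ∑ j, K.L j (K.L i (fderiv ℝ G x (rotVec i j x))) := by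
      rw [gam, gamma_eq_sum, Finset.sum_comm]
      rw [Finset.sum_congr rfl fun i _ => Finset.sum_congr rfl fun j _ => by rw [hrot i j x]]
      simp only [map_neg, Finset.sum_neg_distrib, smul_neg, neg_smul, neg_neg]
    rw [e2, gam, gamma_eq_sum]
    simp only [hder x hx, real_inner_smul_left, real_inner_smul_right, sum_inner, inner_sum,
      mul_add, Finset.sum_add_distrib, Finset.mul_sum, neg_mul, Finset.sum_neg_distrib]
    ring
  have hzero : ∀ i j, ∫ x, fderiv ℝ (fun x => ⟪F x, K.L j (K.L i (G x))⟫_ℝ) x (rotVec i j x)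
      ∂sphereMeasure m = 0 := fun i j => integral_fderiv_rotVec (hs i j) i j
  have hi : ∀ i j, Integrable (fun x => (-(1 / 2) : ℝ) *
      fderiv ℝ (fun x => ⟪F x, K.L j (K.L i (G x))⟫_ℝ) x (rotVec i j x)) (sphereMeasure m) := by
    intro i j
    refine (integrable_sphereMeasure ?_).const_mul _
    refine ((hs i j).continuousOn_fderiv_of_isOpen isOpen_compl_singleton le_rfl).clm_apply ?_
    exact Continuous.continuousOn (by unfold rotVec; fun_prop)
  rw [← sub_eq_zero, ← integral_sub (hint (K.gam_mem hF) hG) (hint hF (K.gam_mem hG)),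
    integral_congr_ae key, integral_finsetSum _ fun i _ => integrable_finsetSum _ fun j _ => hi i j]
  refine Finset.sum_eq_zero fun i _ => ?_
  rw [integral_finsetSum _ fun j _ => hi i j]
  refine Finset.sum_eq_zero fun j _ => ?_
  rw [integral_const_mul, hzero, mul_zero]

end

end CliffordModel

section Polynomials

variable {m : ℕ} {W : Type*} [NormedAddCommGroup W] [InnerProductSpace ℝ W]

/-- Multiplication of functions by a coordinate. -/
def mulCoord (i : Fin m) :
    (EuclideanSpace ℝ (Fin m) → W) →ₗ[ℝ] (EuclideanSpace ℝ (Fin m) → W) where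
  toFun F x := x i • F x
  map_add' F G := by funext x; simp
  map_smul' c F := funext fun x => smul_comm (x i) c (F x)

theorem mulCoord_apply (i : Fin m) (F : EuclideanSpace ℝ (Fin m) → W)
    (x : EuclideanSpace ℝ (Fin m)) : mulCoord i F x = x i • F x := rfl

/-- The homogeneous polynomial maps of degree `k`. -/
noncomputable def homPoly (m : ℕ) (W : Type*) [NormedAddCommGroup W] [InnerProductSpace ℝ W] :
    ℕ → Submodule ℝ (EuclideanSpace ℝ (Fin m) → W)
  | 0 => LinearMap.range (LinearMap.pi fun _ => (LinearMap.id : W →ₗ[ℝ] W))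
  | k + 1 => ⨆ i, (homPoly m W k).map (mulCoord i)

/-- The polynomial maps of degree at most `k`. -/
noncomputable def polyLE (m : ℕ) (W : Type*) [NormedAddCommGroup W] [InnerProductSpace ℝ W] :
    ℕ → Submodule ℝ (EuclideanSpace ℝ (Fin m) → W)
  | 0 => homPoly m W 0
  | k + 1 => polyLE m W k ⊔ homPoly m W (k + 1)

theorem const_mem_homPoly (w : W) : (fun _ => w) ∈ homPoly m W 0 := ⟨w, rfl⟩

theorem mem_homPoly_zero {F : EuclideanSpace ℝ (Fin m) → W} (h : F ∈ homPoly m W 0) :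
    ∃ w, F = fun _ => w := by
  obtain ⟨w, rfl⟩ := h
  exact ⟨w, rfl⟩

theorem mulCoord_mem_homPoly (i : Fin m) {k : ℕ} {F : EuclideanSpace ℝ (Fin m) → W}
    (h : F ∈ homPoly m W k) : mulCoord i F ∈ homPoly m W (k + 1) :=
  Submodule.mem_iSup_of_mem i ⟨F, h, rfl⟩

theorem homPoly_induction {p : ℕ → (EuclideanSpace ℝ (Fin m) → W) → Prop}
    (const : ∀ w, p 0 fun _ => w)
    (mul : ∀ k i F, F ∈ homPoly m W k → p k F → p (k + 1) (mulCoord i F))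
    (zero : ∀ k, p (k + 1) 0)
    (add : ∀ k F G, p (k + 1) F → p (k + 1) G → p (k + 1) (F + G))
    {k : ℕ} {F : EuclideanSpace ℝ (Fin m) → W} (hF : F ∈ homPoly m W k) : p k F := by
  induction k generalizing F with
  | zero =>
    obtain ⟨w, rfl⟩ := hF
    exact const w
  | succ k ih =>
    refine Submodule.iSup_induction _ (motive := p (k + 1)) hF ?_ (zero k) (add k)
    rintro i _ ⟨G, hG, rfl⟩
    exact mul k i G hG (ih hG)

theorem contDiff_of_mem_homPoly {k : ℕ} {F : EuclideanSpace ℝ (Fin m) → W}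
    (hF : F ∈ homPoly m W k) : ContDiff ℝ ∞ F := by
  refine homPoly_induction (p := fun _ F => ContDiff ℝ ∞ F) (fun w => contDiff_const) ?_
    (fun k => contDiff_const) (fun k F G h1 h2 => h1.add h2) hF
  intro k i F _ h
  exact ContDiff.smul (by fun_prop) h

theorem fderiv_mulCoord (i : Fin m) {F : EuclideanSpace ℝ (Fin m) → W}
    {x : EuclideanSpace ℝ (Fin m)} (hF : DifferentiableAt ℝ F x) (v : EuclideanSpace ℝ (Fin m)) :
    fderiv ℝ (mulCoord i F) x v = x i • fderiv ℝ F x v + v i • F x := by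
  have h : HasFDerivAt (fun y : EuclideanSpace ℝ (Fin m) => y i)
      (EuclideanSpace.proj i : EuclideanSpace ℝ (Fin m) →L[ℝ] ℝ) x :=
    (EuclideanSpace.proj i : EuclideanSpace ℝ (Fin m) →L[ℝ] ℝ).hasFDerivAt
  have h2 : HasFDerivAt (mulCoord i F) _ x := h.smul hF.hasFDerivAt
  rw [h2.fderiv]
  simp

theorem differentiable_of_mem_homPoly {k : ℕ} {F : EuclideanSpace ℝ (Fin m) → W}
    (hF : F ∈ homPoly m W k) : Differentiable ℝ F :=
  (contDiff_of_mem_homPoly hF).differentiable (by simp)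

theorem fderiv_self_of_mem_homPoly {k : ℕ} {F : EuclideanSpace ℝ (Fin m) → W}
    (hF : F ∈ homPoly m W k) (x : EuclideanSpace ℝ (Fin m)) :
    fderiv ℝ F x x = (k : ℝ) • F x := by
  refine (homPoly_induction (p := fun k F => Differentiable ℝ F ∧
    fderiv ℝ F x x = (k : ℝ) • F x) ?_ ?_ ?_ ?_ hF).2
  · intro w; simp
  · rintro k i F hF ⟨h1, h2⟩
    refine ⟨differentiable_of_mem_homPoly (mulCoord_mem_homPoly i hF), ?_⟩
    rw [fderiv_mulCoord i (h1 x), h2, mulCoord_apply]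
    push_cast
    module
  · intro k
    exact ⟨differentiable_const _, by simp⟩
  · rintro k F G ⟨h1, h2⟩ ⟨h3, h4⟩
    refine ⟨h1.add h3, ?_⟩
    rw [fderiv_add (h1 x) (h3 x), add_apply, h2, h4, Pi.add_apply, smul_add]

theorem fderiv_mem_homPoly {k : ℕ} {F : EuclideanSpace ℝ (Fin m) → W}
    (hF : F ∈ homPoly m W (k + 1)) (v : EuclideanSpace ℝ (Fin m)) :
    (fun x => fderiv ℝ F x v) ∈ homPoly m W k := by
  refine (homPoly_induction (p := fun k F => Differentiable ℝ F ∧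
    ∀ l, k = l + 1 → (fun x => fderiv ℝ F x v) ∈ homPoly m W l) ?_ ?_ ?_ ?_ hF).2 k rfl
  · intro w; simp
  · rintro k i F hF ⟨h1, h2⟩
    refine ⟨differentiable_of_mem_homPoly (mulCoord_mem_homPoly i hF), ?_⟩
    intro l hl
    obtain rfl : k = l := by omega
    have h3 : (fun x => fderiv ℝ (mulCoord i F) x v) =
        mulCoord i (fun x => fderiv ℝ F x v) + v i • F := by
      funext x
      rw [fderiv_mulCoord i (h1 x)]
      rfl
    rw [h3]
    refine Submodule.add_mem _ ?_ (Submodule.smul_mem _ _ hF)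
    cases k with
    | zero =>
      obtain ⟨w, rfl⟩ := hF
      have : (fun x : EuclideanSpace ℝ (Fin m) =>
          fderiv ℝ (LinearMap.pi (fun _ => (LinearMap.id : W →ₗ[ℝ] W)) w) x v) = 0 := by
        funext x
        change fderiv ℝ (fun _ => w) x v = 0
        simp
      rw [this, map_zero]
      exact Submodule.zero_mem _
    | succ k => exact mulCoord_mem_homPoly i (h2 k rfl)
  · intro k
    refine ⟨differentiable_const _, fun l _ => ?_⟩
    have : (fun x : EuclideanSpace ℝ (Fin m) =>
        fderiv ℝ (0 : EuclideanSpace ℝ (Fin m) → W) x v) = 0 := by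
      funext x
      simp
    rw [this]
    exact Submodule.zero_mem _
  · rintro k F G ⟨h1, h2⟩ ⟨h3, h4⟩
    refine ⟨h1.add h3, fun l hl => ?_⟩
    have : (fun x => fderiv ℝ (F + G) x v) =
        (fun x => fderiv ℝ F x v) + fun x => fderiv ℝ G x v := by
      funext x
      rw [fderiv_add (h1 x) (h3 x), add_apply, Pi.add_apply]
    rw [this]
    exact Submodule.add_mem _ (h2 l hl) (h4 l hl)

theorem comp_mem_homPoly {V : Type*} [NormedAddCommGroup V] [InnerProductSpace ℝ V]
    (T : W →ₗ[ℝ] V) {k : ℕ} {F : EuclideanSpace ℝ (Fin m) → W}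
    (hF : F ∈ homPoly m W k) : (fun x => T (F x)) ∈ homPoly m V k := by
  refine homPoly_induction (p := fun k F => (fun x => T (F x)) ∈ homPoly m V k) ?_ ?_ ?_ ?_ hF
  · intro w; exact const_mem_homPoly _
  · intro k i F _ h
    have : (fun x => T (mulCoord i F x)) = mulCoord i (fun x => T (F x)) := by
      funext x; simp [mulCoord_apply]
    rw [this]; exact mulCoord_mem_homPoly i h
  · intro k
    simp only [Pi.zero_apply, map_zero]
    exact Submodule.zero_mem _
  · intro k F G h1 h2
    simp only [Pi.add_apply, map_add]
    exact Submodule.add_mem _ h1 h2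

theorem finiteDimensional_homPoly [FiniteDimensional ℝ W] (k : ℕ) :
    FiniteDimensional ℝ (homPoly m W k) := by
  induction k with
  | zero => rw [homPoly]; infer_instance
  | succ k ih => rw [homPoly]; infer_instance

theorem finiteDimensional_polyLE [FiniteDimensional ℝ W] (k : ℕ) :
    FiniteDimensional ℝ (polyLE m W k) := by
  have := finiteDimensional_homPoly (m := m) (W := W)
  induction k with
  | zero => exact this 0
  | succ k ih => rw [polyLE]; exact Submodule.finiteDimensional_sup _ _

theorem polyLE_mono : Monotone (polyLE m W) :=
  monotone_nat_of_le_succ fun _ => le_sup_left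

theorem homPoly_le_polyLE (k : ℕ) : homPoly m W k ≤ polyLE m W k := by
  cases k with
  | zero => exact le_rfl
  | succ k => exact le_sup_right

theorem polyLE_induction {p : ℕ → (EuclideanSpace ℝ (Fin m) → W) → Prop}
    (hom : ∀ k F, F ∈ homPoly m W k → p k F) (succ : ∀ k F, F ∈ polyLE m W k → p k F → p (k + 1) F)
    (add : ∀ k F G, p k F → p k G → p k (F + G)) {k : ℕ} {F : EuclideanSpace ℝ (Fin m) → W}
    (hF : F ∈ polyLE m W k) : p k F := by
  induction k generalizing F with
  | zero => exact hom 0 F hF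
  | succ k ih =>
    obtain ⟨A, hA, B, hB, rfl⟩ := Submodule.mem_sup.1 hF
    exact add _ _ _ (succ k A hA (ih hA)) (hom _ B hB)

theorem contDiff_of_mem_polyLE {k : ℕ} {F : EuclideanSpace ℝ (Fin m) → W}
    (hF : F ∈ polyLE m W k) : ContDiff ℝ ∞ F :=
  polyLE_induction (p := fun _ F => ContDiff ℝ ∞ F) (fun _ _ => contDiff_of_mem_homPoly)
    (fun _ _ _ => id) (fun _ _ _ h1 h2 => h1.add h2) hF

theorem mulCoord_mem_polyLE (i : Fin m) {k : ℕ} {F : EuclideanSpace ℝ (Fin m) → W}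
    (hF : F ∈ polyLE m W k) : mulCoord i F ∈ polyLE m W (k + 1) := by
  refine polyLE_induction (p := fun k F => mulCoord i F ∈ polyLE m W (k + 1)) ?_ ?_ ?_ hF
  · exact fun k F h => homPoly_le_polyLE _ (mulCoord_mem_homPoly i h)
  · exact fun k F _ h => polyLE_mono (Nat.le_succ _) h
  · intro k F G h1 h2
    rw [map_add]; exact Submodule.add_mem _ h1 h2

theorem comp_mem_polyLE {V : Type*} [NormedAddCommGroup V] [InnerProductSpace ℝ V]
    (T : W →ₗ[ℝ] V) {k : ℕ} {F : EuclideanSpace ℝ (Fin m) → W}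
    (hF : F ∈ polyLE m W k) : (fun x => T (F x)) ∈ polyLE m V k := by
  refine polyLE_induction (p := fun k F => (fun x => T (F x)) ∈ polyLE m V k) ?_ ?_ ?_ hF
  · exact fun k F h => homPoly_le_polyLE _ (comp_mem_homPoly T h)
  · exact fun k F _ h => polyLE_mono (Nat.le_succ _) h
  · intro k F G h1 h2
    simp only [Pi.add_apply, map_add]
    exact Submodule.add_mem _ h1 h2

theorem mem_smoothOff_of_mem_polyLE {k : ℕ} {F : EuclideanSpace ℝ (Fin m) → W}
    (hF : F ∈ polyLE m W k) : F ∈ smoothOff m W := (contDiff_of_mem_polyLE hF).contDiffOn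

theorem mem_smoothOff_of_mem_homPoly {k : ℕ} {F : EuclideanSpace ℝ (Fin m) → W}
    (hF : F ∈ homPoly m W k) : F ∈ smoothOff m W := (contDiff_of_mem_homPoly hF).contDiffOn

/-- The multiples of polynomial maps by a function that is polynomial on the sphere are
polynomial on the sphere. -/
theorem exists_polyLE_smul_eq {g : C({x : EuclideanSpace ℝ (Fin m) // ‖x‖ = 1}, ℝ)}
    (hg : g ∈ Algebra.adjoin ℝ (range fun i : Fin m =>
      (⟨fun x => x.1 i, by fun_prop⟩ : C({x : EuclideanSpace ℝ (Fin m) // ‖x‖ = 1}, ℝ)))) :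
    ∀ k, ∀ q ∈ polyLE m W k, ∃ l, ∃ p ∈ polyLE m W l,
      ∀ x : {x : EuclideanSpace ℝ (Fin m) // ‖x‖ = 1}, p x = g x • q x := by
  induction hg using Algebra.adjoin_induction with
  | mem g hg =>
    obtain ⟨i, rfl⟩ := hg
    exact fun k q hq => ⟨k + 1, mulCoord i q, mulCoord_mem_polyLE i hq, fun x => rfl⟩
  | algebraMap r =>
    exact fun k q hq => ⟨k, r • q, Submodule.smul_mem _ _ hq, fun x => rfl⟩
  | add g h _ _ hg hh =>
    intro k q hq
    obtain ⟨l, p, hp, h1⟩ := hg k q hq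
    obtain ⟨l', p', hp', h2⟩ := hh k q hq
    refine ⟨max l l', p + p', Submodule.add_mem _ (polyLE_mono (le_max_left _ _) hp)
      (polyLE_mono (le_max_right _ _) hp'), fun x => ?_⟩
    rw [Pi.add_apply, h1, h2, ContinuousMap.add_apply, add_smul]
  | mul g h _ _ hg hh =>
    intro k q hq
    obtain ⟨l, p, hp, h1⟩ := hh k q hq
    obtain ⟨l', p', hp', h2⟩ := hg l p hp
    refine ⟨l', p', hp', fun x => ?_⟩
    rw [h2, h1, ContinuousMap.mul_apply, mul_smul]

/-- Polynomial maps approximate continuous maps on the sphere. -/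
theorem exists_polyLE_near [FiniteDimensional ℝ W] {F : EuclideanSpace ℝ (Fin m) → W}
    (hF : ContinuousOn F {x | ‖x‖ = 1}) {ε : ℝ} (hε : 0 < ε) :
    ∃ k, ∃ p ∈ polyLE m W k, ∀ x, ‖x‖ = 1 → ‖F x - p x‖ < ε := by
  have : CompactSpace {x : EuclideanSpace ℝ (Fin m) // ‖x‖ = 1} :=
    isCompact_iff_compactSpace.1 isCompact_unitSphere
  set A := Algebra.adjoin ℝ (range fun i : Fin m =>
      (⟨fun x => x.1 i, by fun_prop⟩ : C({x : EuclideanSpace ℝ (Fin m) // ‖x‖ = 1}, ℝ))) with hA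
  have hsep : A.SeparatesPoints := by
    intro x y hxy
    have : ∃ i, x.1 i ≠ y.1 i := by
      by_contra! h
      exact hxy (Subtype.ext (PiLp.ext h))
    obtain ⟨i, hi⟩ := this
    exact ⟨_, ⟨_, Algebra.subset_adjoin ⟨i, rfl⟩, rfl⟩, hi⟩
  have hF' : Continuous fun x : {x : EuclideanSpace ℝ (Fin m) // ‖x‖ = 1} => F x :=
    continuousOn_iff_continuous_domRestrict.1 hF
  let b := stdOrthonormalBasis ℝ W
  set d : ℝ := (Module.finrank ℝ W : ℝ) + 1 with hd
  have hd0 : 0 < d := by positivity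
  have h1 : ∀ i, ∃ k, ∃ p ∈ polyLE m W k, ∀ x, ‖x‖ = 1 → ‖⟪b i, F x⟫_ℝ • b i - p x‖ < ε / d := by
    intro i
    obtain ⟨g, hg⟩ := ContinuousMap.exists_mem_subalgebra_near_continuous_of_separatesPoints A hsep
      (fun x => ⟪b i, F x⟫_ℝ) (continuous_const.inner hF') (ε / d) (by positivity)
    obtain ⟨k, p, hp, h⟩ := exists_polyLE_smul_eq g.2 0 (fun _ => b i) (const_mem_homPoly _)
    refine ⟨k, p, hp, fun x hx => ?_⟩
    rw [h ⟨x, hx⟩, ← sub_smul, norm_smul, b.norm_eq_one, mul_one, norm_sub_rev]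
    exact hg ⟨x, hx⟩
  choose k p hp h2 using h1
  refine ⟨Finset.univ.sup k, ∑ i, p i, Submodule.sum_mem _ fun i _ =>
    polyLE_mono (Finset.le_sup (Finset.mem_univ i)) (hp i), fun x hx => ?_⟩
  calc ‖F x - (∑ i, p i) x‖ = ‖∑ i, (⟪b i, F x⟫_ℝ • b i - p i x)‖ := by
        rw [Finset.sum_sub_distrib, b.sum_repr', Finset.sum_apply]
    _ ≤ ∑ i, ‖⟪b i, F x⟫_ℝ • b i - p i x‖ := norm_sum_le _ _
    _ ≤ ∑ i : Fin (Module.finrank ℝ W), ε / d := Finset.sum_le_sum fun i _ => (h2 i x hx).le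
    _ < ε := by
        rw [Finset.sum_const, Finset.card_univ, Fintype.card_fin, nsmul_eq_mul, mul_div_assoc',
          div_lt_iff₀ hd0]
        nlinarith

end Polynomials

namespace CliffordModel

section

variable {m : ℕ} {W : Type*} [NormedAddCommGroup W] [InnerProductSpace ℝ W] (K : CliffordModel m W)

theorem cl_mem_homPoly {k : ℕ} {F : EuclideanSpace ℝ (Fin m) → W} (hF : F ∈ homPoly m W k) :
    (fun x => K.cl x (F x)) ∈ homPoly m W (k + 1) := by
  have : (fun x => K.cl x (F x)) = ∑ i, mulCoord i (fun x => K.L i (F x)) := by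
    funext x
    simp [cl_apply, mulCoord_apply]
  rw [this]
  exact Submodule.sum_mem _ fun i _ =>
    mulCoord_mem_homPoly i (comp_mem_homPoly (K.L i).toLinearMap hF)

theorem cl_mem_polyLE {k : ℕ} {F : EuclideanSpace ℝ (Fin m) → W} (hF : F ∈ polyLE m W k) :
    (fun x => K.cl x (F x)) ∈ polyLE m W (k + 1) := by
  have : (fun x => K.cl x (F x)) = ∑ i, mulCoord i (fun x => K.L i (F x)) := by
    funext x
    simp [cl_apply, mulCoord_apply]
  rw [this]
  exact Submodule.sum_mem _ fun i _ =>
    mulCoord_mem_polyLE i (comp_mem_polyLE (K.L i).toLinearMap hF)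

theorem cr_mem_polyLE {k : ℕ} {F : EuclideanSpace ℝ (Fin m) → W} (hF : F ∈ polyLE m W k) :
    (fun x => K.cr x (F x)) ∈ polyLE m W (k + 1) := by
  have : (fun x => K.cr x (F x)) = ∑ i, mulCoord i (fun x => K.ρ i (F x)) := by
    funext x
    simp [cr_apply, mulCoord_apply]
  rw [this]
  exact Submodule.sum_mem _ fun i _ =>
    mulCoord_mem_polyLE i (comp_mem_polyLE (K.ρ i).toLinearMap hF)

theorem proj_mem_polyLE {k : ℕ} {F : EuclideanSpace ℝ (Fin m) → W} (hF : F ∈ polyLE m W k) :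
    (fun x => K.proj x (F x)) ∈ polyLE m W (k + 2) := by
  have h1 : (F + fun x => K.ε (F x)) ∈ polyLE m W k :=
    Submodule.add_mem _ hF (comp_mem_polyLE K.ε.toLinearMap hF)
  have h2 : (fun x => K.proj x (F x)) = (F + fun x => K.ε (F x)) -
      fun x => K.cl x (K.cr x ((F + fun x => K.ε (F x)) x)) := by
    funext x; simp [proj_apply]
  rw [h2]
  exact Submodule.sub_mem _ (polyLE_mono (by omega) h1) (K.cl_mem_polyLE (K.cr_mem_polyLE h1))

/-- The Dirac operator. -/
noncomputable def dirac (F : EuclideanSpace ℝ (Fin m) → W) (x : EuclideanSpace ℝ (Fin m)) : W :=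
  K.tr (fderiv ℝ F x)

theorem dirac_mem_homPoly {k : ℕ} {F : EuclideanSpace ℝ (Fin m) → W}
    (hF : F ∈ homPoly m W (k + 1)) : K.dirac F ∈ homPoly m W k := by
  have : K.dirac F = ∑ j, fun x => K.L j (fderiv ℝ F x (EuclideanSpace.single j 1)) := by
    funext x
    simp [dirac, tr]
  rw [this]
  exact Submodule.sum_mem _ fun j _ =>
    comp_mem_homPoly (K.L j).toLinearMap (fderiv_mem_homPoly hF _)

theorem gam_of_mem_homPoly {k : ℕ} {F : EuclideanSpace ℝ (Fin m) → W}
    (hF : F ∈ homPoly m W k) (x : EuclideanSpace ℝ (Fin m)) :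
    K.gam F x = -(K.cl x (K.dirac F x) + (k : ℝ) • F x) := by
  rw [← fderiv_self_of_mem_homPoly hF]; rfl

theorem gam_const (w : W) : K.gam (fun _ => w) = 0 := by
  funext x
  simp [gam, gamma, tr]

theorem gam_mem_homPoly {k : ℕ} {F : EuclideanSpace ℝ (Fin m) → W}
    (hF : F ∈ homPoly m W k) : K.gam F ∈ homPoly m W k := by
  cases k with
  | zero =>
    obtain ⟨w, rfl⟩ := mem_homPoly_zero hF
    rw [gam_const]; exact Submodule.zero_mem _
  | succ k =>
    have : K.gam F = -((fun x => K.cl x (K.dirac F x)) + ((k + 1 : ℕ) : ℝ) • F) :=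
      funext fun x => K.gam_of_mem_homPoly hF x
    rw [this]
    exact Submodule.neg_mem _ (Submodule.add_mem _ (K.cl_mem_homPoly (K.dirac_mem_homPoly hF))
      (Submodule.smul_mem _ _ hF))

theorem gam_mem_polyLE {k : ℕ} {F : EuclideanSpace ℝ (Fin m) → W}
    (hF : F ∈ polyLE m W k) : K.gam F ∈ polyLE m W k := by
  refine (polyLE_induction (p := fun k F => F ∈ smoothOff m W ∧ K.gam F ∈ polyLE m W k)
    ?_ ?_ ?_ hF).2
  · exact fun k F h => ⟨mem_smoothOff_of_mem_homPoly h, homPoly_le_polyLE _ (K.gam_mem_homPoly h)⟩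
  · exact fun k F _ h => ⟨h.1, polyLE_mono (Nat.le_succ _) h.2⟩
  · rintro k F G ⟨h1, h2⟩ ⟨h3, h4⟩
    exact ⟨Submodule.add_mem _ h1 h3, by rw [K.gam_add h1 h3]; exact Submodule.add_mem _ h2 h4⟩

theorem gam_gam_of_mem_homPoly {k : ℕ} {F : EuclideanSpace ℝ (Fin m) → W}
    (hF : F ∈ homPoly m W (k + 1)) (x : EuclideanSpace ℝ (Fin m)) :
    K.gam (K.gam F) x - ((m : ℝ) - 2) • K.gam F x =
      (((k : ℝ) + 1) * ((k : ℝ) + m - 1)) • F x + (‖x‖ ^ 2) • K.dirac (K.dirac F) x := by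
  have hD := K.dirac_mem_homPoly hF
  have h1 : K.gam F = (-1 : ℝ) • ((fun x => K.cl x (K.dirac F x)) + ((k + 1 : ℕ) : ℝ) • F) := by
    funext x
    rw [K.gam_of_mem_homPoly hF x, Pi.smul_apply, neg_one_smul]
    rfl
  have h2 : K.gam (K.gam F) x = (-1 : ℝ) • (K.gam (fun x => K.cl x (K.dirac F x)) x +
      ((k + 1 : ℕ) : ℝ) • K.gam F x) := by
    have e1 := mem_smoothOff_of_mem_homPoly (K.cl_mem_homPoly hD)
    have e2 := mem_smoothOff_of_mem_homPoly hF
    conv_lhs => rw [h1]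
    rw [K.gam_smul _ (Submodule.add_mem _ e1 (Submodule.smul_mem _ _ e2)),
      K.gam_add e1 (Submodule.smul_mem _ _ e2), K.gam_smul _ e2]
    rfl
  rw [h2, K.gam_cl (differentiable_of_mem_homPoly hD x), K.gam_of_mem_homPoly hD,
    K.gam_of_mem_homPoly hF, map_neg, map_add, K.cl_cl_self, map_smul]
  push_cast
  module

/-- On polynomials of degree at most `k`, the Laplacian acts by a scalar, up to terms of lower
degree. -/
theorem exists_gam_gam_eq {k : ℕ} {F : EuclideanSpace ℝ (Fin m) → W}
    (hF : F ∈ polyLE m W (k + 1)) : ∃ R ∈ polyLE m W k, ∀ x, ‖x‖ = 1 →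
      K.gam (K.gam F) x - ((m : ℝ) - 2) • K.gam F x =
      (((k : ℝ) + 1) * ((k : ℝ) + m - 1)) • F x + R x := by
  obtain ⟨A, hA, B, hB, rfl⟩ := Submodule.mem_sup.1 hF
  have hDD : K.dirac (K.dirac B) ∈ polyLE m W k := by
    cases k with
    | zero =>
      obtain ⟨w, hw⟩ := mem_homPoly_zero (K.dirac_mem_homPoly hB)
      have : K.dirac (K.dirac B) = 0 := by
        rw [hw]; funext x; simp [dirac, tr]
      rw [this]; exact Submodule.zero_mem _
    | succ k =>
      exact polyLE_mono (Nat.le_succ _)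
        (homPoly_le_polyLE _ (K.dirac_mem_homPoly (K.dirac_mem_homPoly hB)))
  refine ⟨K.gam (K.gam A) - ((m : ℝ) - 2) • K.gam A - (((k : ℝ) + 1) * ((k : ℝ) + m - 1)) • A +
    K.dirac (K.dirac B), ?_, fun x hx => ?_⟩
  · have h := K.gam_mem_polyLE hA
    exact Submodule.add_mem _ (Submodule.sub_mem _ (Submodule.sub_mem _ (K.gam_mem_polyLE h)
      (Submodule.smul_mem _ _ h)) (Submodule.smul_mem _ _ hA)) hDD
  · have eA := mem_smoothOff_of_mem_polyLE hA
    have eB := mem_smoothOff_of_mem_homPoly hB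
    have h := K.gam_gam_of_mem_homPoly hB x
    rw [hx, one_pow, one_smul] at h
    rw [K.gam_add eA eB, K.gam_add (K.gam_mem eA) (K.gam_mem eB)]
    simp only [Pi.add_apply, Pi.sub_apply, Pi.smul_apply]
    linear_combination (norm := module) h

end

end CliffordModel

section ToLp

variable {m : ℕ} {W : Type*} [NormedAddCommGroup W] [InnerProductSpace ℝ W]

/-- The class in `L²` of the sphere of a function that is smooth away from the origin. -/
noncomputable def sphereToLp (m : ℕ) [NeZero m] (W : Type*) [NormedAddCommGroup W]
    [InnerProductSpace ℝ W] : smoothOff m W →ₗ[ℝ] Lp W 2 (sphereMeasure m) where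
  toFun F := (memLp_sphereMeasure (continuousOn_of_mem_smoothOff F.2) 2).toLp
  map_add' _ _ := MemLp.toLp_add _ _
  map_smul' _ _ := MemLp.toLp_const_smul _ _

theorem sphereMeasure_ne_zero : sphereMeasure m ≠ 0 := by
  rw [sphereMeasure, Ne, Measure.map_eq_zero_iff measurable_normalize.aemeasurable,
    Measure.restrict_eq_zero]
  exact (Metric.measure_ball_pos _ _ one_pos).ne'

/-- A subspace which contains almost every point of the sphere is everything. -/
theorem eq_top_of_ae_mem_sphere {T : Submodule ℝ (EuclideanSpace ℝ (Fin m))}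
    (h : ∀ᵐ x ∂sphereMeasure m, x ∈ T) : T = ⊤ := by
  by_contra hT
  have h1 := Measure.addHaar_submodule (volume : Measure (EuclideanSpace ℝ (Fin m))) T hT
  have h2 := ae_of_ae_map measurable_normalize.aemeasurable h
  have h3 : ∀ᵐ x ∂(volume.restrict (Metric.ball (0 : EuclideanSpace ℝ (Fin m)) 1)), False := by
    filter_upwards [h2, ae_restrict_of_ae (measure_eq_zero_iff_ae_notMem.1 h1)] with x hx hx'
    refine hx' ?_
    by_cases h0 : x = 0
    · simp [h0]
    · exact (T.smul_mem_iff (inv_ne_zero (norm_ne_zero_iff.2 h0))).1 hx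
  rw [eventually_false_iff_eq_bot, ae_eq_bot, Measure.restrict_eq_zero] at h3
  exact (Metric.measure_ball_pos _ _ one_pos).ne' h3

variable [NeZero m]

theorem coeFn_sphereToLp (F : smoothOff m W) :
    sphereToLp m W F =ᵐ[sphereMeasure m] (F : EuclideanSpace ℝ (Fin m) → W) :=
  MemLp.coeFn_toLp (memLp_sphereMeasure (continuousOn_of_mem_smoothOff F.2) 2)

theorem inner_sphereToLp (F G : smoothOff m W) :
    ⟪sphereToLp m W F, sphereToLp m W G⟫_ℝ =
      ∫ x, ⟪(F : EuclideanSpace ℝ (Fin m) → W) x, (G : EuclideanSpace ℝ (Fin m) → W) x⟫_ℝ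
        ∂sphereMeasure m := by
  rw [L2.inner_def]
  refine integral_congr_ae ?_
  filter_upwards [coeFn_sphereToLp F, coeFn_sphereToLp G] with x hF hG
  rw [hF, hG]

theorem integrable_inner (F G : smoothOff m W) : Integrable (fun x =>
    ⟪(F : EuclideanSpace ℝ (Fin m) → W) x, (G : EuclideanSpace ℝ (Fin m) → W) x⟫_ℝ)
    (sphereMeasure m) :=
  integrable_sphereMeasure
    ((continuousOn_of_mem_smoothOff F.2).inner (continuousOn_of_mem_smoothOff G.2))

theorem inner_sphereToLp_congr {F G F' G' : smoothOff m W}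
    (h : ∀ x, ‖x‖ = 1 → ⟪F.1 x, G.1 x⟫_ℝ = ⟪F'.1 x, G'.1 x⟫_ℝ) :
    ⟪sphereToLp m W F, sphereToLp m W G⟫_ℝ = ⟪sphereToLp m W F', sphereToLp m W G'⟫_ℝ := by
  rw [inner_sphereToLp, inner_sphereToLp]
  exact integral_congr_ae (ae_norm_eq_one.mono fun x hx => h x hx)

theorem sphereToLp_congr {F G : smoothOff m W} (h : ∀ x, ‖x‖ = 1 → F.1 x = G.1 x) :
    sphereToLp m W F = sphereToLp m W G :=
  MemLp.toLp_congr (memLp_sphereMeasure (continuousOn_of_mem_smoothOff F.2) 2)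
    (memLp_sphereMeasure (continuousOn_of_mem_smoothOff G.2) 2) (ae_norm_eq_one.mono fun x hx => h x hx)

theorem norm_sphereToLp_le_mul {F G : smoothOff m W} {c : ℝ}
    (h : ∀ x, ‖x‖ = 1 → ‖F.1 x‖ ≤ c * ‖G.1 x‖) :
    ‖sphereToLp m W F‖ ≤ c * ‖sphereToLp m W G‖ := by
  refine Lp.norm_le_mul_norm_of_ae_le_mul ?_
  filter_upwards [coeFn_sphereToLp F, coeFn_sphereToLp G, ae_norm_eq_one] with x hF hG hx
  rw [hF, hG]
  exact h x hx

theorem exists_norm_sphereToLp_le : ∃ c : ℝ, 0 ≤ c ∧ ∀ (F : smoothOff m W) (ε : ℝ), 0 ≤ ε →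
    (∀ x, ‖x‖ = 1 → ‖F.1 x‖ ≤ ε) → ‖sphereToLp m W F‖ ≤ c * ε := by
  refine ⟨_, by positivity, fun F ε hε h => Lp.norm_le_of_ae_bound hε ?_⟩
  filter_upwards [coeFn_sphereToLp F, ae_norm_eq_one] with x hF hx
  rw [hF]
  exact h x hx

theorem ae_eq_zero_of_sphereToLp_eq {F G : smoothOff m W}
    (h : sphereToLp m W F = sphereToLp m W G) : ∀ᵐ x ∂sphereMeasure m, F.1 x = G.1 x := by
  filter_upwards [coeFn_sphereToLp F, coeFn_sphereToLp G] with x hF hG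
  rw [← hF, ← hG, h]

end ToLp

section

variable {m : ℕ} {W : Type*} [NormedAddCommGroup W] [InnerProductSpace ℝ W]

/-- The polynomials of degree at most `k`, among the functions smooth away from the origin. -/
noncomputable def smoothPolyLE (m : ℕ) (W : Type*) [NormedAddCommGroup W] [InnerProductSpace ℝ W] (k : ℕ) :
    Submodule ℝ (smoothOff m W) :=
  (polyLE m W k).comap (smoothOff m W).subtype

theorem smoothPolyLE_mono : Monotone (smoothPolyLE m W) :=
  fun _ _ h => Submodule.comap_mono (polyLE_mono h)

theorem finiteDimensional_smoothPolyLE [FiniteDimensional ℝ W] (k : ℕ) :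
    FiniteDimensional ℝ (smoothPolyLE m W k) :=
  have := finiteDimensional_polyLE (m := m) (W := W) k
  FiniteDimensional.of_injective
    (((smoothOff m W).subtype ∘ₗ (smoothPolyLE m W k).subtype).codRestrict (polyLE m W k)
      fun F => F.2)
    fun _ _ h => Subtype.ext (Subtype.ext (congrArg (fun z => z.1) h))

end

namespace CliffordModel

section

variable {m : ℕ} {W : Type*} [NormedAddCommGroup W] [InnerProductSpace ℝ W] (K : CliffordModel m W)

/-- The spherical Dirac operator as a linear map. -/
noncomputable def gamLM : smoothOff m W →ₗ[ℝ] smoothOff m W where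
  toFun F := ⟨K.gam F, K.gam_mem F.2⟩
  map_add' F G := Subtype.ext (K.gam_add F.2 G.2)
  map_smul' c F := Subtype.ext (K.gam_smul c F.2)

/-- The Laplacian. -/
noncomputable def lap : smoothOff m W →ₗ[ℝ] smoothOff m W :=
  K.gamLM ∘ₗ K.gamLM - ((m : ℝ) - 2) • K.gamLM

theorem lap_apply (F : smoothOff m W) :
    K.lap F = K.gamLM (K.gamLM F) - ((m : ℝ) - 2) • K.gamLM F := rfl

/-- The operator of multiplication by `N`. -/
noncomputable def NLM : smoothOff m W →ₗ[ℝ] smoothOff m W where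
  toFun F := ⟨fun x => K.N (F.1 x), clm_comp_mem_smoothOff _ F.2⟩
  map_add' _ _ := Subtype.ext (funext fun _ => map_add _ _ _)
  map_smul' _ _ := Subtype.ext (funext fun _ => map_smul _ _ _)

variable [NeZero m]

theorem inner_gamLM (F G : smoothOff m W) :
    ⟪sphereToLp m W (K.gamLM F), sphereToLp m W G⟫_ℝ =
      ⟪sphereToLp m W F, sphereToLp m W (K.gamLM G)⟫_ℝ := by
  rw [inner_sphereToLp, inner_sphereToLp]
  exact K.integral_inner_gam F.2 G.2

theorem inner_lap (F G : smoothOff m W) :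
    ⟪sphereToLp m W (K.lap F), sphereToLp m W G⟫_ℝ =
      ⟪sphereToLp m W F, sphereToLp m W (K.lap G)⟫_ℝ := by
  simp only [lap_apply, map_sub, map_smul, inner_sub_left, inner_sub_right, real_inner_smul_left,
    real_inner_smul_right, inner_gamLM]

theorem lap_of_mem_zero {F : smoothOff m W} (hF : F ∈ smoothPolyLE m W 0) :
    sphereToLp m W (K.lap F) = 0 := by
  obtain ⟨F, hF'⟩ := F
  obtain ⟨w, rfl⟩ := mem_homPoly_zero hF
  have : K.gamLM ⟨_, hF'⟩ = 0 := Subtype.ext (K.gam_const w)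
  rw [lap_apply, this]
  simp

theorem exists_lap_eq (k : ℕ) {F : smoothOff m W} (hF : F ∈ smoothPolyLE m W (k + 1)) :
    ∃ R ∈ smoothPolyLE m W k, sphereToLp m W (K.lap F) =
      (((k : ℝ) + 1) * ((k : ℝ) + m - 1)) • sphereToLp m W F + sphereToLp m W R := by
  obtain ⟨R, hR, h⟩ := K.exists_gam_gam_eq hF
  refine ⟨⟨R, mem_smoothOff_of_mem_polyLE hR⟩, hR, ?_⟩
  rw [← map_smul, ← map_add]
  exact sphereToLp_congr h

theorem monotone_eigenvalue : Monotone fun k : ℕ => ((k : ℝ) + 1) * ((k : ℝ) + m - 1) := by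
  intro k l h
  have h1 : (k : ℝ) ≤ l := Nat.cast_le.2 h
  have h2 : (1 : ℝ) ≤ m := Nat.one_le_cast.2 NeZero.one_le
  have h3 : (0 : ℝ) ≤ k := Nat.cast_nonneg k
  exact mul_le_mul (by linarith) (by linarith) (by linarith) (by linarith)

theorem le_inner_lap [FiniteDimensional ℝ W] {l d : ℕ} {F : smoothOff m W}
    (hF : F ∈ smoothPolyLE m W l)
    (h : ∀ G ∈ smoothPolyLE m W d, ⟪sphereToLp m W F, sphereToLp m W G⟫_ℝ = 0) :
    (((d : ℝ) + 1) * ((d : ℝ) + m - 1)) * ‖sphereToLp m W F‖ ^ 2 ≤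
      ⟪sphereToLp m W (K.lap F), sphereToLp m W F⟫_ℝ :=
  le_inner_of_triangular (sphereToLp m W) K.lap K.inner_lap (smoothPolyLE m W) smoothPolyLE_mono
    finiteDimensional_smoothPolyLE _ monotone_eigenvalue (fun _ => K.lap_of_mem_zero)
    (fun k _ => K.exists_lap_eq k) hF h

theorem exists_eq_const [FiniteDimensional ℝ W] (hm : 2 ≤ m) {l : ℕ} {F : smoothOff m W}
    (hF : F ∈ smoothPolyLE m W l)
    (h : ⟪sphereToLp m W (K.lap F), sphereToLp m W F⟫_ℝ ≤ 0) :
    ∃ w, ∀ᵐ x ∂sphereMeasure m, F.1 x = w := by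
  have hm' : (2 : ℝ) ≤ m := Nat.ofNat_le_cast.2 hm
  obtain ⟨p, hp, h1⟩ := exists_eq_of_inner_nonpos (sphereToLp m W) K.lap K.inner_lap
    (smoothPolyLE m W) smoothPolyLE_mono finiteDimensional_smoothPolyLE _ monotone_eigenvalue
    (by simp; linarith) (fun _ => K.lap_of_mem_zero) (fun k _ => K.exists_lap_eq k) hF h
  obtain ⟨w, hw⟩ := mem_homPoly_zero hp
  refine ⟨w, (ae_eq_zero_of_sphereToLp_eq h1).mono fun x hx => ?_⟩
  rw [hx]
  exact congrFun hw x

theorem growth_gam [FiniteDimensional ℝ W] (hm : 2 ≤ m) {l d : ℕ} {F : smoothOff m W}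
    (hF : F ∈ smoothPolyLE m W l)
    (h : ∀ G ∈ smoothPolyLE m W d, ⟪sphereToLp m W F, sphereToLp m W G⟫_ℝ = 0) :
    ((d : ℝ) + 1 - m) * ‖sphereToLp m W F‖ ≤ ‖sphereToLp m W (K.gamLM F)‖ := by
  have h1 := K.le_inner_lap hF h
  have h2 : (2 : ℝ) ≤ m := Nat.ofNat_le_cast.2 hm
  rw [lap_apply, map_sub, map_smul, inner_sub_left, real_inner_smul_left, inner_gamLM,
    real_inner_self_eq_norm_sq] at h1
  have h3 := abs_real_inner_le_norm (sphereToLp m W (K.gamLM F)) (sphereToLp m W F)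
  have hd : (0 : ℝ) ≤ d := Nat.cast_nonneg d
  generalize hA : ‖sphereToLp m W (K.gamLM F)‖ = a at *
  generalize hB : ‖sphereToLp m W F‖ = b at *
  generalize ⟪sphereToLp m W (K.gamLM F), sphereToLp m W F⟫_ℝ = t at *
  have ha : 0 ≤ a := hA ▸ norm_nonneg _
  have hb : 0 ≤ b := hB ▸ norm_nonneg _
  have hab : 0 ≤ a * b := by positivity
  have h4 : -((m : ℝ) - 2) * t ≤ m * (a * b) := by
    nlinarith [mul_nonneg (by linarith : (0 : ℝ) ≤ m - 2) (by linarith [(abs_le.1 h3).1] : 0 ≤ a * b + t)]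
  have h5 : ((d + 1) * b) ^ 2 ≤ (a + m * b) ^ 2 := by
    have e1 : 0 ≤ m * (a * b) := by positivity
    have e2 : 0 ≤ (((d : ℝ) + 1) * (m - 2)) * b ^ 2 :=
      mul_nonneg (mul_nonneg (by linarith) (by linarith)) (sq_nonneg b)
    have e3 : 0 ≤ (m * b) ^ 2 := sq_nonneg _
    linarith
  have h6 := abs_le_of_sq_le_sq' h5 (by positivity)
  linarith [h6.2]

end

end CliffordModel

namespace CliffordModel

section

variable {m : ℕ} {W : Type*} [NormedAddCommGroup W] [InnerProductSpace ℝ W] (K : CliffordModel m W)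

/-- The smooth functions that on the sphere take values in the fibres. -/
def sec : Submodule ℝ (smoothOff m W) where
  carrier := {F | ∀ x, ‖x‖ = 1 → F.1 x ∈ K.Fib x}
  zero_mem' := fun x _ => (K.Fib x).zero_mem
  add_mem' hF hG := fun x hx => (K.Fib x).add_mem (hF x hx) (hG x hx)
  smul_mem' c _ hF := fun x hx => (K.Fib x).smul_mem c (hF x hx)

/-- The skew version of the Dirac operator on the sections. -/
noncomputable def skewDirac : K.sec →ₗ[ℝ] K.sec where
  toFun F := ⟨⟨fun x => K.ω (K.gam F.1.1 x - K.N (F.1.1 x)),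
    clm_comp_mem_smoothOff K.ω (Submodule.sub_mem _ (K.gam_mem F.1.2)
      (clm_comp_mem_smoothOff K.N F.1.2))⟩, fun _ hx => K.ω_gam_sub_mem_Fib F.1.2 F.2 hx⟩
  map_add' F G := by
    refine Subtype.ext (Subtype.ext (funext fun x => ?_))
    simp [K.gam_add F.1.2 G.1.2]
    abel
  map_smul' c F := by
    refine Subtype.ext (Subtype.ext (funext fun x => ?_))
    simp [K.gam_smul c F.1.2, smul_sub]

theorem skewDirac_apply (F : K.sec) (x : EuclideanSpace ℝ (Fin m)) :
    (K.skewDirac F).1.1 x = K.ω (K.gam F.1.1 x - K.N (F.1.1 x)) := rfl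

/-- The field of endomorphisms given by a pair of vector fields. -/
noncomputable def crcr (a b : EuclideanSpace ℝ (Fin m) → EuclideanSpace ℝ (Fin m))
    (x : EuclideanSpace ℝ (Fin m)) : W →L[ℝ] W := K.cr (a x) ∘L K.cr (b x)

variable {a b : EuclideanSpace ℝ (Fin m) → EuclideanSpace ℝ (Fin m)}

theorem contDiffOn_crcr (ha : ContDiffOn ℝ ∞ a {0}ᶜ) (hb : ContDiffOn ℝ ∞ b {0}ᶜ) :
    ContDiffOn ℝ ∞ (K.crcr a b) {0}ᶜ :=
  (K.cr.contDiff.comp_contDiffOn ha).clm_comp (K.cr.contDiff.comp_contDiffOn hb)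

/-- The action of a pair of vector fields on the sections. -/
noncomputable def frameOp (ha : ContDiffOn ℝ ∞ a {0}ᶜ) (hb : ContDiffOn ℝ ∞ b {0}ᶜ)
    (hxa : ∀ x, ‖x‖ = 1 → ⟪x, a x⟫_ℝ = 0) (hxb : ∀ x, ‖x‖ = 1 → ⟪x, b x⟫_ℝ = 0) :
    K.sec →ₗ[ℝ] K.sec where
  toFun F := ⟨⟨fun x => K.crcr a b x (F.1.1 x),
    clm_apply_mem_smoothOff (K.contDiffOn_crcr ha hb) F.1.2⟩,
    fun x hx => K.cr_cr_mem_Fib (hxa x hx) (hxb x hx) (F.2 x hx)⟩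
  map_add' _ _ := Subtype.ext (Subtype.ext (funext fun _ => map_add _ _ _))
  map_smul' _ _ := Subtype.ext (Subtype.ext (funext fun _ => map_smul _ _ _))

theorem exists_norm_gamma_le : ∃ c, 0 ≤ c ∧ ∀ (x : EuclideanSpace ℝ (Fin m))
    (g : EuclideanSpace ℝ (Fin m) →L[ℝ] W), ‖x‖ = 1 → ‖K.gamma x g‖ ≤ c * ‖g‖ := by
  refine ⟨‖K.cl‖ * ∑ j, ‖K.L j‖ + 1, by positivity, fun x g hx => ?_⟩
  have h1 : ‖K.tr g‖ ≤ (∑ j, ‖K.L j‖) * ‖g‖ := by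
    rw [Finset.sum_mul]
    refine (norm_sum_le _ _).trans (Finset.sum_le_sum fun j _ => ?_)
    refine ((K.L j).le_opNorm _).trans (mul_le_mul_of_nonneg_left ?_ (norm_nonneg _))
    simpa using g.le_opNorm (EuclideanSpace.single j 1)
  have h2 : ‖K.cl x (K.tr g)‖ ≤ ‖K.cl‖ * ((∑ j, ‖K.L j‖) * ‖g‖) := by
    refine (K.cl.le_opNorm₂ x _).trans ?_
    rw [hx, mul_one]
    gcongr
  have h3 : ‖g x‖ ≤ ‖g‖ := by simpa [hx] using g.le_opNorm x
  rw [gamma, norm_neg]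
  calc _ ≤ _ := norm_add_le _ _
    _ ≤ _ := add_le_add h2 h3
    _ = _ := by ring

/-- The commutator of the Dirac operator with the action of a pair of vector fields is bounded. -/
theorem exists_commutator_bound
    (ha : ContDiffOn ℝ ∞ a {0}ᶜ) (hb : ContDiffOn ℝ ∞ b {0}ᶜ) :
    ∃ c, 0 ≤ c ∧ ∀ F ∈ smoothOff m W, ∀ x, ‖x‖ = 1 →
      ‖K.ω (K.gam (fun y => K.crcr a b y (F y)) x - K.N (K.crcr a b x (F x))) -
        K.crcr a b x (K.ω (K.gam F x - K.N (F x)))‖ ≤ c * ‖F x‖ := by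
  have hM := K.contDiffOn_crcr ha hb
  obtain ⟨c₁, hc₁, h₁⟩ := K.exists_norm_gamma_le
  obtain ⟨c₂, hc₂, h₂⟩ := exists_bound_on_sphere hM.continuousOn
  obtain ⟨c₃, hc₃, h₃⟩ := exists_bound_on_sphere
    (hM.continuousOn_fderiv_of_isOpen isOpen_compl_singleton (by simp))
  refine ⟨c₁ * c₃ + 2 * (‖K.N‖ * c₂), by positivity, fun F hF x hx => ?_⟩
  have hx0 := ne_zero_of_norm_eq_one hx
  have hdM : DifferentiableAt ℝ (K.crcr a b) x :=
    (hM.differentiableOn (by simp)).differentiableAt (isOpen_compl_singleton.mem_nhds hx0)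
  have hdF := differentiableAt_of_mem_smoothOff hF hx0
  have hcl : ∀ i f, K.crcr a b x (K.L i f) = K.L i (K.crcr a b x f) := fun i f => by
    have h : ∀ y f, K.cr y (K.L i f) = -K.L i (K.cr y f) := fun y f => by
      rw [← cl_single, ← cl_single, cl_cr, neg_neg]
    simp [crcr, h]
  have hω : ∀ f, K.crcr a b x (K.ω f) = K.ω (K.crcr a b x f) := fun f => by
    simp [crcr, ω_cr]
  have h4 : K.gam (fun y => K.crcr a b y (F y)) x = K.crcr a b x (K.gam F x) +
      K.gamma x ((fderiv ℝ (K.crcr a b) x).flip (F x)) := by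
    rw [gam, (hdM.hasFDerivAt.clm_apply hdF.hasFDerivAt).fderiv, gamma_add,
      K.gamma_comp_of_comm hcl, gam]
  have h5 : K.ω (K.gam (fun y => K.crcr a b y (F y)) x - K.N (K.crcr a b x (F x))) -
        K.crcr a b x (K.ω (K.gam F x - K.N (F x))) =
      K.ω (K.gamma x ((fderiv ℝ (K.crcr a b) x).flip (F x)) -
        (K.N (K.crcr a b x (F x)) - K.crcr a b x (K.N (F x)))) := by
    simp only [hω, h4, map_sub, map_add]
    abel
  rw [h5, norm_ω]
  have e1 : ‖K.gamma x ((fderiv ℝ (K.crcr a b) x).flip (F x))‖ ≤ c₁ * c₃ * ‖F x‖ := by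
    refine (h₁ x _ hx).trans ?_
    rw [mul_assoc]
    refine mul_le_mul_of_nonneg_left ?_ hc₁
    refine (ContinuousLinearMap.le_opNorm _ _).trans ?_
    rw [ContinuousLinearMap.opNorm_flip]
    exact mul_le_mul_of_nonneg_right (h₃ x hx) (norm_nonneg _)
  have e0 : ∀ f, ‖K.crcr a b x f‖ ≤ c₂ * ‖f‖ := fun f =>
    (ContinuousLinearMap.le_opNorm _ _).trans
      (mul_le_mul_of_nonneg_right (h₂ x hx) (norm_nonneg _))
  have e2 : ‖K.N (K.crcr a b x (F x))‖ ≤ ‖K.N‖ * c₂ * ‖F x‖ := by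
    rw [mul_assoc]
    exact (K.N.le_opNorm _).trans (mul_le_mul_of_nonneg_left (e0 _) (norm_nonneg _))
  have e3 : ‖K.crcr a b x (K.N (F x))‖ ≤ ‖K.N‖ * c₂ * ‖F x‖ := by
    rw [mul_comm ‖K.N‖, mul_assoc]
    exact (e0 _).trans (mul_le_mul_of_nonneg_left (K.N.le_opNorm _) hc₂)
  calc _ ≤ _ := norm_sub_le _ _
    _ ≤ _ := add_le_add e1 ((norm_sub_le _ _).trans (add_le_add e2 e3))
    _ = _ := by ring

/-- The constant section. -/
noncomputable def vacSec : K.sec :=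
  ⟨⟨fun _ => K.vac, contDiffOn_const⟩, fun x _ => by
    rw [mem_Fib]
    exact ⟨K.ε_vac, by simp [cr_apply, cl_apply, K.ρ_vac]⟩⟩

theorem skewDirac_vacSec : K.skewDirac K.vacSec = 0 := by
  refine Subtype.ext (Subtype.ext (funext fun x => ?_))
  rw [skewDirac_apply]
  simp [vacSec, K.gam_const, K.N_vac]

variable [NeZero m]

/-- The embedding of the sections in `L²`. -/
noncomputable def secToLp : K.sec →ₗ[ℝ] Lp W 2 (sphereMeasure m) :=
  sphereToLp m W ∘ₗ K.sec.subtype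

theorem secToLp_vacSec_ne_zero : K.secToLp K.vacSec ≠ 0 := by
  intro h
  have h1 := ae_eq_zero_of_sphereToLp_eq (F := K.vacSec.1) (G := 0) (h.trans (map_zero _).symm)
  have h2 : ∀ᵐ x ∂sphereMeasure m, False := h1.mono fun x hx => K.vac_ne_zero hx
  rw [eventually_false_iff_eq_bot, ae_eq_bot] at h2
  exact sphereMeasure_ne_zero h2

theorem inner_skewDirac (F G : K.sec) : ⟪K.secToLp (K.skewDirac F), K.secToLp G⟫_ℝ =
    -⟪K.secToLp F, K.secToLp (K.skewDirac G)⟫_ℝ := by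
  let ωG : smoothOff m W := ⟨fun x => K.ω (G.1.1 x), clm_comp_mem_smoothOff K.ω G.1.2⟩
  have h1 : ⟪K.secToLp (K.skewDirac F), K.secToLp G⟫_ℝ =
      ⟪sphereToLp m W (-K.gamLM F.1), sphereToLp m W ωG⟫_ℝ := by
    refine inner_sphereToLp_congr fun x hx => ?_
    change ⟪K.ω (K.gam F.1.1 x - K.N (F.1.1 x)), G.1.1 x⟫_ℝ = ⟪-K.gam F.1.1 x, K.ω (G.1.1 x)⟫_ℝ
    rw [map_sub, inner_sub_left, K.inner_ω_N_eq_zero hx (F.2 x hx) (G.2 x hx), sub_zero, K.inner_ω,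
      inner_neg_left]
  have h2 : ⟪K.secToLp F, K.secToLp (K.skewDirac G)⟫_ℝ =
      ⟪sphereToLp m W F.1, sphereToLp m W (K.gamLM ωG)⟫_ℝ := by
    refine inner_sphereToLp_congr fun x hx => ?_
    change ⟪F.1.1 x, K.ω (K.gam G.1.1 x - K.N (G.1.1 x))⟫_ℝ =
      ⟪F.1.1 x, K.gam (fun y => K.ω (G.1.1 y)) x⟫_ℝ
    rw [map_sub, inner_sub_right, real_inner_comm _ (F.1.1 x),
      real_inner_comm _ (F.1.1 x), K.inner_ω_N_eq_zero hx (G.2 x hx) (F.2 x hx), sub_zero,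
      K.gam_comp_of_anticomm K.ω_L
        (differentiableAt_of_mem_smoothOff G.1.2 (ne_zero_of_norm_eq_one hx)), real_inner_comm]
  rw [h1, h2, map_neg, inner_neg_left, inner_gamLM]

end

end CliffordModel

namespace CliffordModel

section

variable {m : ℕ} {W : Type*} [NormedAddCommGroup W] [InnerProductSpace ℝ W] (K : CliffordModel m W)

/-- The polynomial sections of degree at most `k`. -/
noncomputable def polySec (k : ℕ) : Submodule ℝ K.sec := (smoothPolyLE m W k).comap K.sec.subtype

theorem polySec_mono : Monotone K.polySec := fun _ _ h => Submodule.comap_mono (smoothPolyLE_mono h)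

set_option maxSynthPendingDepth 6 in
theorem finiteDimensional_polySec [FiniteDimensional ℝ W] (k : ℕ) :
    FiniteDimensional ℝ (K.polySec k) :=
  have := finiteDimensional_smoothPolyLE (m := m) (W := W) k
  FiniteDimensional.of_injective
    ((K.sec.subtype ∘ₗ (K.polySec k).subtype).codRestrict (smoothPolyLE m W k) fun F => F.2)
    fun _ _ h => Subtype.ext (Subtype.ext (congrArg (fun z => z.1) h))

theorem skewDirac_mem_polySec {k : ℕ} {F : K.sec} (hF : F ∈ K.polySec k) :
    K.skewDirac F ∈ K.polySec k :=
  comp_mem_polyLE K.ω.toLinearMap (Submodule.sub_mem _ (K.gam_mem_polyLE hF)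
    (comp_mem_polyLE K.N.toLinearMap hF))

/-- The projection of a polynomial to the sections. -/
noncomputable def projSec {k : ℕ} {p : EuclideanSpace ℝ (Fin m) → W} (hp : p ∈ polyLE m W k) :
    K.sec :=
  ⟨⟨fun x => K.proj x (p x), mem_smoothOff_of_mem_polyLE (K.proj_mem_polyLE hp)⟩,
    fun _ hx => K.proj_mem_Fib hx _⟩

theorem projSec_mem {k : ℕ} {p : EuclideanSpace ℝ (Fin m) → W} (hp : p ∈ polyLE m W k) :
    K.projSec hp ∈ K.polySec (k + 2) := K.proj_mem_polyLE hp

variable [NeZero m]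

theorem exists_polySec_near [FiniteDimensional ℝ W] (F : K.sec) {ε : ℝ} (hε : 0 < ε) :
    ∃ k, ∃ G ∈ K.polySec k, ‖K.secToLp F - K.secToLp G‖ < ε := by
  obtain ⟨c, hc, h⟩ := exists_norm_sphereToLp_le (m := m) (W := W)
  have hpc : ContinuousOn (fun x => K.proj x) ({0}ᶜ : Set (EuclideanSpace ℝ (Fin m))) := by
    refine Continuous.continuousOn ?_
    unfold proj
    exact continuous_const.sub (K.cl.continuous.clm_comp (K.cr.continuous.clm_comp
      continuous_const))
  obtain ⟨c', hc', h'⟩ := exists_bound_on_sphere hpc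
  obtain ⟨k, p, hp, hFp⟩ := exists_polyLE_near
    ((continuousOn_of_mem_smoothOff F.1.2).mono fun x hx => ne_zero_of_norm_eq_one hx)
    (ε := ε / (c * c' + 1)) (by positivity)
  refine ⟨k + 2, (1 / 4 : ℝ) • K.projSec hp, Submodule.smul_mem _ _ (K.projSec_mem hp), ?_⟩
  rw [← map_sub]
  have h1 : ‖K.secToLp (F - (1 / 4 : ℝ) • K.projSec hp)‖ ≤ c * (c' * (ε / (c * c' + 1))) := by
    refine h _ _ (by positivity) fun x hx => ?_
    have e1 : (F - (1 / 4 : ℝ) • K.projSec hp).1.1 x = (1 / 4 : ℝ) • K.proj x (F.1.1 x - p x) := by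
      change F.1.1 x - (1 / 4 : ℝ) • K.proj x (p x) = _
      rw [map_sub, K.proj_of_mem_Fib hx (F.2 x hx)]
      module
    change ‖(F - (1 / 4 : ℝ) • K.projSec hp).1.1 x‖ ≤ _
    rw [e1, norm_smul]
    have e2 : ‖K.proj x (F.1.1 x - p x)‖ ≤ c' * (ε / (c * c' + 1)) :=
      (ContinuousLinearMap.le_opNorm _ _).trans
        (mul_le_mul (h' x hx) (hFp x hx).le (norm_nonneg _) hc')
    have e3 : ‖(1 / 4 : ℝ)‖ ≤ 1 := by norm_num
    exact (mul_le_of_le_one_left (norm_nonneg _) e3).trans e2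
  refine h1.trans_lt ?_
  rw [← mul_assoc, mul_div_assoc', div_lt_iff₀ (by positivity)]
  nlinarith

theorem exists_growth [FiniteDimensional ℝ W] (hm : 2 ≤ m) (M : ℝ) : ∃ k, ∀ l, ∀ F ∈ K.polySec l,
    (∀ G ∈ K.polySec k, ⟪K.secToLp F, K.secToLp G⟫_ℝ = 0) →
      M * ‖K.secToLp F‖ ≤ ‖K.secToLp (K.skewDirac F)‖ := by
  obtain ⟨d, hd⟩ := exists_nat_ge (M + ‖K.N‖ + m)
  refine ⟨d + 2, fun l F hF h => ?_⟩
  have h1 : ∀ G ∈ smoothPolyLE m W d, ⟪sphereToLp m W F.1, sphereToLp m W G⟫_ℝ = 0 := by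
    intro G hG
    have e1 := h _ (K.projSec_mem hG)
    have e2 : ⟪K.secToLp F, K.secToLp (K.projSec hG)⟫_ℝ =
        ⟪sphereToLp m W ((4 : ℝ) • F.1), sphereToLp m W G⟫_ℝ := by
      refine inner_sphereToLp_congr fun x hx => ?_
      change ⟪F.1.1 x, K.proj x (G.1 x)⟫_ℝ = ⟪(4 : ℝ) • F.1.1 x, G.1 x⟫_ℝ
      rw [← K.inner_proj, K.proj_of_mem_Fib hx (F.2 x hx)]
    rw [e2, map_smul, real_inner_smul_left] at e1
    linarith
  have h2 := K.growth_gam hm hF h1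
  have h3 : ‖sphereToLp m W (K.gamLM F.1)‖ ≤ ‖K.secToLp (K.skewDirac F)‖ +
      ‖K.N‖ * ‖K.secToLp F‖ := by
    have e1 : ‖sphereToLp m W (K.gamLM F.1 - K.NLM F.1)‖ ≤ 1 * ‖K.secToLp (K.skewDirac F)‖ := by
      refine norm_sphereToLp_le_mul fun x _ => ?_
      change ‖K.gam F.1.1 x - K.N (F.1.1 x)‖ ≤ 1 * ‖K.ω (K.gam F.1.1 x - K.N (F.1.1 x))‖
      rw [norm_ω, one_mul]
    have e2 : ‖sphereToLp m W (K.NLM F.1)‖ ≤ ‖K.N‖ * ‖K.secToLp F‖ :=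
      norm_sphereToLp_le_mul fun x _ => K.N.le_opNorm _
    rw [map_sub, one_mul] at e1
    have e3 := norm_sub_norm_le (sphereToLp m W (K.gamLM F.1)) (sphereToLp m W (K.NLM F.1))
    linarith
  change ((d : ℝ) + 1 - m) * ‖K.secToLp F‖ ≤ ‖sphereToLp m W (K.gamLM F.1)‖ at h2
  have h4 : (M + ‖K.N‖) * ‖K.secToLp F‖ ≤ ((d : ℝ) + 1 - m) * ‖K.secToLp F‖ :=
    mul_le_mul_of_nonneg_right (by linarith) (norm_nonneg _)
  linarith [h2.trans h3, add_mul M ‖K.N‖ ‖K.secToLp F‖]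

theorem exists_smul_of_skewDirac_eq_zero [FiniteDimensional ℝ W] (hm : 2 ≤ m) {k : ℕ} {F : K.sec}
    (hF : F ∈ K.polySec k) (h : K.secToLp (K.skewDirac F) = 0) :
    ∃ r : ℝ, K.secToLp F = r • K.secToLp K.vacSec := by
  have h1 : sphereToLp m W (K.gamLM F.1) = sphereToLp m W (K.NLM F.1) := by
    rw [← sub_eq_zero, ← map_sub, ← norm_le_zero_iff]
    have e1 : ‖sphereToLp m W (K.gamLM F.1 - K.NLM F.1)‖ ≤ 1 * ‖K.secToLp (K.skewDirac F)‖ := by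
      refine norm_sphereToLp_le_mul fun x _ => ?_
      change ‖K.gam F.1.1 x - K.N (F.1.1 x)‖ ≤ 1 * ‖K.ω (K.gam F.1.1 x - K.N (F.1.1 x))‖
      rw [norm_ω, one_mul]
    simpa [h] using e1
  have h2 : ⟪sphereToLp m W (K.lap F.1), sphereToLp m W F.1⟫_ℝ ≤ 0 := by
    rw [lap_apply, map_sub, map_smul, inner_sub_left, real_inner_smul_left, inner_gamLM, h1,
      inner_sphereToLp, inner_sphereToLp, ← integral_const_mul, ← integral_sub (integrable_inner _ _)
      ((integrable_inner _ _).const_mul _)]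
    refine integral_nonpos_of_ae ?_
    filter_upwards [ae_norm_eq_one] with x hx
    have hx0 := ne_zero_of_norm_eq_one hx
    have hf := K.mem_Fib.1 (F.2 x hx)
    refine K.inner_N x (F.1.1 x) (fun h0 => hx0 (by ext i; exact congrFun h0 i)) hf.1 ?_
    rw [← cl_apply, ← cr_apply]
    exact hf.2
  obtain ⟨w, hw⟩ : ∃ w, ∀ᵐ x ∂sphereMeasure m, F.1.1 x = w := K.exists_eq_const hm hF h2
  have h3 : LinearMap.ker ((K.cr - K.cl).flip w).toLinearMap = ⊤ := by
    refine eq_top_of_ae_mem_sphere ?_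
    filter_upwards [hw, ae_norm_eq_one] with x hx hx1
    have := (K.mem_Fib.1 (F.2 x hx1)).2
    rw [hx] at this
    simp [this]
  obtain ⟨r, hr⟩ := K.eq_smul_vac w fun i => by
    have : EuclideanSpace.single i (1 : ℝ) ∈ LinearMap.ker ((K.cr - K.cl).flip w).toLinearMap :=
      h3 ▸ Submodule.mem_top
    rw [← cl_single, ← cr_single]
    simpa [sub_eq_zero] using this
  refine ⟨r, ?_⟩
  rw [← map_smul]
  refine Lp.ext ?_
  filter_upwards [coeFn_sphereToLp F.1, coeFn_sphereToLp (r • K.vacSec).1, hw] with x h5 h6 h7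
  change (sphereToLp m W F.1) x = (sphereToLp m W (r • K.vacSec).1) x
  rw [h5, h6, h7, hr]
  rfl

/-- There is no smooth field of orthonormal tangent 2-frames on the sphere. -/
theorem false_of_frame [FiniteDimensional ℝ W] (K : CliffordModel m W) (hm : 2 ≤ m)
    {a b : EuclideanSpace ℝ (Fin m) → EuclideanSpace ℝ (Fin m)}
    (ha : ContDiffOn ℝ ∞ a {0}ᶜ) (hb : ContDiffOn ℝ ∞ b {0}ᶜ)
    (hxa : ∀ x, ‖x‖ = 1 → ⟪x, a x⟫_ℝ = 0) (hxb : ∀ x, ‖x‖ = 1 → ⟪x, b x⟫_ℝ = 0)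
    (hab : ∀ x, ‖x‖ = 1 → ⟪a x, b x⟫_ℝ = 0) (haa : ∀ x, ‖x‖ = 1 → ‖a x‖ = 1)
    (hbb : ∀ x, ‖x‖ = 1 → ‖b x‖ = 1) : False := by
  obtain ⟨c, hc, hcom⟩ := K.exists_commutator_bound ha hb
  refine false_of_skew_of_kernel_line_of_completeSpace K.secToLp K.skewDirac
    (K.frameOp ha hb hxa hxb) K.inner_skewDirac (fun F G => ?_) (fun F => ?_) hc (fun F => ?_)
    K.polySec K.polySec_mono K.finiteDimensional_polySec (fun _ _ => K.skewDirac_mem_polySec)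
    (fun F _ => K.exists_polySec_near F) (K.exists_growth hm) K.vacSec ?_
    K.secToLp_vacSec_ne_zero ?_ fun _ _ => K.exists_smul_of_skewDirac_eq_zero hm
  · rw [← inner_neg_right, ← map_neg]
    refine inner_sphereToLp_congr fun x hx => ?_
    change ⟪K.cr (a x) (K.cr (b x) (F.1.1 x)), G.1.1 x⟫_ℝ =
      ⟪F.1.1 x, -K.cr (a x) (K.cr (b x) (G.1.1 x))⟫_ℝ
    rw [K.inner_cr_cr (hab x hx), inner_neg_right]
  · rw [← map_neg]
    exact sphereToLp_congr fun x hx => K.cr_cr_cr_cr (haa x hx) (hbb x hx) (hab x hx) _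
  · rw [← map_sub]
    exact norm_sphereToLp_le_mul fun x hx => hcom F.1.1 F.1.2 x hx
  · exact const_mem_homPoly _
  · rw [skewDirac_vacSec, map_zero]

end

end CliffordModel

section

theorem linearIndependent_triple_iff {V : Type*} [AddCommGroup V] [Module ℝ V] {x y z : V} :
    LinearIndependent ℝ ![x, y, z] ↔
      ∀ α β γ : ℝ, α • x + β • y + γ • z = 0 → α = 0 ∧ β = 0 ∧ γ = 0 := by
  rw [Fintype.linearIndependent_iff]
  constructor
  · intro h α β γ h0
    have := h ![α, β, γ] (by simpa [Fin.sum_univ_three] using h0)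
    exact ⟨this 0, this 1, this 2⟩
  · intro h g hg i
    have := h (g 0) (g 1) (g 2) (by simpa [Fin.sum_univ_three] using hg)
    fin_cases i
    exacts [this.1, this.2.1, this.2.2]

theorem linearIndependent_triple_map {V V' : Type*} [AddCommGroup V] [Module ℝ V]
    [AddCommGroup V'] [Module ℝ V'] {x y z : V} (h : LinearIndependent ℝ ![x, y, z])
    (φ : V ≃ₗ[ℝ] V') : LinearIndependent ℝ ![φ x, φ y, φ z] := by
  rw [linearIndependent_triple_iff] at h ⊢
  intro α β γ h0
  refine h α β γ (φ.injective ?_)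
  simpa using h0

/-- Polynomial approximations of continuous linearly independent fields. -/
theorem exists_contDiff_linearIndependent {m : ℕ}
    {v w : EuclideanSpace ℝ (Fin m) → EuclideanSpace ℝ (Fin m)}
    (hv : ContinuousOn v {x | ‖x‖ = 1}) (hw : ContinuousOn w {x | ‖x‖ = 1})
    (h : ∀ x, ‖x‖ = 1 → LinearIndependent ℝ ![x, v x, w x]) :
    ∃ p q : EuclideanSpace ℝ (Fin m) → EuclideanSpace ℝ (Fin m), ContDiff ℝ ∞ p ∧ ContDiff ℝ ∞ q ∧
      ∀ x, ‖x‖ = 1 → LinearIndependent ℝ ![x, p x, q x] := by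
  have hcont : ContinuousOn (fun x => ![x, v x, w x]) {x | ‖x‖ = 1} := by
    refine continuousOn_pi.2 fun i => ?_
    fin_cases i
    exacts [continuousOn_id, hv, hw]
  obtain ⟨ε, hε, hsub⟩ := (isCompact_unitSphere.image_of_continuousOn hcont).exists_thickening_subset_open
    (isOpen_setOfPred_linearIndependent (𝕜 := ℝ) (E := EuclideanSpace ℝ (Fin m)) (ι := Fin 3))
    (by rintro _ ⟨x, hx, rfl⟩; exact h x hx)
  obtain ⟨k, p, hp, hvp⟩ := exists_polyLE_near hv hε
  obtain ⟨l, q, hq, hwq⟩ := exists_polyLE_near hw hε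
  refine ⟨p, q, contDiff_of_mem_polyLE hp, contDiff_of_mem_polyLE hq, fun x hx => hsub ?_⟩
  refine Metric.mem_thickening_iff.2 ⟨_, mem_image_of_mem _ hx, ?_⟩
  rw [dist_comm, dist_pi_lt_iff hε]
  intro i
  fin_cases i
  · simpa using hε
  · simpa [dist_eq_norm] using hvp x hx
  · simpa [dist_eq_norm] using hwq x hx

/-- On the unit sphere of `ℝᵐ` with `m % 4 = 2`, there are no two continuous fields which are
linearly independent modulo the radial direction. -/
theorem not_linearIndependent_fields {m : ℕ} (hm : m % 4 = 2)
    {v w : EuclideanSpace ℝ (Fin m) → EuclideanSpace ℝ (Fin m)}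
    (hv : ContinuousOn v {x | ‖x‖ = 1}) (hw : ContinuousOn w {x | ‖x‖ = 1})
    (h : ∀ x, ‖x‖ = 1 → LinearIndependent ℝ ![x, v x, w x]) : False := by
  have : NeZero m := ⟨by omega⟩
  obtain ⟨p, q, hp, hq, hpq⟩ := exists_contDiff_linearIndependent hv hw h
  set n : EuclideanSpace ℝ (Fin m) → EuclideanSpace ℝ (Fin m) := fun x => ‖x‖⁻¹ • x with hn
  have hnorm : ContDiffOn ℝ ∞ (fun x : EuclideanSpace ℝ (Fin m) => ‖x‖⁻¹) {0}ᶜ :=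
    (contDiffOn_id.norm ℝ fun x hx => hx).inv fun x hx => norm_ne_zero_iff.2 hx
  have hns : ContDiffOn ℝ ∞ n {0}ᶜ := hnorm.smul contDiffOn_id
  have hn1 : ∀ x ∈ ({0}ᶜ : Set (EuclideanSpace ℝ (Fin m))), ‖n x‖ = 1 := fun x hx => by
    rw [hn, norm_smul, norm_inv, norm_norm, inv_mul_cancel₀ (norm_ne_zero_iff.2 hx)]
  have hnx : ∀ x, ‖x‖ = 1 → n x = x := fun x hx => by simp [hn, hx]
  have hmem : ∀ x : EuclideanSpace ℝ (Fin m), ‖x‖ = 1 →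
      x ∈ ({0}ᶜ : Set (EuclideanSpace ℝ (Fin m))) := fun x hx => ne_zero_of_norm_eq_one hx
  set P := fun x => p (n x) with hP
  set Q := fun x => q (n x) with hQ
  have hPs : ContDiffOn ℝ ∞ P {0}ᶜ := hp.comp_contDiffOn hns
  have hQs : ContDiffOn ℝ ∞ Q {0}ᶜ := hq.comp_contDiffOn hns
  have hli : ∀ x ∈ ({0}ᶜ : Set (EuclideanSpace ℝ (Fin m))),
      ∀ α β γ : ℝ, α • n x + β • P x + γ • Q x = 0 → α = 0 ∧ β = 0 ∧ γ = 0 := fun x hx =>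
    linearIndependent_triple_iff.1 (hpq (n x) (hn1 x hx))
  set A := fun x => P x - ⟪n x, P x⟫_ℝ • n x with hA
  have hAs : ContDiffOn ℝ ∞ A {0}ᶜ := hPs.sub ((hns.inner ℝ hPs).smul hns)
  have hA0 : ∀ x ∈ ({0}ᶜ : Set (EuclideanSpace ℝ (Fin m))), A x ≠ 0 := fun x hx h0 => by
    have := (hli x hx (-⟪n x, P x⟫_ℝ) 1 0 (by rw [← h0, hA]; module)).2.1
    exact one_ne_zero this
  set a := fun x => ‖A x‖⁻¹ • A x with ha
  have has : ContDiffOn ℝ ∞ a {0}ᶜ :=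
    ((hAs.norm ℝ hA0).inv fun x hx => norm_ne_zero_iff.2 (hA0 x hx)).smul hAs
  have ha1 : ∀ x ∈ ({0}ᶜ : Set (EuclideanSpace ℝ (Fin m))), ‖a x‖ = 1 := fun x hx => by
    rw [ha, norm_smul, norm_inv, norm_norm, inv_mul_cancel₀ (norm_ne_zero_iff.2 (hA0 x hx))]
  have hna : ∀ x ∈ ({0}ᶜ : Set (EuclideanSpace ℝ (Fin m))), ⟪n x, a x⟫_ℝ = 0 := fun x hx => by
    rw [ha, hA, real_inner_smul_right, inner_sub_right, real_inner_smul_right,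
      real_inner_self_eq_norm_sq, hn1 x hx]
    ring
  set B := fun x => Q x - ⟪n x, Q x⟫_ℝ • n x - ⟪a x, Q x⟫_ℝ • a x with hB
  have hBs : ContDiffOn ℝ ∞ B {0}ᶜ :=
    (hQs.sub ((hns.inner ℝ hQs).smul hns)).sub ((has.inner ℝ hQs).smul has)
  have hB0 : ∀ x ∈ ({0}ᶜ : Set (EuclideanSpace ℝ (Fin m))), B x ≠ 0 := fun x hx h0 => by
    have := (hli x hx (-⟪n x, Q x⟫_ℝ + ⟪a x, Q x⟫_ℝ * ‖A x‖⁻¹ * ⟪n x, P x⟫_ℝ)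
      (-⟪a x, Q x⟫_ℝ * ‖A x‖⁻¹) 1 (by
        rw [← h0]
        simp only [hB]
        have : a x = ‖A x‖⁻¹ • (P x - ⟪n x, P x⟫_ℝ • n x) := rfl
        generalize ⟪a x, Q x⟫_ℝ = t
        rw [this]
        module)).2.2
    exact one_ne_zero this
  set b := fun x => ‖B x‖⁻¹ • B x with hb
  have hbs : ContDiffOn ℝ ∞ b {0}ᶜ :=
    ((hBs.norm ℝ hB0).inv fun x hx => norm_ne_zero_iff.2 (hB0 x hx)).smul hBs
  have hb1 : ∀ x ∈ ({0}ᶜ : Set (EuclideanSpace ℝ (Fin m))), ‖b x‖ = 1 := fun x hx => by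
    rw [hb, norm_smul, norm_inv, norm_norm, inv_mul_cancel₀ (norm_ne_zero_iff.2 (hB0 x hx))]
  have hnb : ∀ x ∈ ({0}ᶜ : Set (EuclideanSpace ℝ (Fin m))), ⟪n x, b x⟫_ℝ = 0 := fun x hx => by
    simp only [hb, hB]
    rw [real_inner_smul_right, inner_sub_right, inner_sub_right, real_inner_smul_right (n x) (n x),
      real_inner_smul_right (n x) (a x), real_inner_self_eq_norm_sq, hn1 x hx, hna x hx]
    ring
  have hab : ∀ x ∈ ({0}ᶜ : Set (EuclideanSpace ℝ (Fin m))), ⟪a x, b x⟫_ℝ = 0 := fun x hx => by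
    simp only [hb, hB]
    rw [real_inner_smul_right, inner_sub_right, inner_sub_right, real_inner_smul_right (a x) (n x),
      real_inner_smul_right (a x) (a x), real_inner_self_eq_norm_sq, ha1 x hx,
      real_inner_comm (n x) (a x), hna x hx]
    ring
  exact (FockModel.model hm).false_of_frame (by omega) has hbs
    (fun x hx => by rw [← hna x (hmem x hx), hnx x hx])
    (fun x hx => by rw [← hnb x (hmem x hx), hnx x hx])
    (fun x hx => hab x (hmem x hx)) (fun x hx => ha1 x (hmem x hx))
    (fun x hx => hb1 x (hmem x hx))

theorem not_linearIndependent_fields_of_finrank {V : Type*} [NormedAddCommGroup V]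
    [InnerProductSpace ℝ V] [FiniteDimensional ℝ V] (hm : Module.finrank ℝ V % 4 = 2)
    {v w : V → V} (hv : ContinuousOn v {x | ‖x‖ = 1}) (hw : ContinuousOn w {x | ‖x‖ = 1})
    (h : ∀ x, ‖x‖ = 1 → LinearIndependent ℝ ![x, v x, w x]) : False := by
  let φ := (stdOrthonormalBasis ℝ V).repr
  have hφ : MapsTo φ.symm {x | ‖x‖ = 1} {x | ‖x‖ = 1} := fun x hx => by
    simpa using hx
  refine not_linearIndependent_fields hm (v := fun x => φ (v (φ.symm x)))
    (w := fun x => φ (w (φ.symm x)))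
    (φ.continuous.comp_continuousOn (hv.comp φ.symm.continuous.continuousOn hφ))
    (φ.continuous.comp_continuousOn (hw.comp φ.symm.continuous.continuousOn hφ)) fun x hx => ?_
  have := linearIndependent_triple_map (h (φ.symm x) (hφ hx)) φ.toLinearEquiv
  simpa using this

end

theorem norm_fst_sq {E : Type*} [NormedAddCommGroup E] {p : WithLp 2 (E × ℝ)} (hp : ‖p‖ = 1) :
    ‖p.fst‖ ^ 2 = 1 - p.snd ^ 2 := by
  have := WithLp.prod_norm_sq_eq_of_L2 p
  rw [hp, Real.norm_eq_abs, sq_abs] at this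
  linarith

section

variable {E : Type*} [NormedAddCommGroup E] [InnerProductSpace ℝ E]

/-- The point of `E × ℝ` obtained from `v` by the reflection (up to sign) that exchanges the pole
`(0, σ)` and `p`. -/
noncomputable def poleRefl (σ : ℝ) (p : WithLp 2 (E × ℝ)) (v : E) : WithLp 2 (E × ℝ) :=
  WithLp.toLp 2 (v - (⟪v, p.fst⟫_ℝ / (1 + σ * p.snd)) • p.fst, -σ * ⟪v, p.fst⟫_ℝ)

theorem linearIndependent_poleRefl {σ : ℝ} (hσ : σ * σ = 1) {p : WithLp 2 (E × ℝ)} (hp : ‖p‖ = 1)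
    (hps : 1 + σ * p.snd ≠ 0) {a b : E} (hab : LinearIndependent ℝ ![a, b]) :
    LinearIndependent ℝ ![p, poleRefl σ p a, poleRefl σ p b] := by
  rw [linearIndependent_triple_iff]
  intro α β γ h
  rw [LinearIndependent.pair_iff] at hab
  have hy := norm_fst_sq hp
  have h1 := congrArg (fun q => q.fst) h
  have h2 := congrArg (fun q => q.snd) h
  simp only [poleRefl, WithLp.add_fst, WithLp.smul_fst, WithLp.add_snd, WithLp.smul_snd,
    WithLp.toLp_fst, WithLp.toLp_snd, WithLp.zero_fst, WithLp.zero_snd, smul_eq_mul] at h1 h2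
  set z := β • a + γ • b with hz
  have hzy : ⟪z, p.fst⟫_ℝ = β * ⟪a, p.fst⟫_ℝ + γ * ⟪b, p.fst⟫_ℝ := by
    rw [hz, inner_add_left, real_inner_smul_left, real_inner_smul_left]
  have h3 : ⟪z, p.fst⟫_ℝ = α * (σ * p.snd) := by
    rw [hzy]; linear_combination (-σ) * h2 - (β * ⟪a, p.fst⟫_ℝ + γ * ⟪b, p.fst⟫_ℝ) * hσ
  have h4 : z = (⟪z, p.fst⟫_ℝ / (1 + σ * p.snd) - α) • p.fst := by
    rw [hzy, hz]
    linear_combination (norm := module) h1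
  have h5 : ⟪z, p.fst⟫_ℝ = (⟪z, p.fst⟫_ℝ / (1 + σ * p.snd) - α) * (1 - (σ * p.snd) ^ 2) := by
    conv_lhs => rw [h4]
    rw [real_inner_smul_left, real_inner_self_eq_norm_sq, hy]
    linear_combination ((⟪z, p.fst⟫_ℝ / (1 + σ * p.snd) - α) * p.snd ^ 2) * hσ
  have hα : α = 0 := by
    rw [h3] at h5
    field_simp at h5
    have h6 : α * (1 + σ * p.snd) = 0 := by linear_combination h5
    simpa [hps] using h6
  have hz0 : z = 0 := by rw [h4, h3, hα]; simp
  exact ⟨hα, hab β γ hz0⟩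

theorem poleRefl_reflection {p : WithLp 2 (E × ℝ)} (hp : ‖p‖ = 1) (h1 : 1 + p.snd ≠ 0)
    (h2 : 1 - p.snd ≠ 0) (v : E) :
    poleRefl 1 p (v - (2 * ⟪‖p.fst‖⁻¹ • p.fst, v⟫_ℝ) • (‖p.fst‖⁻¹ • p.fst)) =
      poleRefl (-1) p v := by
  have hy := norm_fst_sq hp
  have hy' : ‖p.fst‖⁻¹ ^ 2 = ((1 + p.snd) * (1 - p.snd))⁻¹ := by
    rw [inv_pow, hy]; congr 1; ring
  have h3 : v - (2 * ⟪‖p.fst‖⁻¹ • p.fst, v⟫_ℝ) • (‖p.fst‖⁻¹ • p.fst) =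
      v - (2 * ⟪v, p.fst⟫_ℝ * ((1 + p.snd) * (1 - p.snd))⁻¹) • p.fst := by
    rw [← hy', real_inner_smul_left, smul_smul, real_inner_comm]
    congr 2
    ring
  have h4 : ⟪v - (2 * ⟪v, p.fst⟫_ℝ * ((1 + p.snd) * (1 - p.snd))⁻¹) • p.fst, p.fst⟫_ℝ =
      -⟪v, p.fst⟫_ℝ := by
    rw [inner_sub_left, real_inner_smul_left, real_inner_self_eq_norm_sq, hy]
    field_simp
    ring
  have h5 : 2 * ⟪v, p.fst⟫_ℝ * ((1 + p.snd) * (1 - p.snd))⁻¹ + -⟪v, p.fst⟫_ℝ / (1 + 1 * p.snd) =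
      ⟪v, p.fst⟫_ℝ / (1 + -1 * p.snd) := by
    rw [one_mul, neg_one_mul, ← sub_eq_add_neg 1 p.snd]
    field_simp
    ring
  have h6 : -1 * -⟪v, p.fst⟫_ℝ = -(-1) * ⟪v, p.fst⟫_ℝ := by ring
  rw [h3, poleRefl, poleRefl, h4, sub_sub, ← add_smul, h5, h6]

theorem continuousAt_poleRefl {X : Type*} [TopologicalSpace X] {σ : ℝ} {f : X → WithLp 2 (E × ℝ)}
    {g : X → E} {x : X} (hf : ContinuousAt f x) (hg : ContinuousAt g x)
    (h : 1 + σ * (f x).snd ≠ 0) : ContinuousAt (fun x => poleRefl σ (f x) (g x)) x := by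
  have h1 : ContinuousAt (fun x => (f x).fst) x := by fun_prop
  have h2 : ContinuousAt (fun x => (f x).snd) x := by fun_prop
  refine (WithLp.prod_continuous_toLp 2 E ℝ).continuousAt.comp (ContinuousAt.prodMk ?_ ?_)
  · exact hg.sub (((ContinuousAt.inner (𝕜 := ℝ) hg h1).div
      (continuousAt_const.add (continuousAt_const.mul h2)) h).smul h1)
  · exact continuousAt_const.mul (ContinuousAt.inner (𝕜 := ℝ) hg h1)

/-- The unit vector in the direction of `y`, or `y₀` if `y = 0`. -/
noncomputable def directionOr (y₀ : Metric.sphere (0 : E) 1) (y : E) : Metric.sphere (0 : E) 1 :=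
  open scoped Classical in
  if h : y = 0 then y₀ else ⟨‖y‖⁻¹ • y, by
    rw [mem_sphere_zero_iff_norm, norm_smul, norm_inv, norm_norm,
      inv_mul_cancel₀ (norm_ne_zero_iff.2 h)]⟩

theorem coe_directionOr (y₀ : Metric.sphere (0 : E) 1) {y : E} (hy : y ≠ 0) :
    (directionOr y₀ y : E) = ‖y‖⁻¹ • y := by
  simp [directionOr, hy]

theorem continuousAt_directionOr (y₀ : Metric.sphere (0 : E) 1) {y : E} (hy : y ≠ 0) :
    ContinuousAt (directionOr y₀) y := by
  rw [Topology.IsEmbedding.subtypeVal.isInducing.continuousAt_iff]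
  have h : ContinuousAt (fun y : E => ‖y‖⁻¹ • y) y :=
    (continuousAt_id.norm.inv₀ (norm_ne_zero_iff.2 hy)).smul continuousAt_id
  refine h.congr ?_
  filter_upwards [isOpen_ne.mem_nhds hy] with z hz
  exact (coe_directionOr y₀ hz).symm

/-- The tangent field on the unit sphere of `E × ℝ` that is the constant `c` in a trivialisation
over the lower hemisphere and is given by `K` in a trivialisation over the upper hemisphere. -/
noncomputable def clutchField (y₀ : Metric.sphere (0 : E) 1) (c : E)
    (K : ℝ × Metric.sphere (0 : E) 1 → E) (p : WithLp 2 (E × ℝ)) : WithLp 2 (E × ℝ) :=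
  open scoped Classical in
  if p.snd < 0 then poleRefl (-1) p c else poleRefl 1 p (K (3 * p.snd, directionOr y₀ p.fst))

theorem continuousOn_clutchField (y₀ : Metric.sphere (0 : E) 1) {c k : E}
    {K : ℝ × Metric.sphere (0 : E) 1 → E} (hK : Continuous K)
    (hc : ∀ t y, t ≤ 0 → K (t, y) = c - (2 * ⟪(y : E), c⟫_ℝ) • (y : E))
    (hk : ∀ t y, 2 ≤ t → K (t, y) = k) :
    ContinuousOn (clutchField y₀ c K) {x | ‖x‖ = 1} := by
  intro p hp
  have hfst : Continuous fun q : WithLp 2 (E × ℝ) => q.fst := by fun_prop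
  have hsnd : Continuous fun q : WithLp 2 (E × ℝ) => q.snd := by fun_prop
  rcases lt_or_ge p.snd 0 with hs | hs
  · refine ContinuousAt.continuousWithinAt ?_
    have h1 : ContinuousAt (fun q => poleRefl (-1) q c) p :=
      continuousAt_poleRefl continuousAt_id continuousAt_const (by dsimp; linarith)
    refine h1.congr ?_
    filter_upwards [(isOpen_Iio.preimage hsnd).mem_nhds hs] with q hq
    exact (if_pos hq).symm
  by_cases hy : p.fst = 0
  · have hs1 : p.snd = 1 := by
      have := norm_fst_sq hp
      rw [hy, norm_zero] at this
      nlinarith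
    refine ContinuousAt.continuousWithinAt ?_
    have h1 : ContinuousAt (fun q => poleRefl 1 q k) p :=
      continuousAt_poleRefl continuousAt_id continuousAt_const (by dsimp; linarith)
    refine h1.congr ?_
    have hs2 : p.snd ∈ Ioi (2 / 3 : ℝ) := by rw [hs1, mem_Ioi]; norm_num
    filter_upwards [(isOpen_Ioi.preimage hsnd).mem_nhds hs2] with q hq
    have hq' : 2 / 3 < q.snd := hq
    rw [clutchField, if_neg (by linarith), hk _ _ (by linarith)]
  · have h1 : ContinuousAt (fun q => poleRefl 1 q (K (3 * q.snd, directionOr y₀ q.fst))) p := by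
      refine continuousAt_poleRefl continuousAt_id (hK.continuousAt.comp ?_) (by dsimp; linarith)
      refine ContinuousAt.prodMk (by fun_prop) ?_
      exact ContinuousAt.comp (f := fun q : WithLp 2 (E × ℝ) => q.fst)
        (continuousAt_directionOr y₀ hy) hfst.continuousAt
    have hs2 : p.snd ∈ Ioi (-1 : ℝ) := by rw [mem_Ioi]; linarith
    refine h1.continuousWithinAt.congr_of_eventuallyEq_of_mem ?_ hp
    filter_upwards [self_mem_nhdsWithin,
      nhdsWithin_le_nhds ((isOpen_Ioi.preimage hsnd).mem_nhds hs2),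
      nhdsWithin_le_nhds ((isOpen_ne.preimage hfst).mem_nhds hy)] with q hq hq1 hqy
    have hq2 : -1 < q.snd := hq1
    have hqy' : q.fst ≠ 0 := hqy
    rcases lt_or_ge q.snd 0 with hq3 | hq3
    · rw [clutchField, if_pos hq3, hc _ _ (by linarith), coe_directionOr y₀ hqy',
        poleRefl_reflection hq (by linarith) (by linarith)]
    · rw [clutchField, if_neg (by linarith)]

theorem false_of_clutchFields [FiniteDimensional ℝ E] (hm : Module.finrank ℝ E % 4 = 1)
    (y₀ : Metric.sphere (0 : E) 1) {c₁ c₂ k₁ k₂ : E} {K₁ K₂ : ℝ × Metric.sphere (0 : E) 1 → E}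
    (hK₁ : Continuous K₁) (hK₂ : Continuous K₂)
    (hc₁ : ∀ t y, t ≤ 0 → K₁ (t, y) = c₁ - (2 * ⟪(y : E), c₁⟫_ℝ) • (y : E))
    (hc₂ : ∀ t y, t ≤ 0 → K₂ (t, y) = c₂ - (2 * ⟪(y : E), c₂⟫_ℝ) • (y : E))
    (hk₁ : ∀ t y, 2 ≤ t → K₁ (t, y) = k₁) (hk₂ : ∀ t y, 2 ≤ t → K₂ (t, y) = k₂)
    (hK : ∀ q, LinearIndependent ℝ ![K₁ q, K₂ q]) : False := by
  have hV : Module.finrank ℝ (WithLp 2 (E × ℝ)) % 4 = 2 := by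
    rw [(WithLp.linearEquiv 2 ℝ (E × ℝ)).finrank_eq, Module.finrank_prod, Module.finrank_self]
    omega
  have hc : LinearIndependent ℝ ![c₁, c₂] := by
    have h0 := hK (0, y₀)
    rw [LinearIndependent.pair_iff] at h0 ⊢
    intro a b hab
    refine h0 a b ?_
    have h1 : a * ⟪(y₀ : E), c₁⟫_ℝ + b * ⟪(y₀ : E), c₂⟫_ℝ = 0 := by
      rw [← real_inner_smul_right, ← real_inner_smul_right, ← inner_add_right, hab,
        inner_zero_right]
    rw [hc₁ _ _ le_rfl, hc₂ _ _ le_rfl]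
    have h2 : (a * ⟪(y₀ : E), c₁⟫_ℝ + b * ⟪(y₀ : E), c₂⟫_ℝ) • (y₀ : E) = 0 := by
      rw [h1, zero_smul]
    linear_combination (norm := module) hab - (2 : ℝ) • h2
  refine not_linearIndependent_fields_of_finrank hV (continuousOn_clutchField y₀ hK₁ hc₁ hk₁)
    (continuousOn_clutchField y₀ hK₂ hc₂ hk₂) fun p hp => ?_
  by_cases hs : p.snd < 0
  · rw [clutchField, clutchField, if_pos hs, if_pos hs]
    exact linearIndependent_poleRefl (by norm_num) hp (by linarith) hc
  · rw [clutchField, clutchField, if_neg hs, if_neg hs]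
    exact linearIndependent_poleRefl (by norm_num) hp (by linarith) (hK _)

end

section

theorem charMatrix_mulVec {n : ℕ} (x : EuclideanSpace ℝ (Fin n)) {v c : Fin n → ℝ}
    (hv : ∀ i, (if i.val = 0 then (-1 : ℝ) else 1) * v i = c i) :
    WithLp.toLp 2 (Matrix.mulVec (charMatrix n x) v) =
      WithLp.toLp 2 c - (2 * ⟪x, WithLp.toLp 2 c⟫_ℝ) • x := by
  have h1 : Matrix.mulVec (Matrix.diagonal fun i : Fin n => if i.val = 0 then (-1 : ℝ) else 1) v =
      c := by
    ext i
    rw [Matrix.mulVec_diagonal, hv]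
  rw [charMatrix, ← Matrix.mulVec_mulVec, h1, Matrix.sub_mulVec, Matrix.one_mulVec,
    Matrix.smul_mulVec, Matrix.vecMulVec_mulVec]
  ext i
  simp [PiLp.inner_apply, dotProduct, mul_comm]
  ring

theorem dotProduct_mulVec_of_mem_SOSet {n : ℕ} {A : Matrix (Fin n) (Fin n) ℝ} (hA : A ∈ SOSet n)
    (v w : Fin n → ℝ) : A.mulVec v ⬝ᵥ A.mulVec w = v ⬝ᵥ w := by
  have h : A.transpose * A = 1 := mul_eq_one_comm.1 hA.1
  rw [Matrix.dotProduct_mulVec, Matrix.vecMul_mulVec, h, Matrix.vecMul_one]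

theorem linearIndependent_pair_of_apply {ι : Type*} {e v : ι → ℝ} {i : ι} (he : e i = 1)
    (hvi : v i = 0) (hv : v ≠ 0) : LinearIndependent ℝ ![e, v] := by
  rw [LinearIndependent.pair_iff]
  intro a b hab
  have ha : a = 0 := by simpa [he, hvi] using congrFun hab i
  rw [ha, zero_smul, zero_add, smul_eq_zero] at hab
  exact ⟨ha, hab.resolve_right hv⟩

theorem add_smul_neg_sub_ne_zero {ι : Type*} [Fintype ι] {v w : ι → ℝ} (hv : v ⬝ᵥ v = 1)
    (hw : w ⬝ᵥ w = 1) (h : v ≠ w) (s : ℝ) : v + s • (-w - v) ≠ 0 := by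
  intro h0
  have h1 : (1 - s) • v = s • w := by linear_combination (norm := module) h0
  have h2 := congrArg (fun z => z ⬝ᵥ z) h1
  simp only [smul_dotProduct, dotProduct_smul, hv, hw, smul_eq_mul, mul_one] at h2
  have hs : s = 1 / 2 := by linarith
  refine h (smul_right_injective _ (by norm_num : (1 / 2 : ℝ) ≠ 0) ?_)
  rw [hs] at h1
  convert h1 using 2
  norm_num

theorem linearIndependent_toLp {ι : Type*} {v w : ι → ℝ} :
    LinearIndependent ℝ ![WithLp.toLp 2 v, WithLp.toLp 2 w] ↔ LinearIndependent ℝ ![v, w] := by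
  simp only [LinearIndependent.pair_iff, ← WithLp.toLp_smul, ← WithLp.toLp_add,
    WithLp.toLp_eq_zero]

end

/-- For n ≡ 1 (mod 4), n ≥ 5: if the structure group of Sⁿ reduces to a closed connected
subgroup G' of the standard SO(n−1) ⊆ SO(n) (the matrices in SO(n) fixing the first
standard basis vector), then G' acts transitively on the sphere S^{n-2}. -/
theorem reduced_group_acts_transitively
    {n : ℕ} (hn : 5 ≤ n) (hmod : n % 4 = 1)
    (G' : Set (Matrix (Fin n) (Fin n) ℝ))
    (hGcl : IsClosed G') (hGconn : IsConnected G')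
    (h1 : (1 : Matrix (Fin n) (Fin n) ℝ) ∈ G')
    (hmul : ∀ A ∈ G', ∀ B ∈ G', A * B ∈ G')
    (hinv : ∀ A ∈ G', A⁻¹ ∈ G')
    (hGSO : G' ⊆ SOSet n)
    (hGfix : ∀ A ∈ G',
      A.mulVec (fun j : Fin n => if j = (⟨0, by omega⟩ : Fin n) then 1 else 0) =
        fun j : Fin n => if j = (⟨0, by omega⟩ : Fin n) then 1 else 0)
    (hred : SphereStructureGroupReducesTo n G') :
    ∀ u w : Fin n → ℝ,
      (∑ i, u i ^ 2) = 1 → u (⟨0, by omega⟩ : Fin n) = 0 →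
      (∑ i, w i ^ 2) = 1 → w (⟨0, by omega⟩ : Fin n) = 0 →
      ∃ A ∈ G', A.mulVec u = w := by
  intro u w hu hu0 hw hw0
  by_contra! hne
  obtain ⟨χ, g, hχ, hg, ⟨H⟩⟩ := hred
  set i₀ : Fin n := ⟨0, by omega⟩ with hi₀
  set e : Fin n → ℝ := fun j => if j = i₀ then 1 else 0 with he
  have he₀ : e i₀ = 1 := if_pos rfl
  have hes : e = Pi.single i₀ 1 := by
    ext j
    rw [he, Pi.single_apply]
  have huu : u ⬝ᵥ u = 1 := by simpa only [dotProduct, ← sq] using hu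
  have hww : w ⬝ᵥ w = 1 := by simpa only [dotProduct, ← sq] using hw
  have hune : u ≠ 0 := fun h => by simp [h] at huu
  have hval : ∀ j : Fin n, j.val = 0 ↔ j = i₀ := fun j => by rw [hi₀, Fin.ext_iff]
  let K₁ : ℝ × Metric.sphere (0 : EuclideanSpace ℝ (Fin n)) 1 → EuclideanSpace ℝ (Fin n) :=
    fun q => WithLp.toLp 2 ((H (projIcc 0 1 zero_le_one q.1, q.2)).mulVec e)
  let K₂ : ℝ × Metric.sphere (0 : EuclideanSpace ℝ (Fin n)) 1 → EuclideanSpace ℝ (Fin n) :=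
    fun q => WithLp.toLp 2 ((H (projIcc 0 1 zero_le_one q.1, q.2)).mulVec u +
      (projIcc (0 : ℝ) 1 zero_le_one (q.1 - 1) : ℝ) • (-w - (g q.2).mulVec u))
  have hH : Continuous fun q : ℝ × Metric.sphere (0 : EuclideanSpace ℝ (Fin n)) 1 =>
      H (projIcc 0 1 zero_le_one q.1, q.2) :=
    H.continuous.comp ((continuous_projIcc.comp continuous_fst).prodMk continuous_snd)
  have hL : Continuous (WithLp.toLp 2 : (Fin n → ℝ) → EuclideanSpace ℝ (Fin n)) :=
    PiLp.continuous_toLp 2 _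
  have hK₁ : Continuous K₁ := hL.comp (hH.matrix_mulVec continuous_const)
  have hK₂ : Continuous K₂ := by
    have h1 : Continuous fun q : ℝ × Metric.sphere (0 : EuclideanSpace ℝ (Fin n)) 1 =>
        (projIcc (0 : ℝ) 1 zero_le_one (q.1 - 1) : ℝ) :=
      continuous_subtype_val.comp (continuous_projIcc.comp (continuous_fst.sub continuous_const))
    have h2 : Continuous fun q : ℝ × Metric.sphere (0 : EuclideanSpace ℝ (Fin n)) 1 =>
        -w - (g q.2).mulVec u :=
      continuous_const.sub ((g.continuous.comp continuous_snd).matrix_mulVec continuous_const)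
    exact hL.comp ((hH.matrix_mulVec continuous_const).add (h1.smul h2))
  have hge : ∀ y, (g y).mulVec e = e := fun y => hGfix _ (hg y)
  have hgu₀ : ∀ y, (g y).mulVec u i₀ = 0 := fun y => by
    have h := dotProduct_mulVec_of_mem_SOSet (hGSO (hg y)) e u
    rwa [hge, hes, single_one_dotProduct, single_one_dotProduct, hu0] at h
  have hgu : ∀ y, (g y).mulVec u ⬝ᵥ (g y).mulVec u = 1 := fun y => by
    rw [dotProduct_mulVec_of_mem_SOSet (hGSO (hg y)), huu]
  refine false_of_clutchFields (E := EuclideanSpace ℝ (Fin n)) (c₁ := WithLp.toLp 2 (-e))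
    (c₂ := WithLp.toLp 2 u) (k₁ := WithLp.toLp 2 e) (k₂ := WithLp.toLp 2 (-w)) (by simpa using hmod)
    ⟨WithLp.toLp 2 u, ?_⟩ hK₁ hK₂ (fun t y ht => ?_) (fun t y ht => ?_) (fun t y ht => ?_)
    (fun t y ht => ?_) fun ⟨t, y⟩ => ?_
  · rw [mem_sphere_zero_iff_norm, EuclideanSpace.norm_eq]
    simp [hu]
  · simp only [K₁]
    rw [projIcc_of_le_left _ ht]
    erw [H.apply_zero]
    rw [hχ]
    refine charMatrix_mulVec _ fun j => ?_
    by_cases hj : j = i₀ <;> simp [hval, he, hj]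
  · simp only [K₂]
    rw [projIcc_of_le_left _ ht, projIcc_of_le_left _ (by linarith)]
    erw [H.apply_zero]
    rw [hχ, zero_smul, add_zero]
    refine charMatrix_mulVec _ fun j => ?_
    by_cases hj : j = i₀ <;> simp [hval, hj, hu0]
  · simp only [K₁]
    rw [projIcc_of_right_le _ (by linarith)]
    erw [H.apply_one]
    rw [hge]
  · simp only [K₂]
    rw [projIcc_of_right_le _ (by linarith), projIcc_of_right_le _ (by linarith)]
    erw [H.apply_one]
    rw [one_smul, add_sub_cancel]
  · simp only [K₁, K₂]
    rw [linearIndependent_toLp]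
    rcases le_total t 1 with ht | ht
    · rw [projIcc_of_le_left (x := t - 1) _ (by linarith)]
      rw [zero_smul, add_zero]
      have hinj := Matrix.mulVec_injective_iff_isUnit.2 (H.prop (projIcc 0 1 zero_le_one t) y)
      have hlin := linearIndependent_pair_of_apply he₀ hu0 hune
      rw [LinearIndependent.pair_iff] at hlin ⊢
      refine fun a b hab => hlin a b (hinj ?_)
      rw [Matrix.mulVec_add, Matrix.mulVec_smul, Matrix.mulVec_smul, Matrix.mulVec_zero]
      exact hab
    · rw [projIcc_of_right_le _ ht]
      erw [H.apply_one]
      rw [hge]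
      refine linearIndependent_pair_of_apply he₀ ?_
        (add_smul_neg_sub_ne_zero (hgu y) hww (hne _ (hg y)) _)
      simp [hgu₀, hw0]
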